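/- Let Ω, Ω' ⊆ ℝⁿ be domains, 1 ≤ q ≤ p < ∞, and φ : Ω → Ω' a homeomorphism. Set 1/σ = 1/q − 1/p (with σ = ∞ when q = p). Then the following are equivalent. (A) There exists K ≥ 0 such that for every locally Lipschitz u : Ω' → ℝ with ∫_{Ω'} ‖∇u(x)‖^p dx < ∞ (where ∇u(x) is the Fréchet derivative of u, defined a.e. by Rademacher's theorem), the composition u∘φ is locally integrable on Ω and has a weak gradient v_u with (∫_Ω ‖v_u‖^q dx)^{1/q} ≤ K·(∫_{Ω'} ‖∇u‖^p dx)^{1/p}. (B) (1) φ ∈ W¹_{q,loc}(Ω;ℝⁿ): there is a locally integrable map Dφ : Ω → (n×n matrices) which is componentwise the weak derivative of φ and whose operator norm ‖Dφ‖ is in L_{q,loc}(Ω); (2) φ has finite distortion: Dφ(x) = 0 for a.e. x ∈ Ω with det Dφ(x) = 0; (3) the outer distortion function K_p(x,φ), equal to ‖Dφ(x)‖ / |det Dφ(x)|^{1/p} when det Dφ(x) ≠ 0 and 0 otherwise, belongs to L_σ(Ω). Moreover, the least constant K in (A) equals ‖K_p(·,φ)‖_{L_σ(Ω)}. -/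

import Mathlib

open MeasureTheory Set
open scoped ENNReal Topology NNReal

noncomputable section

/-- `f` has weak gradient `v` on the open set `Ω ⊆ ℝⁿ`. -/
def HasWeakGradOn {n : ℕ} (f : EuclideanSpace ℝ (Fin n) → ℝ)
    (v : EuclideanSpace ℝ (Fin n) → EuclideanSpace ℝ (Fin n))
    (Ω : Set (EuclideanSpace ℝ (Fin n))) : Prop :=
  LocallyIntegrableOn f Ω volume ∧ LocallyIntegrableOn v Ω volume ∧
    ∀ ψ : EuclideanSpace ℝ (Fin n) → ℝ, ContDiff ℝ (⊤ : ℕ∞) ψ → HasCompactSupport ψ →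
      tsupport ψ ⊆ Ω →
      ∫ x in Ω, f x • gradient ψ x = - ∫ x in Ω, ψ x • v x

/-- `u` is Lipschitz on every compact subset of `Ω'`. -/
def LocLipschitzOn {n : ℕ} (u : EuclideanSpace ℝ (Fin n) → ℝ)
    (Ω' : Set (EuclideanSpace ℝ (Fin n))) : Prop :=
  ∀ K : Set (EuclideanSpace ℝ (Fin n)), K ⊆ Ω' → IsCompact K →
    ∃ C : ℝ≥0, LipschitzOnWith C u K

/-- `φ* : L¹_p(Ω') ∩ Lip_loc(Ω') → L¹_q(Ω)` is bounded with norm at most `K`. -/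
def CompBound {n : ℕ} (p q K : ℝ) (φ : EuclideanSpace ℝ (Fin n) → EuclideanSpace ℝ (Fin n))
    (Ω Ω' : Set (EuclideanSpace ℝ (Fin n))) : Prop :=
  ∀ u : EuclideanSpace ℝ (Fin n) → ℝ, LocLipschitzOn u Ω' →
    IntegrableOn (fun x => ‖gradient u x‖ ^ p) Ω' volume →
    ∃ v, HasWeakGradOn (u ∘ φ) v Ω ∧ IntegrableOn (fun x => ‖v x‖ ^ q) Ω volume ∧
      (∫ x in Ω, ‖v x‖ ^ q) ^ (1/q) ≤ K * (∫ x in Ω', ‖gradient u x‖ ^ p) ^ (1/p)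

/-- `D` is the weak Jacobian matrix of `φ` on `Ω`: the `j`-th row of `D` is the weak
gradient of the `j`-th component of `φ`. -/
def IsWeakJacobian {n : ℕ} (φ : EuclideanSpace ℝ (Fin n) → EuclideanSpace ℝ (Fin n))
    (D : EuclideanSpace ℝ (Fin n) → (EuclideanSpace ℝ (Fin n) →L[ℝ] EuclideanSpace ℝ (Fin n)))
    (Ω : Set (EuclideanSpace ℝ (Fin n))) : Prop :=
  ∀ j : Fin n, HasWeakGradOn (fun x => φ x j)
    (fun x => (WithLp.equiv 2 (Fin n → ℝ)).symm (fun i => D x (EuclideanSpace.single i 1) j)) Ω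

/-- The outer distortion function `K_p(·,φ)` built from the weak Jacobian `D`. -/
def distortionFn {n : ℕ} (p : ℝ)
    (D : EuclideanSpace ℝ (Fin n) → (EuclideanSpace ℝ (Fin n) →L[ℝ] EuclideanSpace ℝ (Fin n)))
    (x : EuclideanSpace ℝ (Fin n)) : ℝ :=
  if LinearMap.det ((D x) : EuclideanSpace ℝ (Fin n) →ₗ[ℝ] EuclideanSpace ℝ (Fin n)) ≠ 0 then
    ‖D x‖ / |LinearMap.det ((D x) : EuclideanSpace ℝ (Fin n) →ₗ[ℝ] EuclideanSpace ℝ (Fin n))| ^ (1/p)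
  else 0

/-- The exponent `σ` with `1/σ = 1/q − 1/p`, equal to `∞` when `q = p`. -/
def sigmaExp (p q : ℝ) : ℝ≥0∞ :=
  if q = p then ⊤ else ENNReal.ofReal (1 / (1/q - 1/p))

section File1

open MeasureTheory Set Metric Filter
open scoped ENNReal Topology NNReal


set_option linter.unusedSectionVars false
section Maximal

variable {E F : Type*} [NormedAddCommGroup E] [NormedSpace ℝ E] [FiniteDimensional ℝ E]
  [MeasurableSpace E] [BorelSpace E] (μ : Measure E) [μ.IsAddHaarMeasure]
  [NormedAddCommGroup F] [NormedSpace ℝ F] [CompleteSpace F]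

/-- points where the local maximal function exceeds `l` -/
def badSet (g : E → ℝ≥0∞) (l : ℝ≥0∞) : Set E :=
  {x | ∃ r : ℝ, 0 < r ∧ r ≤ 1 ∧ l * μ (closedBall x r) < ∫⁻ y in closedBall x r, g y ∂μ}

lemma weak_type (g : E → ℝ≥0∞) (l : ℝ≥0∞) (hl : l ≠ 0) (hl' : l ≠ ⊤) :
    μ (badSet μ g l) ≤ ENNReal.ofReal (4 ^ Module.finrank ℝ E) * (l⁻¹ * ∫⁻ y, g y ∂μ) := by
  classical
  have h : ∀ x : E, ∃ r : ℝ, x ∈ badSet μ g l →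
      0 < r ∧ r ≤ 1 ∧ l * μ (closedBall x r) < ∫⁻ y in closedBall x r, g y ∂μ := by
    intro x
    by_cases hx : x ∈ badSet μ g l
    · obtain ⟨r, hr⟩ := hx
      exact ⟨r, fun _ => hr⟩
    · exact ⟨0, fun h => absurd h hx⟩
  choose r hr using h
  obtain ⟨u, hu, hdisj, hcov⟩ := Vitali.exists_disjoint_subfamily_covering_enlargement_closedBall
    (badSet μ g l) (fun x => x) r 1 (fun a ha => (hr a ha).2.1) 4 (by norm_num)
  have hcount : u.Countable := by
    refine hdisj.countable_of_nonempty_interior ?_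
    intro a ha
    refine ⟨a, ?_⟩
    exact ball_subset_interior_closedBall (mem_ball_self (hr a (hu ha)).1)
  have hsub : badSet μ g l ⊆ ⋃ b ∈ u, closedBall b (4 * r b) := by
    intro a ha
    obtain ⟨b, hb, hab⟩ := hcov a ha
    exact mem_biUnion hb (hab (mem_closedBall_self (hr a ha).1.le))
  have := hcount.to_subtype
  calc μ (badSet μ g l) ≤ μ (⋃ b ∈ u, closedBall b (4 * r b)) := measure_mono hsub
    _ ≤ ∑' b : u, μ (closedBall (b : E) (4 * r b)) := measure_biUnion_le _ hcount _
    _ ≤ ∑' b : u, ENNReal.ofReal (4 ^ Module.finrank ℝ E) *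
          (l⁻¹ * ∫⁻ y in closedBall (b : E) (r b), g y ∂μ) := by
        refine ENNReal.tsum_le_tsum fun b => ?_
        rw [Measure.addHaar_closedBall_mul μ _ (by norm_num : (0:ℝ) ≤ 4) (hr b (hu b.2)).1.le]
        rw [← Measure.addHaar_closedBall_center μ (b : E)]
        gcongr
        have h5 := mul_le_mul_right (hr b (hu b.2)).2.2.le l⁻¹
        rwa [← mul_assoc, ENNReal.inv_mul_cancel hl hl', one_mul] at h5
    _ = ENNReal.ofReal (4 ^ Module.finrank ℝ E) *
          (l⁻¹ * ∑' b : u, ∫⁻ y in closedBall (b : E) (r b), g y ∂μ) := by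
        rw [ENNReal.tsum_mul_left, ENNReal.tsum_mul_left]
    _ ≤ _ := by
        gcongr
        rw [← lintegral_biUnion hcount (fun b _ => measurableSet_closedBall) hdisj]
        exact setLIntegral_le_lintegral _ _

lemma ftc_enorm (g : E → F) (hg : ContDiff ℝ 1 g) (x z : E) :
    ‖g (x + z) - g x‖ₑ ≤ ∫⁻ t in Ioc (0:ℝ) 1, ‖fderiv ℝ g (x + t • z)‖ₑ * ‖z‖ₑ := by
  have hc : Continuous (fderiv ℝ g) := hg.continuous_fderiv one_ne_zero
  have h1 : ∀ t ∈ uIcc (0:ℝ) 1, HasDerivAt (fun t : ℝ => g (x + t • z))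
      (fderiv ℝ g (x + t • z) z) t := by
    intro t _
    have h2 : HasDerivAt (fun t : ℝ => x + t • z) z t := by
      simpa using ((hasDerivAt_id t).smul_const z).const_add x
    exact ((hg.differentiable one_ne_zero).differentiableAt.hasFDerivAt).comp_hasDerivAt t h2
  have h3 := intervalIntegral.integral_eq_sub_of_hasDerivAt h1
    (Continuous.intervalIntegrable (by fun_prop) _ _)
  simp only [one_smul, zero_smul, add_zero] at h3
  rw [← h3, intervalIntegral.integral_of_le zero_le_one]
  refine (enorm_integral_le_lintegral_enorm _).trans ?_
  refine lintegral_mono fun t => ?_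
  exact ContinuousLinearMap.le_opENorm _ _

lemma lintegral_scale (G : E → ℝ≥0∞) (hG : Measurable G) (x : E) (r t : ℝ) (ht : 0 < t) :
    ∫⁻ z in closedBall (0:E) r, G (x + t • z) ∂μ =
      ENNReal.ofReal ((t ^ Module.finrank ℝ E)⁻¹) * ∫⁻ z in closedBall x (t * r), G z ∂μ := by
  have h1 : ∫⁻ z in closedBall x (t * r), G z ∂μ
      = ∫⁻ z, (closedBall (0:E) (t * r)).indicator (fun z => G (x + z)) z ∂μ := by
    rw [← lintegral_indicator measurableSet_closedBall,
      ← lintegral_add_left_eq_self _ x]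
    refine lintegral_congr fun z => ?_
    simp [indicator]
  have hm : Measurable ((closedBall (0:E) (t * r)).indicator (fun z => G (x + z))) :=
    (hG.comp (measurable_const_add x)).indicator measurableSet_closedBall
  have h2 := lintegral_map (μ := μ) hm (measurable_const_smul t)
  rw [Measure.map_addHaar_smul μ ht.ne', lintegral_smul_measure] at h2
  rw [h1, ← abs_of_pos (inv_pos.2 (pow_pos ht (Module.finrank ℝ E)))]
  rw [smul_eq_mul] at h2
  rw [h2, ← lintegral_indicator measurableSet_closedBall]
  refine lintegral_congr fun z => ?_
  simp only [indicator, mem_closedBall, dist_zero_right, norm_smul, Real.norm_eq_abs, abs_of_pos ht,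
    mul_le_mul_iff_right₀ ht]

lemma avg_est (g : E → F) (hg : ContDiff ℝ 1 g) (x : E) (l : ℝ≥0∞)
    (hx : x ∉ badSet μ (fun y => ‖fderiv ℝ g y‖ₑ) l) (r : ℝ) (hr : 0 < r) (hr1 : r ≤ 1) :
    ∫⁻ z in closedBall x r, ‖g z - g x‖ₑ ∂μ ≤ ENNReal.ofReal r * (l * μ (closedBall x r)) := by
  have hc : Continuous (fderiv ℝ g) := hg.continuous_fderiv one_ne_zero
  have hgc : Continuous g := hg.continuous
  have h0 : ∀ s : ℝ, 0 < s → s ≤ 1 →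
      ∫⁻ y in closedBall x s, ‖fderiv ℝ g y‖ₑ ∂μ ≤ l * μ (closedBall x s) := by
    intro s hs hs1
    by_contra h
    exact hx ⟨s, hs, hs1, not_le.1 h⟩
  have hsc := lintegral_scale μ (fun z => ‖g z - g x‖ₑ)
    (hgc.sub continuous_const).enorm.measurable x r 1 one_pos
  simp only [one_smul, one_pow, inv_one, ENNReal.ofReal_one, one_mul] at hsc
  rw [← hsc]
  calc ∫⁻ z in closedBall (0:E) r, ‖g (x + z) - g x‖ₑ ∂μ
      ≤ ∫⁻ z in closedBall (0:E) r, ∫⁻ t in Ioc (0:ℝ) 1,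
          ‖fderiv ℝ g (x + t • z)‖ₑ * ENNReal.ofReal r ∂volume ∂μ := by
        refine setLIntegral_mono' measurableSet_closedBall fun z hz => ?_
        refine (ftc_enorm g hg x z).trans ?_
        refine lintegral_mono fun t => ?_
        gcongr
        rw [← ofReal_norm]
        exact ENNReal.ofReal_le_ofReal (by simpa using hz)
    _ = ∫⁻ t in Ioc (0:ℝ) 1, ∫⁻ z in closedBall (0:E) r,
          ‖fderiv ℝ g (x + t • z)‖ₑ * ENNReal.ofReal r ∂μ := by
        rw [lintegral_lintegral_swap]
        refine Continuous.aemeasurable ?_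
        simp only [Function.uncurry_def]
        refine ENNReal.continuous_mul_const ENNReal.ofReal_ne_top |>.comp ?_
        fun_prop
    _ ≤ ∫⁻ t in Ioc (0:ℝ) 1, ENNReal.ofReal r * (l * μ (closedBall x r)) := by
        refine setLIntegral_mono' measurableSet_Ioc fun t ht => ?_
        rw [lintegral_mul_const' _ _ ENNReal.ofReal_ne_top,
          lintegral_scale μ (fun z => ‖fderiv ℝ g z‖ₑ) hc.enorm.measurable x r t ht.1, mul_comm]
        refine mul_le_mul_right ?_ _
        refine (mul_le_mul_right (h0 (t * r) (mul_pos ht.1 hr) ?_) _).trans ?_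
        · nlinarith [ht.1, ht.2]
        rw [Measure.addHaar_closedBall_mul μ _ ht.1.le hr.le, Measure.addHaar_closedBall_center μ x r]
        rw [mul_left_comm l, ← mul_assoc, ← ENNReal.ofReal_mul (by have := ht.1; positivity)]
        rw [inv_mul_cancel₀ (by have := ht.1; positivity)]
        simp
    _ = _ := by simp

lemma lip_est (g : E → F) (hg : ContDiff ℝ 1 g) (x y : E) (l : ℝ≥0)
    (hx : x ∉ badSet μ (fun y => ‖fderiv ℝ g y‖ₑ) l)
    (hy : y ∉ badSet μ (fun y => ‖fderiv ℝ g y‖ₑ) l)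
    (hxy : dist x y ≤ 1) :
    ‖g x - g y‖ ≤ 2 * 2 ^ Module.finrank ℝ E * l * dist x y := by
  rcases eq_or_ne x y with rfl | hne
  · simp
  set r := dist x y with hr
  have hr0 : 0 < r := dist_pos.2 hne
  have hgc : Continuous g := hg.continuous
  set m := midpoint ℝ x y
  have hmx : dist m x = r / 2 := by
    rw [dist_midpoint_left, ← hr]; simp; ring
  have hmy : dist m y = r / 2 := by
    rw [dist_midpoint_right, ← hr]; simp; ring
  have hSx : closedBall m (r/2) ⊆ closedBall x r := closedBall_subset_closedBall' (by linarith)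
  have hSy : closedBall m (r/2) ⊆ closedBall y r := closedBall_subset_closedBall' (by linarith)
  have e1 : ‖g x - g y‖ₑ * μ (closedBall m (r/2)) ≤
      2 * ENNReal.ofReal r * l * ENNReal.ofReal (2 ^ Module.finrank ℝ E) * μ (closedBall m (r/2)) := by
    calc ‖g x - g y‖ₑ * μ (closedBall m (r/2)) = ∫⁻ z in closedBall m (r/2), ‖g x - g y‖ₑ ∂μ := by simp
      _ ≤ ∫⁻ z in closedBall m (r/2), (‖g z - g x‖ₑ + ‖g z - g y‖ₑ) ∂μ := by
          refine lintegral_mono fun z => ?_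
          have : g x - g y = (g z - g y) - (g z - g x) := by abel
          rw [this, add_comm]
          exact enorm_sub_le
      _ = ∫⁻ z in closedBall m (r/2), ‖g z - g x‖ₑ ∂μ + ∫⁻ z in closedBall m (r/2), ‖g z - g y‖ₑ ∂μ :=
          lintegral_add_left (hgc.sub continuous_const).enorm.measurable _
      _ ≤ ∫⁻ z in closedBall x r, ‖g z - g x‖ₑ ∂μ + ∫⁻ z in closedBall y r, ‖g z - g y‖ₑ ∂μ := by
          gcongr
      _ ≤ ENNReal.ofReal r * (l * μ (closedBall x r)) + ENNReal.ofReal r * (l * μ (closedBall y r)) :=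
          add_le_add (avg_est μ g hg x l hx r hr0 hxy) (avg_est μ g hg y l hy r hr0 hxy)
      _ = _ := by
          have : ∀ w : E, μ (closedBall w r) = ENNReal.ofReal (2 ^ Module.finrank ℝ E) * μ (closedBall m (r/2)) := by
            intro w
            have h := Measure.addHaar_closedBall_mul μ w (by norm_num : (0:ℝ) ≤ 2) (by positivity : 0 ≤ r/2)
            rw [show 2 * (r/2) = r by ring] at h
            rw [h, Measure.addHaar_closedBall_center μ m]
          rw [this x, this y]
          ring
  have hpos : μ (closedBall m (r/2)) ≠ 0 := (measure_closedBall_pos μ m (by positivity)).ne'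
  have htop : μ (closedBall m (r/2)) ≠ ⊤ := measure_closedBall_lt_top.ne
  have e2 := (ENNReal.mul_le_mul_iff_left hpos htop).1 e1
  rw [← ofReal_norm, ← ENNReal.ofReal_coe_nnreal, show (2:ℝ≥0∞) = ENNReal.ofReal 2 by simp,
    ← ENNReal.ofReal_mul (by norm_num), ← ENNReal.ofReal_mul (by positivity), 
    ← ENNReal.ofReal_mul (by positivity), ENNReal.ofReal_le_ofReal_iff (by positivity)] at e2
  linarith

end Maximal

end File1

section File2

open MeasureTheory Set Metric Filter
open scoped ENNReal Topology NNReal Convolution ContDiff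


set_option linter.unusedSectionVars false
section Moll

variable {E F : Type*} [NormedAddCommGroup E] [InnerProductSpace ℝ E] [FiniteDimensional ℝ E]
  [MeasurableSpace E] [BorelSpace E] (μ : Measure E) [μ.IsAddHaarMeasure]
  [NormedAddCommGroup F] [NormedSpace ℝ F] [CompleteSpace F]

/-- `D` is the weak derivative of `f` on `U`. -/
def WD (f : E → F) (D : E → E →L[ℝ] F) (U : Set E) : Prop :=
  ∀ ψ : E → ℝ, ContDiff ℝ ∞ ψ → HasCompactSupport ψ → tsupport ψ ⊆ U → ∀ w : E,
    ∫ x, (fderiv ℝ ψ x w) • f x ∂μ = - ∫ x, ψ x • D x w ∂μ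

variable (E) in
/-- A sequence of bump functions. -/
def bmp (k : ℕ) : ContDiffBump (0 : E) where
  rIn := 1 / ((k : ℝ) + 1)
  rOut := 2 / ((k : ℝ) + 1)
  rIn_pos := by positivity
  rIn_lt_rOut := by gcongr; norm_num

/-- mollification -/
def moll (k : ℕ) (g : E → F) : E → F := (bmp E k).normed μ ⋆[ContinuousLinearMap.lsmul ℝ ℝ, μ] g

variable (E) in
lemma bmp_tendsto : Tendsto (fun k => (bmp E k).rOut) atTop (𝓝 0) := by
  have := (tendsto_one_div_add_atTop_nhds_zero_nat (𝕜 := ℝ)).const_mul 2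
  simp only [mul_zero] at this
  refine this.congr fun k => ?_
  simp [bmp, div_eq_mul_inv]

lemma moll_apply (k : ℕ) (g : E → F) (x : E) :
    moll μ k g x = ∫ t, (bmp E k).normed μ t • g (x - t) ∂μ := by
  simp [moll, convolution_def]

lemma moll_apply' (k : ℕ) (g : E → F) (x : E) :
    moll μ k g x = ∫ t, (bmp E k).normed μ (x - t) • g t ∂μ := by
  simp [moll, convolution_eq_swap]

lemma moll_contDiff (k : ℕ) {g : E → F} (hg : LocallyIntegrable g μ) :
    ContDiff ℝ ∞ (moll μ k g) :=
  ((bmp E k).hasCompactSupport_normed).contDiff_convolution_left _ ((bmp E k).contDiff_normed) hg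

lemma moll_tendsto {g : E → F} (hg : Continuous g) (x : E) :
    Tendsto (fun k => moll μ k g x) atTop (𝓝 (g x)) :=
  ContDiffBump.convolution_tendsto_right_of_continuous (bmp_tendsto E) hg x

lemma moll_ae_tendsto {g : E → F} (hg : LocallyIntegrable g μ) :
    ∀ᵐ x ∂μ, Tendsto (fun k => moll μ k g x) atTop (𝓝 (g x)) := by
  refine ContDiffBump.ae_convolution_tendsto_right_of_locallyIntegrable (bmp_tendsto E) (K := 2) ?_ hg
  refine Eventually.of_forall fun k => ?_
  simp only [bmp]
  apply le_of_eq
  ring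

lemma moll_bound (k : ℕ) {g : E → F} {C : ℝ} (hg : ∀ x, ‖g x‖ ≤ C) (x : E) :
    ‖moll μ k g x‖ ≤ C := by
  rw [moll_apply]
  calc ‖∫ t, (bmp E k).normed μ t • g (x - t) ∂μ‖
      ≤ ∫ t, (bmp E k).normed μ t * C ∂μ := by
        refine norm_integral_le_of_norm_le ((bmp E k).integrable_normed.mul_const C) ?_
        refine Eventually.of_forall fun t => ?_
        rw [norm_smul, Real.norm_of_nonneg ((bmp E k).nonneg_normed t)]
        exact mul_le_mul_of_nonneg_left (hg _) ((bmp E k).nonneg_normed t)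
    _ = C := by rw [integral_mul_const, (bmp E k).integral_normed, one_mul]

lemma moll_integrable (k : ℕ) {g : E → F} (hg : Integrable g μ) : Integrable (moll μ k g) μ :=
  Integrable.integrable_convolution _ (bmp E k).integrable_normed hg

lemma moll_integral_norm (k : ℕ) {g : E → F} (hg : Integrable g μ) :
    ∫ x, ‖moll μ k g x‖ ∂μ ≤ ∫ x, ‖g x‖ ∂μ := by
  have h1 : ∫ x, moll μ k (fun y => ‖g y‖) x ∂μ = ∫ x, ‖g x‖ ∂μ := by
    rw [moll, integral_convolution _ (bmp E k).integrable_normed hg.norm]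
    simp [(bmp E k).integral_normed]
  rw [← h1]
  refine integral_mono (moll_integrable μ k hg).norm (moll_integrable μ k hg.norm) fun x => ?_
  simp only [moll_apply]
  refine (norm_integral_le_integral_norm _).trans (le_of_eq ?_)
  refine integral_congr_ae (Eventually.of_forall fun t => ?_)
  simp only [norm_smul, Real.norm_of_nonneg ((bmp E k).nonneg_normed t), smul_eq_mul]

lemma moll_L1 {g : E → F} (hg : Integrable g μ) :
    Tendsto (fun k => ∫ x, ‖moll μ k g x - g x‖ ∂μ) atTop (𝓝 0) := by
  have h1 : Tendsto (fun k => ∫ x, (‖moll μ k g x - g x‖ - ‖moll μ k g x‖) ∂μ) atTop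
      (𝓝 (∫ x, -‖g x‖ ∂μ)) := by
    refine tendsto_integral_of_dominated_convergence (fun x => ‖g x‖) ?_ hg.norm ?_ ?_
    · intro k
      exact (((moll_integrable μ k hg).sub hg).norm.sub (moll_integrable μ k hg).norm).aestronglyMeasurable
    · intro k
      refine Eventually.of_forall fun x => ?_
      have := abs_norm_sub_norm_le (moll μ k g x - g x) (moll μ k g x)
      simpa using this
    · filter_upwards [moll_ae_tendsto μ hg.locallyIntegrable] with x hx
      have h2 := ((hx.sub_const (g x)).norm).sub hx.norm
      simpa using h2
  have h2 : Tendsto (fun k => ∫ x, (‖moll μ k g x - g x‖ - ‖moll μ k g x‖) ∂μ + ∫ x, ‖g x‖ ∂μ) atTop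
      (𝓝 0) := by
    have := h1.add_const (∫ x, ‖g x‖ ∂μ)
    rwa [integral_neg, neg_add_cancel] at this
  refine squeeze_zero (fun k => integral_nonneg fun x => norm_nonneg _) (fun k => ?_) h2
  have i0 : Integrable (fun x => ‖moll μ k g x - g x‖) μ := ((moll_integrable μ k hg).sub hg).norm
  rw [integral_sub i0 (moll_integrable μ k hg).norm]
  linarith [moll_integral_norm μ k hg]

lemma moll_hasFDerivAt (k : ℕ) {f : E → F} {D : E → E →L[ℝ] F} (hf : LocallyIntegrable f μ)
    (hD : LocallyIntegrable D μ) (h : WD μ f D univ) (x : E) :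
    HasFDerivAt (moll μ k f) (moll μ k D x) x := by
  have h1 := ((bmp E k).hasCompactSupport_normed (μ := μ)).hasFDerivAt_convolution_left
    (ContinuousLinearMap.lsmul ℝ ℝ) (((bmp E k).contDiff_normed (n := 1))) hf x
  suffices key : moll μ k D x = (fderiv ℝ ((bmp E k).normed μ)
      ⋆[(ContinuousLinearMap.lsmul ℝ ℝ : ℝ →L[ℝ] F →L[ℝ] F).precompL E, μ] f) x by
    rw [key]; exact h1
  ext w
  set ρ := (bmp E k).normed μ
  have hρ : ContDiff ℝ ∞ ρ := (bmp E k).contDiff_normed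
  have hρc : HasCompactSupport ρ := (bmp E k).hasCompactSupport_normed
  have hψs : ContDiff ℝ ∞ (fun s => ρ (x - s)) := hρ.comp (contDiff_const.sub contDiff_id)
  have hψc : HasCompactSupport (fun s => ρ (x - s)) :=
    hρc.comp_homeomorph (Homeomorph.subLeft x)
  have h2 := h _ hψs hψc (subset_univ _) w
  have hder : ∀ s, fderiv ℝ (fun s => ρ (x - s)) s w = - fderiv ℝ ρ (x - s) w := by
    intro s
    have e : HasFDerivAt (fun s : E => x - s) (-(ContinuousLinearMap.id ℝ E)) s := by
      simpa using (hasFDerivAt_id s).const_sub x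
    have := ((hρ.differentiable (by simp)).differentiableAt (x := x - s)).hasFDerivAt.comp s e
    rw [show (fun s => ρ (x - s)) = ρ ∘ (fun s => x - s) from rfl, this.fderiv]
    simp
  simp only [hder, neg_smul, integral_neg, neg_inj] at h2
  rw [moll_apply', convolution_eq_swap]
  have i1 : Integrable (fun t => ρ (x - t) • D t) μ :=
    hD.integrable_smul_left_of_hasCompactSupport hψs.continuous hψc
  rw [ContinuousLinearMap.integral_apply i1]
  have i2 : Integrable (fun t => ((ContinuousLinearMap.lsmul ℝ ℝ).precompL E
      (fderiv ℝ ρ (x - t))) (f t)) μ := by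
    have := ((hρc.fderiv ℝ).convolutionExists_left ((ContinuousLinearMap.lsmul ℝ ℝ :
      ℝ →L[ℝ] F →L[ℝ] F).precompL E) (hρ.continuous_fderiv (by simp)) hf x)
    exact this.integrable_swap
  rw [ContinuousLinearMap.integral_apply i2]
  simpa [ContinuousLinearMap.precompL_apply] using h2.symm

theorem good_sets {f : E → F} {D : E → E →L[ℝ] F} (hf : Continuous f)
    (hD : Integrable D μ) (h : WD μ f D univ) :
    ∃ A : ℕ → Set E, (∀ m, MeasurableSet (A m)) ∧ μ (⋃ m, A m)ᶜ = 0 ∧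
      ∀ m, ∀ x ∈ A m, HasFDerivWithinAt f (D x) (A m) x := by
  have hfl : LocallyIntegrable f μ := hf.locallyIntegrable
  have hsub : ∀ j : ℕ, ∃ k : ℕ, j ≤ k ∧ ∫ x, ‖moll μ k D x - D x‖ ∂μ ≤ (1/4) ^ j := by
    intro j
    obtain ⟨k, hk⟩ := (((moll_L1 μ hD).eventually (ge_mem_nhds (by positivity : (0:ℝ) < (1/4)^j))).and
      (eventually_ge_atTop j)).exists
    exact ⟨k, hk.2, hk.1⟩
  choose κ hκ hκ1 using hsub
  have hκt : Tendsto κ atTop atTop := tendsto_atTop_mono hκ tendsto_id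
  set fj : ℕ → E → F := fun j => moll μ (κ j) f
  set Dj : ℕ → E → E →L[ℝ] F := fun j => moll μ (κ j) D
  have hfj : ∀ j x, HasFDerivAt (fj j) (Dj j x) x :=
    fun j x => moll_hasFDerivAt μ (κ j) hfl hD.locallyIntegrable h x
  have hfs : ∀ j, ContDiff ℝ 1 (fj j) := fun j => (moll_contDiff μ (κ j) hfl).of_le (by simp)
  have hDji : ∀ j, Integrable (Dj j) μ := fun j => moll_integrable μ _ hD
  set g : ℕ → E → F := fun j x => fj (j+1) x - fj j x
  have hgs : ∀ j, ContDiff ℝ 1 (g j) := fun j => (hfs (j+1)).sub (hfs j)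
  have hgd : ∀ j x, fderiv ℝ (g j) x = Dj (j+1) x - Dj j x :=
    fun j x => ((hfj (j+1) x).sub (hfj j x)).fderiv
  set bad : ℕ → Set E := fun j =>
    badSet μ (fun y => ‖fderiv ℝ (g j) y‖ₑ) ((((1/2) ^ j : ℝ≥0)) : ℝ≥0∞)
  have hInt0 : ∀ j, ∫⁻ y, ‖fderiv ℝ (g j) y‖ₑ ∂μ ≤ ENNReal.ofReal (2 * (1/4)^j) := by
    intro j
    simp only [hgd]
    have i1 : Integrable (fun x => Dj (j+1) x - Dj j x) μ := ((hDji (j+1)).sub (hDji j))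
    rw [← ofReal_integral_norm_eq_lintegral_enorm i1]
    refine ENNReal.ofReal_le_ofReal ?_
    calc ∫ x, ‖Dj (j+1) x - Dj j x‖ ∂μ ≤ ∫ x, (‖Dj (j+1) x - D x‖ + ‖Dj j x - D x‖) ∂μ := by
          refine integral_mono i1.norm (((hDji (j+1)).sub hD).norm.add ((hDji j).sub hD).norm) fun x => ?_
          have : Dj (j+1) x - Dj j x = (Dj (j+1) x - D x) - (Dj j x - D x) := by abel
          simp only [this]
          exact norm_sub_le _ _
      _ = ∫ x, ‖Dj (j+1) x - D x‖ ∂μ + ∫ x, ‖Dj j x - D x‖ ∂μ :=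
          integral_add ((hDji (j+1)).sub hD).norm ((hDji j).sub hD).norm
      _ ≤ (1/4)^(j+1) + (1/4)^j := add_le_add (hκ1 _) (hκ1 _)
      _ ≤ 2 * (1/4)^j := by
          rw [pow_succ]
          have : (0:ℝ) ≤ (1/4)^j := by positivity
          linarith
  have hbad : ∀ j, μ (bad j) ≤ ENNReal.ofReal (4 ^ Module.finrank ℝ E * 2) * (ENNReal.ofReal (1/2)) ^ j := by
    intro j
    refine (weak_type μ _ _ (by simp) (by simp)).trans ?_
    rw [ENNReal.ofReal_mul (by positivity), mul_assoc]
    refine mul_le_mul_right ?_ _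
    refine (mul_le_mul_right (hInt0 j) _).trans (le_of_eq ?_)
    rw [← ENNReal.ofReal_coe_nnreal, ← ENNReal.ofReal_inv_of_pos (by positivity),
      ← ENNReal.ofReal_mul (by positivity), ← ENNReal.ofReal_pow (by positivity),
      ← ENNReal.ofReal_mul (by positivity)]
    congr 1
    push_cast
    rw [show (1/4:ℝ) = (1/2)*(1/2) by norm_num, mul_pow]
    field_simp
  have hsum : ∑' j, μ (toMeasurable μ (bad j)) ≠ ⊤ := by
    refine ne_top_of_le_ne_top ?_ (ENNReal.tsum_le_tsum fun j => (measure_toMeasurable (bad j)).le.trans (hbad j))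
    rw [ENNReal.tsum_mul_left, ENNReal.tsum_geometric]
    refine ENNReal.mul_ne_top ENNReal.ofReal_ne_top ?_
    refine ENNReal.inv_ne_top.2 ?_
    refine (tsub_pos_of_lt ?_).ne'
    rw [← ENNReal.ofReal_one]
    exact (ENNReal.ofReal_lt_ofReal_iff (by norm_num)).2 (by norm_num)
  have hls := measure_limsup_atTop_eq_zero hsum
  have hae : ∀ᵐ x ∂μ, Tendsto (fun j => Dj j x) atTop (𝓝 (D x)) := by
    filter_upwards [moll_ae_tendsto μ hD.locallyIntegrable] with x hx
    exact hx.comp hκt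
  set Z := toMeasurable μ {x | ¬ Tendsto (fun j => Dj j x) atTop (𝓝 (D x))}
  have hZ : μ Z = 0 := by
    rw [measure_toMeasurable]; exact hae
  refine ⟨fun m => (⋃ j ≥ m, toMeasurable μ (bad j))ᶜ ∩ Zᶜ, ?_, ?_, ?_⟩
  · intro m
    refine MeasurableSet.inter (MeasurableSet.compl ?_) (measurableSet_toMeasurable _ _).compl
    exact MeasurableSet.biUnion (to_countable _) fun j _ => measurableSet_toMeasurable _ _
  · refine measure_mono_null ?_ (measure_union_null hls hZ)
    intro x hx
    simp only [mem_compl_iff, mem_iUnion, not_exists, mem_inter_iff, not_and] at hx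
    by_cases hxZ : x ∈ Z
    · exact Or.inr hxZ
    left
    rw [Filter.limsup_eq_iInf_iSup_of_nat]
    simp only [iInf_eq_iInter, iSup_eq_iUnion, mem_iInter]
    intro m
    by_contra hcon
    exact hx m (by simpa using hcon) hxZ
  · intro m x hx
    set C : ℝ := 2 * 2 ^ Module.finrank ℝ E with hC
    have hC0 : 0 < C := by positivity
    have hnb : ∀ y ∈ (⋃ j ≥ m, toMeasurable μ (bad j))ᶜ ∩ Zᶜ, ∀ j ≥ m, y ∉ bad j := by
      intro y hy j hj hyb
      exact hy.1 (mem_biUnion (s := {j | j ≥ m}) hj (subset_toMeasurable _ _ hyb))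
    have hxZ : Tendsto (fun j => Dj j x) atTop (𝓝 (D x)) := by
      by_contra hcon
      exact hx.2 (subset_toMeasurable _ _ hcon)
    -- telescoping
    have htel : ∀ y ∈ (⋃ j ≥ m, toMeasurable μ (bad j))ᶜ ∩ Zᶜ, dist y x ≤ 1 → ∀ j ≥ m,
        ‖(f y - f x) - (fj j y - fj j x)‖ ≤ C * 2 * (1/2)^j * dist y x := by
      intro y hy hd j hj
      have hstep : ∀ i ≥ m, ‖g i y - g i x‖ ≤ C * (1/2)^i * dist y x := by
        intro i hi
        have := lip_est μ (g i) (hgs i) y x ((1/2)^i) (hnb y hy i hi) (hnb x hx i hi) hd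
        simpa [hC] using this
      have hpart : ∀ N, ‖(fj (j+N) y - fj (j+N) x) - (fj j y - fj j x)‖ ≤
          C * 2 * ((1/2)^j - (1/2)^(j+N)) * dist y x := by
        intro N
        induction N with
        | zero => simp
        | succ N ih =>
          have e : (fj (j+(N+1)) y - fj (j+(N+1)) x) - (fj j y - fj j x) =
            (g (j+N) y - g (j+N) x) + ((fj (j+N) y - fj (j+N) x) - (fj j y - fj j x)) := by
            simp only [g, add_assoc]; abel
          rw [e]
          refine (norm_add_le _ _).trans ((add_le_add (hstep (j+N) (by omega)) ih).trans (le_of_eq ?_))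
          rw [← add_assoc, pow_succ]
          ring
      have hl : ∀ z, Tendsto (fun N => fj (j+N) z) atTop (𝓝 (f z)) := by
        intro z
        refine (moll_tendsto μ hf z).comp (hκt.comp ?_)
        exact tendsto_atTop_mono (fun N => Nat.le_add_left N j) tendsto_id
      have hlim := (((hl y).sub (hl x)).sub_const (fj j y - fj j x)).norm
      refine le_of_tendsto hlim (Eventually.of_forall fun N => (hpart N).trans ?_)
      gcongr
      have : (0:ℝ) ≤ (1/2)^(j+N) := by positivity
      linarith
    rw [hasFDerivWithinAt_iff_isLittleO, Asymptotics.isLittleO_iff]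
    intro c hc
    have hev : ∀ᶠ j in atTop, C * 2 * (1/2)^j ≤ c/3 ∧ ‖Dj j x - D x‖ ≤ c/3 ∧ m ≤ j := by
      have t1 : Tendsto (fun j : ℕ => C * 2 * (1/2:ℝ)^j) atTop (𝓝 0) := by
        have := (tendsto_pow_atTop_nhds_zero_of_lt_one (by norm_num : (0:ℝ) ≤ 1/2) (by norm_num)).const_mul (C*2)
        simpa using this
      have t2 : Tendsto (fun j => ‖Dj j x - D x‖) atTop (𝓝 0) := by
        simpa using (hxZ.sub_const (D x)).norm
      exact (t1.eventually (ge_mem_nhds (by positivity))).and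
        ((t2.eventually (ge_mem_nhds (by positivity))).and (eventually_ge_atTop m))
    obtain ⟨j, hj1, hj2, hj3⟩ := hev.exists
    have hdj := (hasFDerivAt_iff_isLittleO.1 (hfj j x))
    rw [Asymptotics.isLittleO_iff] at hdj
    have hdj' := hdj (by positivity : 0 < c/3)
    filter_upwards [self_mem_nhdsWithin, mem_nhdsWithin_of_mem_nhds hdj',
      mem_nhdsWithin_of_mem_nhds (closedBall_mem_nhds x one_pos)] with y hy hy2 hy3
    have h1 := htel y hy hy3 j hj3
    have e : f y - f x - D x (y - x) = ((f y - f x) - (fj j y - fj j x)) +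
      (fj j y - fj j x - Dj j x (y - x)) + (Dj j x - D x) (y - x) := by
      simp only [_root_.sub_apply]; abel
    rw [e]
    have h3 : ‖(Dj j x - D x) (y - x)‖ ≤ c/3 * ‖y - x‖ :=
      (ContinuousLinearMap.le_opNorm _ _).trans (by gcongr)
    have h4 : C * 2 * (1/2)^j * dist y x ≤ c/3 * ‖y - x‖ := by rw [dist_eq_norm]; gcongr
    have h5 : ‖fj j y - fj j x - Dj j x (y - x)‖ ≤ c/3 * ‖y-x‖ := hy2
    calc _ ≤ _ := norm_add₃_le
      _ ≤ c/3 * ‖y-x‖ + c/3 * ‖y-x‖ + c/3 * ‖y-x‖ := by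
        gcongr
        exact h1.trans h4
      _ = _ := by ring

end Moll

end File2

section File3

open MeasureTheory Set Metric Filter
open scoped ENNReal Topology NNReal Convolution ContDiff


set_option linter.unusedSectionVars false
section Loc

variable {E F : Type*} [NormedAddCommGroup E] [InnerProductSpace ℝ E] [FiniteDimensional ℝ E]
  [MeasurableSpace E] [BorelSpace E] {μ : Measure E} [μ.IsAddHaarMeasure]
  [NormedAddCommGroup F] [NormedSpace ℝ F] [CompleteSpace F]

lemma int_smul {f : E → F} {U : Set E} (hf : LocallyIntegrableOn f U μ) {ψ : E → ℝ}
    (hψ : Continuous ψ) (hc : HasCompactSupport ψ) (hs : tsupport ψ ⊆ U) :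
    Integrable (fun x => ψ x • f x) μ := by
  have h1 : IntegrableOn f (tsupport ψ) μ := hf.integrableOn_compact_subset hs hc
  have h2 : IntegrableOn (fun x => ψ x • f x) (tsupport ψ) μ :=
    h1.continuousOn_smul hψ.continuousOn hc
  rwa [integrableOn_iff_integrable_of_support_subset] at h2
  intro x hx
  apply subset_tsupport
  intro h0
  simp [h0] at hx

lemma int_fderiv_smul {f : E → F} {U : Set E} (hf : LocallyIntegrableOn f U μ) {ψ : E → ℝ}
    (hψ : ContDiff ℝ ∞ ψ) (hc : HasCompactSupport ψ) (hs : tsupport ψ ⊆ U) (w : E) :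
    Integrable (fun x => (fderiv ℝ ψ x w) • f x) μ := by
  have hsub : tsupport (fun x => fderiv ℝ ψ x w) ⊆ tsupport ψ := by
    refine (closure_mono ?_).trans (tsupport_fderiv_subset ℝ (f := ψ))
    intro x hx h0
    simp [h0] at hx
  refine int_smul hf ?_ ?_ (hsub.trans hs)
  · exact ((hψ.continuous_fderiv (by simp)).clm_apply continuous_const)
  · exact hc.of_isClosed_subset (isClosed_tsupport _) hsub

lemma int_smul_clm {D : E → E →L[ℝ] F} {U : Set E} (hf : LocallyIntegrableOn D U μ) {ψ : E → ℝ}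
    (hψ : Continuous ψ) (hc : HasCompactSupport ψ) (hs : tsupport ψ ⊆ U) (w : E) :
    Integrable (fun x => ψ x • D x w) μ := by
  have h1 := (int_smul hf hψ hc hs).apply_continuousLinearMap w
  simpa using h1

lemma WD.cutoff {f : E → F} {D : E → E →L[ℝ] F} {U : Set E} (h : WD μ f D U)
    (hf : LocallyIntegrableOn f U μ) (hD : LocallyIntegrableOn D U μ)
    {χ : E → ℝ} (hχ : ContDiff ℝ ∞ χ) (hc : HasCompactSupport χ) (hs : tsupport χ ⊆ U) :
    WD μ (fun x => χ x • f x) (fun x => χ x • D x + (fderiv ℝ χ x).smulRight (f x)) univ := by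
  intro ψ hψ hψc _ w
  have ht : tsupport (fun x => ψ x * χ x) ⊆ tsupport χ := tsupport_mul_subset_right
  have htc : HasCompactSupport (fun x => ψ x * χ x) := hc.mul_left
  have h1 := h (fun x => ψ x * χ x) (hψ.mul hχ) htc (ht.trans hs) w
  have hd : ∀ x, fderiv ℝ (fun x => ψ x * χ x) x w = ψ x * fderiv ℝ χ x w + χ x * fderiv ℝ ψ x w := by
    intro x
    have a := ((hψ.differentiable (by simp)) x).hasFDerivAt
    have b := ((hχ.differentiable (by simp)) x).hasFDerivAt
    change fderiv ℝ (ψ * χ) x w = _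
    rw [(a.mul b).fderiv]
    simp
  have i1 := int_fderiv_smul hf hχ hc hs w
  have ic : Integrable (fun x => (ψ x * χ x) • D x w) μ :=
    int_smul_clm hD (hψ.continuous.mul hχ.continuous) htc (ht.trans hs) w
  have ia : Integrable (fun x => (ψ x * fderiv ℝ χ x w) • f x) μ := by
    have hsub : tsupport (fun x => ψ x * fderiv ℝ χ x w) ⊆ tsupport χ := by
      refine (closure_mono ?_).trans (tsupport_fderiv_subset ℝ (f := χ))
      intro x hx h0
      simp [h0] at hx
    refine int_smul hf ?_ (hc.of_isClosed_subset (isClosed_tsupport _) hsub) (hsub.trans hs)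
    exact hψ.continuous.mul ((hχ.continuous_fderiv (by simp)).clm_apply continuous_const)
  have ib : Integrable (fun x => (χ x * fderiv ℝ ψ x w) • f x) μ := by
    have hsub : tsupport (fun x => χ x * fderiv ℝ ψ x w) ⊆ tsupport χ := tsupport_mul_subset_left
    refine int_smul hf ?_ (hc.of_isClosed_subset (isClosed_tsupport _) hsub) (hsub.trans hs)
    exact hχ.continuous.mul ((hψ.continuous_fderiv (by simp)).clm_apply continuous_const)
  simp only [hd, add_smul] at h1
  rw [integral_add ia ib] at h1
  have e1 : ∫ x, (fderiv ℝ ψ x w) • χ x • f x ∂μ = ∫ x, (χ x * fderiv ℝ ψ x w) • f x ∂μ := by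
    congr 1; ext x; rw [smul_smul, mul_comm]
  have e2 : ∫ x, ψ x • (χ x • D x + (fderiv ℝ χ x).smulRight (f x)) w ∂μ =
      ∫ x, (ψ x * χ x) • D x w ∂μ + ∫ x, (ψ x * fderiv ℝ χ x w) • f x ∂μ := by
    rw [← integral_add ic ia]
    congr 1; ext x
    simp [smul_smul]
  rw [e1, e2, neg_add, ← h1]
  abel

lemma cutoff_integrable {f : E → F} {D : E → E →L[ℝ] F} {U : Set E}
    (hf : LocallyIntegrableOn f U μ) (hD : LocallyIntegrableOn D U μ)
    {χ : E → ℝ} (hχ : ContDiff ℝ ∞ χ) (hc : HasCompactSupport χ) (hs : tsupport χ ⊆ U) :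
    Integrable (fun x => χ x • D x + (fderiv ℝ χ x).smulRight (f x)) μ := by
  refine (int_smul hD hχ.continuous hc hs).add ?_
  have h1 : IntegrableOn f (tsupport χ) μ := hf.integrableOn_compact_subset hs hc
  obtain ⟨C, hC⟩ := (hc.fderiv ℝ).exists_bound_of_continuous (hχ.continuous_fderiv (by simp))
  have h2 : IntegrableOn (fun x => (fderiv ℝ χ x).smulRight (f x)) (tsupport χ) μ := by
    refine Integrable.mono' (h1.norm.const_mul C) ?_ (Eventually.of_forall fun x => ?_)
    · have hcd : Continuous (fderiv ℝ χ) := hχ.continuous_fderiv (by simp)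
      exact ((ContinuousLinearMap.smulRightL ℝ E F).continuous₂).comp_aestronglyMeasurable₂
        hcd.aestronglyMeasurable h1.aestronglyMeasurable
    · rw [ContinuousLinearMap.norm_smulRight_apply]
      gcongr
      exact hC x
  refine (integrableOn_iff_integrable_of_support_subset ?_).1 h2
  intro x hx
  apply tsupport_fderiv_subset ℝ (f := χ)
  apply subset_tsupport
  intro h0
  apply hx
  ext w
  simp [h0]

lemma cutoff_continuous {f : E → F} {U : Set E} (hU : IsOpen U) (hf : ContinuousOn f U)
    {χ : E → ℝ} (hχ : Continuous χ) (hs : tsupport χ ⊆ U) :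
    Continuous (fun x => χ x • f x) := by
  refine ContinuousOn.continuous_of_tsupport_subset (hχ.continuousOn.smul hf) hU ?_
  exact (tsupport_smul_subset_left χ f).trans hs

theorem good_sets_loc {f : E → F} {D : E → E →L[ℝ] F} {U : Set E} (hU : IsOpen U)
    (hf : ContinuousOn f U) (hD : LocallyIntegrableOn D U μ) (h : WD μ f D U) :
    ∃ A : ℕ → Set E, (∀ m, MeasurableSet (A m)) ∧ (∀ m, A m ⊆ U) ∧ μ (U \ ⋃ m, A m) = 0 ∧
      ∀ m, ∀ x ∈ A m, HasFDerivWithinAt f (D x) (A m) x := by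
  have hfl : LocallyIntegrableOn f U μ := hf.locallyIntegrableOn hU.measurableSet
  have hb : ∀ x : U, ∃ χ : ContDiffBump (x : E), closedBall (x:E) χ.rOut ⊆ U := by
    intro x
    obtain ⟨ε, hε, hεU⟩ := Metric.isOpen_iff.1 hU x x.2
    exact ⟨⟨ε/4, ε/2, by positivity, by linarith⟩,
      (closedBall_subset_ball (by simp; linarith)).trans hεU⟩
  choose χ hχ using hb
  have hA : ∀ x : U, ∃ A : ℕ → Set E, (∀ m, MeasurableSet (A m)) ∧ μ (⋃ m, A m)ᶜ = 0 ∧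
      ∀ m, ∀ y ∈ A m, HasFDerivWithinAt (fun z => χ x z • f z)
        (χ x y • D y + (fderiv ℝ (χ x) y).smulRight (f y)) (A m) y := by
    intro x
    have ts : tsupport (χ x) ⊆ U := by rw [(χ x).tsupport_eq]; exact hχ x
    exact good_sets μ (cutoff_continuous hU hf (χ x).continuous ts)
      (cutoff_integrable hfl hD (χ x).contDiff (χ x).hasCompactSupport ts)
      (h.cutoff hfl hD (χ x).contDiff (χ x).hasCompactSupport ts)
  choose A hAm hAn hAd using hA
  obtain ⟨T, hT, hTU⟩ := TopologicalSpace.isOpen_iUnion_countable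
    (fun x : U => ball (x:E) (χ x).rIn) (fun x => isOpen_ball)
  have hcov : U ⊆ ⋃ x ∈ T, ball (x:E) (χ x).rIn := by
    rw [hTU]
    intro x hx
    exact mem_iUnion.2 ⟨⟨x, hx⟩, mem_ball_self (χ _).rIn_pos⟩
  have hrU : ∀ x : U, ball (x:E) (χ x).rIn ⊆ U := fun x =>
    ((ball_subset_ball (χ x).rIn_lt_rOut.le).trans ball_subset_closedBall).trans (hχ x)
  have key : ∀ x : U, ∀ m, ∀ y ∈ A x m ∩ ball (x:E) (χ x).rIn,
      HasFDerivWithinAt f (D y) (A x m ∩ ball (x:E) (χ x).rIn) y := by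
    intro x m y hy
    have e1 : (χ x : E → ℝ) =ᶠ[𝓝 y] fun _ => 1 := by
      filter_upwards [isOpen_ball.mem_nhds hy.2] with z hz
      exact (χ x).one_of_mem_closedBall (ball_subset_closedBall hz)
    have h1 := (hAd x m y hy.1).mono (inter_subset_left (t := ball (x:E) (χ x).rIn))
    have e2 : fderiv ℝ (χ x) y = 0 := by rw [e1.fderiv_eq]; simp
    have e3 : χ x y = 1 := e1.eq_of_nhds
    rw [e2, e3] at h1
    have e4 : (0 : E →L[ℝ] ℝ).smulRight (f y) = 0 := by ext; simp
    rw [one_smul, e4, add_zero] at h1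
    refine h1.congr (fun z hz => ?_) ?_
    · simp [(χ x).one_of_mem_closedBall (ball_subset_closedBall hz.2)]
    · simp [e3]
  rcases T.eq_empty_or_nonempty with hTe | hTne
  · refine ⟨fun _ => ∅, by simp, by simp, ?_, by simp⟩
    have : U = ∅ := by simpa [hTe] using hcov
    simp [this]
  obtain ⟨t, ht⟩ := hT.exists_eq_range hTne
  refine ⟨fun i => A (t i.unpair.1) i.unpair.2 ∩ ball (t i.unpair.1 : E) (χ (t i.unpair.1)).rIn,
    fun i => (hAm _ _).inter measurableSet_ball, fun i => inter_subset_right.trans (hrU _), ?_,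
    fun i => key _ _⟩
  have : U \ (⋃ i : ℕ, A (t i.unpair.1) i.unpair.2 ∩ ball (t i.unpair.1 : E) (χ (t i.unpair.1)).rIn)
      ⊆ ⋃ i, (⋃ m, A (t i) m)ᶜ := by
    rintro y ⟨hyU, hy⟩
    obtain ⟨x, hxT, hyx⟩ := mem_iUnion₂.1 (hcov hyU)
    rw [ht] at hxT
    obtain ⟨i, rfl⟩ := hxT
    refine mem_iUnion.2 ⟨i, fun hy2 => ?_⟩
    obtain ⟨m, hm⟩ := mem_iUnion.1 hy2
    exact hy (mem_iUnion.2 ⟨Nat.pair i m, by rw [Nat.unpair_pair]; exact ⟨hm, hyx⟩⟩)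
  exact measure_mono_null this (measure_iUnion_null fun i => hAn _)

end Loc

end File3

section File4

open MeasureTheory Set Metric Filter
open scoped ENNReal Topology NNReal Convolution ContDiff


set_option linter.unusedSectionVars false
section Conv

variable {n : ℕ}


lemma inner_gradient_eq (ψ : (EuclideanSpace ℝ (Fin n)) → ℝ) (x w : EuclideanSpace ℝ (Fin n)) : inner ℝ (gradient ψ x) w = fderiv ℝ ψ x w := by
  simp [gradient]

lemma norm_gradient_eq (ψ : (EuclideanSpace ℝ (Fin n)) → ℝ) (x : EuclideanSpace ℝ (Fin n)) : ‖gradient ψ x‖ = ‖fderiv ℝ ψ x‖ := by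
  simp [gradient]

lemma weakgrad_iff_aux {f : (EuclideanSpace ℝ (Fin n)) → ℝ} {v : (EuclideanSpace ℝ (Fin n)) → (EuclideanSpace ℝ (Fin n))} {Ω : Set (EuclideanSpace ℝ (Fin n))}
    (hf : LocallyIntegrableOn f Ω volume)
    (hv : LocallyIntegrableOn v Ω volume) (ψ : (EuclideanSpace ℝ (Fin n)) → ℝ) (hψ : ContDiff ℝ ∞ ψ)
    (hc : HasCompactSupport ψ) (hs : tsupport ψ ⊆ Ω) :
    (∫ x in Ω, f x • gradient ψ x = - ∫ x in Ω, ψ x • v x) ↔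
     ∀ w : EuclideanSpace ℝ (Fin n), ∫ x, (fderiv ℝ ψ x w) • f x = - ∫ x, ψ x • (innerSL ℝ (v x)) w := by
  have hgc : Continuous (gradient ψ) :=
    (LinearIsometryEquiv.continuous _).comp (hψ.continuous_fderiv (by simp))
  have hg0 : ∀ x, x ∉ tsupport ψ → gradient ψ x = 0 := by
    intro x hx
    have : fderiv ℝ ψ x = 0 := by
      by_contra h
      exact hx (tsupport_fderiv_subset ℝ (subset_tsupport _ h))
    simp [gradient, this]
  have hgs : HasCompactSupport (gradient ψ) := by
    refine HasCompactSupport.intro hc hg0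
  have i1 : Integrable (fun x => f x • gradient ψ x) := by
    have h1 : IntegrableOn f (tsupport ψ) volume := hf.integrableOn_compact_subset hs hc
    obtain ⟨C, hC⟩ := hgs.exists_bound_of_continuous hgc
    have h2 : IntegrableOn (fun x => f x • gradient ψ x) (tsupport ψ) volume := by
      refine Integrable.mono' (h1.norm.mul_const C) (h1.aestronglyMeasurable.smul
        hgc.aestronglyMeasurable) (Eventually.of_forall fun x => ?_)
      rw [norm_smul]
      gcongr
      exact hC x
    refine (integrableOn_iff_integrable_of_support_subset ?_).1 h2
    intro x hx
    by_contra h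
    simp [hg0 x h] at hx
  have i2 : Integrable (fun x => ψ x • v x) := int_smul hv hψ.continuous hc hs
  have e1 : ∫ x in Ω, f x • gradient ψ x = ∫ x, f x • gradient ψ x := by
    refine setIntegral_eq_integral_of_forall_compl_eq_zero fun x hx => ?_
    rw [hg0 x (fun h => hx (hs h)), smul_zero]
  have e2 : ∫ x in Ω, ψ x • v x = ∫ x, ψ x • v x := by
    refine setIntegral_eq_integral_of_forall_compl_eq_zero fun x hx => ?_
    rw [image_eq_zero_of_notMem_tsupport (fun h => hx (hs h)), zero_smul]
  have e3 : ∀ w : EuclideanSpace ℝ (Fin n), ∫ x, (fderiv ℝ ψ x w) • f x = inner ℝ w (∫ x, f x • gradient ψ x) := by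
    intro w
    rw [← integral_inner i1]
    congr 1; ext x
    rw [inner_smul_right, real_inner_comm, inner_gradient_eq, smul_eq_mul, mul_comm]
  have e4 : ∀ w : EuclideanSpace ℝ (Fin n), ∫ x, ψ x • (innerSL ℝ (v x)) w = inner ℝ w (∫ x, ψ x • v x) := by
    intro w
    rw [← integral_inner i2]
    congr 1; ext x
    rw [inner_smul_right, real_inner_comm, smul_eq_mul, innerSL_apply_apply]
  rw [e1, e2]
  simp only [e3, e4]
  constructor
  · intro h w
    rw [h, inner_neg_right]
  · intro h
    refine ext_inner_left ℝ fun w => ?_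
    rw [h, inner_neg_right]

lemma HasWeakGradOn.wd {f : (EuclideanSpace ℝ (Fin n)) → ℝ} {v : (EuclideanSpace ℝ (Fin n)) → (EuclideanSpace ℝ (Fin n))} {Ω : Set (EuclideanSpace ℝ (Fin n))}
    (h : HasWeakGradOn f v Ω) : WD volume f (fun x => innerSL ℝ (v x)) Ω := by
  intro ψ hψ hc hs w
  exact (weakgrad_iff_aux h.1 h.2.1 ψ hψ hc hs).1 (h.2.2 ψ hψ hc hs) w

lemma HasWeakGradOn.of_wd {f : (EuclideanSpace ℝ (Fin n)) → ℝ} {v : (EuclideanSpace ℝ (Fin n)) → (EuclideanSpace ℝ (Fin n))} {Ω : Set (EuclideanSpace ℝ (Fin n))}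
    (hf : LocallyIntegrableOn f Ω volume) (hv : LocallyIntegrableOn v Ω volume)
    (h : WD volume f (fun x => innerSL ℝ (v x)) Ω) : HasWeakGradOn f v Ω :=
  ⟨hf, hv, fun ψ hψ hc hs => (weakgrad_iff_aux hf hv ψ hψ hc hs).2 (h ψ hψ hc hs)⟩

/-- rows -/
def rowOf (A : (EuclideanSpace ℝ (Fin n)) →L[ℝ] (EuclideanSpace ℝ (Fin n))) (j : Fin n) : EuclideanSpace ℝ (Fin n) :=
  (WithLp.equiv 2 (Fin n → ℝ)).symm (fun i => A (EuclideanSpace.single i 1) j)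

lemma inner_rowOf (A : (EuclideanSpace ℝ (Fin n)) →L[ℝ] (EuclideanSpace ℝ (Fin n))) (j : Fin n) (w : EuclideanSpace ℝ (Fin n)) :
    inner ℝ (rowOf A j) w = A w j := by
  have hw : w = ∑ i, w i • EuclideanSpace.single i (1:ℝ) := by
    ext k
    simp [Pi.single_apply]
  conv_rhs => rw [hw]
  simp [rowOf, PiLp.inner_apply]

lemma clm_eq_rows (A : (EuclideanSpace ℝ (Fin n)) →L[ℝ] (EuclideanSpace ℝ (Fin n))) :
    A = ∑ j, (innerSL ℝ (rowOf A j)).smulRight (EuclideanSpace.single j (1:ℝ)) := by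
  ext w k
  simp [inner_rowOf, Finset.sum_apply, Pi.single_apply]

/-- assemble -/
def rowL (j : Fin n) : (EuclideanSpace ℝ (Fin n)) →L[ℝ] ((EuclideanSpace ℝ (Fin n)) →L[ℝ] (EuclideanSpace ℝ (Fin n))) :=
  ((ContinuousLinearMap.smulRightL ℝ (EuclideanSpace ℝ (Fin n)) (EuclideanSpace ℝ (Fin n))).flip (EuclideanSpace.single j (1:ℝ))).comp
    (innerSL ℝ)

lemma clm_eq_rowL (A : (EuclideanSpace ℝ (Fin n)) →L[ℝ] (EuclideanSpace ℝ (Fin n))) : A = ∑ j, rowL j (rowOf A j) := by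
  conv_lhs => rw [clm_eq_rows A]
  rfl

lemma IsWeakJacobian.locInt {φ : (EuclideanSpace ℝ (Fin n)) → (EuclideanSpace ℝ (Fin n))} {D : (EuclideanSpace ℝ (Fin n)) → (EuclideanSpace ℝ (Fin n)) →L[ℝ] (EuclideanSpace ℝ (Fin n))} {Ω : Set (EuclideanSpace ℝ (Fin n))}
    (h : IsWeakJacobian φ D Ω) : LocallyIntegrableOn D Ω volume := by
  have e : D = fun x => ∑ j, rowL j (rowOf (D x) j) := by
    ext1 x; exact clm_eq_rowL _
  rw [e]
  have : ∀ s : Finset (Fin n), LocallyIntegrableOn (fun x => ∑ j ∈ s, rowL j (rowOf (D x) j)) Ω volume := by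
    intro s
    induction s using Finset.induction_on with
    | empty => simpa using locallyIntegrableOn_const (0 : (EuclideanSpace ℝ (Fin n)) →L[ℝ] (EuclideanSpace ℝ (Fin n)))
    | insert a s ha ih =>
      simp only [Finset.sum_insert ha]
      refine LocallyIntegrableOn.add (ε'' := (EuclideanSpace ℝ (Fin n)) →L[ℝ] (EuclideanSpace ℝ (Fin n))) ?_ ih
      exact ContinuousLinearMap.locallyIntegrableOn_comp (rowL a) (h a).2.1
  exact this _

lemma IsWeakJacobian.wd {φ : (EuclideanSpace ℝ (Fin n)) → (EuclideanSpace ℝ (Fin n))} {D : (EuclideanSpace ℝ (Fin n)) → (EuclideanSpace ℝ (Fin n)) →L[ℝ] (EuclideanSpace ℝ (Fin n))} {Ω : Set (EuclideanSpace ℝ (Fin n))}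
    (h : IsWeakJacobian φ D Ω) (hφ : LocallyIntegrableOn φ Ω volume) : WD volume φ D Ω := by
  intro ψ hψ hc hs w
  have i1 := int_fderiv_smul hφ hψ hc hs w
  have i2 := int_smul_clm h.locInt hψ.continuous hc hs w
  ext j
  have h1 := (h j).wd ψ hψ hc hs w
  have e1 := (EuclideanSpace.proj j : (EuclideanSpace ℝ (Fin n)) →L[ℝ] ℝ).integral_comp_comm i1
  have e2 := (EuclideanSpace.proj j : (EuclideanSpace ℝ (Fin n)) →L[ℝ] ℝ).integral_comp_comm i2
  simp only [EuclideanSpace.coe_proj, PiLp.smul_apply] at e1 e2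
  rw [PiLp.neg_apply, ← e1, ← e2, h1]
  congr 2; ext x
  rw [innerSL_apply_apply]
  congr 1
  exact inner_rowOf (D x) j w

end Conv

section Area
variable {E F : Type*} [NormedAddCommGroup E] [InnerProductSpace ℝ E] [FiniteDimensional ℝ E]
  [MeasurableSpace E] [BorelSpace E] {μ : Measure E} [μ.IsAddHaarMeasure]
  [NormedAddCommGroup F] [NormedSpace ℝ F] [CompleteSpace F]

theorem area_package {f : E → E} {D : E → E →L[ℝ] E} {U : Set E} (hU : IsOpen U)
    (hf : ContinuousOn f U) (hinj : InjOn f U) (hD : LocallyIntegrableOn D U μ) (h : WD μ f D U) :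
    ∃ G : Set E, MeasurableSet G ∧ G ⊆ U ∧ μ (U \ G) = 0 ∧
      ∀ B ⊆ G, MeasurableSet B → ∀ g : E → ℝ≥0∞,
        ∫⁻ y in f '' B, g y ∂μ = ∫⁻ x in B, ENNReal.ofReal |(D x).det| * g (f x) ∂μ := by
  obtain ⟨A, hAm, hAU, hA0, hAd⟩ := good_sets_loc hU hf hD h
  refine ⟨⋃ m, A m, MeasurableSet.iUnion hAm, iUnion_subset hAU, hA0, ?_⟩
  intro B hB hBm g
  set C : ℕ → Set E := fun m => B ∩ disjointed A m
  have hCm : ∀ m, MeasurableSet (C m) := fun m => hBm.inter (MeasurableSet.disjointed hAm m)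
  have hBC : B = ⋃ m, C m := by
    rw [← inter_iUnion, iUnion_disjointed, inter_eq_left.2 hB]
  have hCA : ∀ m, C m ⊆ A m := fun m => inter_subset_right.trans (disjointed_subset A m)
  have hCd : Pairwise (Function.onFun Disjoint C) := by
    intro i j hij
    exact (disjoint_disjointed A hij).mono inter_subset_right inter_subset_right
  have hCU : ∀ m, C m ⊆ U := fun m => (hCA m).trans (hAU m)
  conv_lhs => rw [hBC, image_iUnion]
  conv_rhs => rw [hBC]
  rw [lintegral_iUnion hCm hCd, lintegral_iUnion]
  · congr 1; ext m
    exact lintegral_image_eq_lintegral_abs_det_fderiv_mul μ (hCm m)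
      (fun x hx => (hAd m x (hCA m hx)).mono (hCA m)) (hinj.mono (hCU m)) g
  · intro m
    exact (hCm m).image_of_continuousOn_injOn (hf.mono (hCU m)) (hinj.mono (hCU m))
  · intro i j hij
    refine disjoint_image_image ?_
    intro x hx y hy hxy
    have := hinj (hCU i hx) (hCU j hy) hxy
    subst this
    exact (disjoint_left.1 (hCd hij)) hx hy

theorem area_le {f : E → E} {D : E → E →L[ℝ] E} {U : Set E} (hU : IsOpen U)
    (hf : ContinuousOn f U) (hinj : InjOn f U) (hD : LocallyIntegrableOn D U μ) (h : WD μ f D U)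
    (g : E → ℝ≥0∞) :
    ∫⁻ x in U, ENNReal.ofReal |(D x).det| * g (f x) ∂μ ≤ ∫⁻ y in f '' U, g y ∂μ := by
  obtain ⟨G, hGm, hGU, hG0, hG⟩ := area_package hU hf hinj hD h
  have : U =ᵐ[μ] G := by
    refine (ae_eq_set).2 ⟨hG0, ?_⟩
    rw [sdiff_eq_empty.2 hGU, measure_empty]
  rw [Measure.restrict_congr_set this, ← hG G Subset.rfl hGm]
  exact lintegral_mono_set (image_mono hGU)

theorem area_null {f : E → E} {D : E → E →L[ℝ] E} {U : Set E} (hU : IsOpen U)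
    (hf : ContinuousOn f U) (hinj : InjOn f U) (hD : LocallyIntegrableOn D U μ) (h : WD μ f D U)
    {N : Set E} (hN : μ N = 0) :
    ∀ᵐ x ∂(μ.restrict U), f x ∈ N → (D x).det = 0 := by
  have h1 := area_le hU hf hinj hD h ((toMeasurable μ N).indicator 1)
  have h2 : ∫⁻ y in f '' U, (toMeasurable μ N).indicator 1 y ∂μ = 0 := by
    refine le_antisymm ((setLIntegral_le_lintegral _ _).trans ?_) zero_le
    rw [lintegral_indicator_one (measurableSet_toMeasurable _ _), measure_toMeasurable, hN]
  rw [h2] at h1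
  have hfm : AEMeasurable f (μ.restrict U) := hf.aemeasurable hU.measurableSet
  have hDm : AEMeasurable D (μ.restrict U) := hD.aestronglyMeasurable.aemeasurable
  have hdet : AEMeasurable (fun x => ENNReal.ofReal |(D x).det|) (μ.restrict U) :=
    (ENNReal.measurable_ofReal.comp (continuous_abs.measurable.comp
      ContinuousLinearMap.continuous_det.measurable)).comp_aemeasurable hDm
  have hind : AEMeasurable (fun x => (toMeasurable μ N).indicator (1 : E → ℝ≥0∞) (f x)) (μ.restrict U) :=
    (measurable_one.indicator (measurableSet_toMeasurable μ N)).comp_aemeasurable hfm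
  have h3 := (lintegral_eq_zero_iff' (hdet.mul hind)).1 (le_antisymm h1 zero_le)
  filter_upwards [h3] with x hx hxN
  have : f x ∈ toMeasurable μ N := subset_toMeasurable _ _ hxN
  simpa [this] using hx

end Area

end File4

section File5

open MeasureTheory Set Metric Filter
open scoped ENNReal Topology NNReal Convolution ContDiff


set_option linter.unusedSectionVars false
section Chain

variable {E F : Type*} [NormedAddCommGroup E] [InnerProductSpace ℝ E] [FiniteDimensional ℝ E]
  [MeasurableSpace E] [BorelSpace E] {μ : Measure E} [μ.IsAddHaarMeasure]

lemma exists_cutoff {K U : Set E} (hK : IsCompact K) (hU : IsOpen U) (hKU : K ⊆ U) :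
    ∃ χ : E → ℝ, ContDiff ℝ ∞ χ ∧ HasCompactSupport χ ∧ tsupport χ ⊆ U ∧
      ∀ x ∈ K, χ =ᶠ[𝓝 x] fun _ => 1 := by
  obtain ⟨L, hL, hKL, hLU⟩ := exists_compact_between hK hU hKU
  obtain ⟨M, hM, hKM, hML⟩ := exists_compact_between hK isOpen_interior hKL
  obtain ⟨f, hf, -, hfs, hf1⟩ := exists_contMDiff_support_eq_eq_one_iff
    (modelWithCornersSelf ℝ E) (n := ⊤) isOpen_interior hM.isClosed hML
  have hts : tsupport f ⊆ L := by
    rw [tsupport, hfs]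
    exact closure_minimal interior_subset hL.isClosed
  refine ⟨f, hf.contDiff, hL.of_isClosed_subset (isClosed_tsupport _) hts, hts.trans hLU, ?_⟩
  intro x hx
  filter_upwards [isOpen_interior.mem_nhds (hKM hx)] with y hy
  exact (hf1 y).1 (interior_subset hy)

lemma lip_wd {u : E → ℝ} {L : ℝ≥0} (hu : LipschitzWith L u) : WD μ u (fderiv ℝ u) univ := by
  intro ψ hψ hc _ w
  obtain ⟨C, hC⟩ := hψ.lipschitzWith_of_hasCompactSupport hc (by simp)
  have h1 := hu.integral_lineDeriv_mul_eq (μ := μ) hC hc w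
  have e1 : ∫ x, lineDeriv ℝ u x w * ψ x ∂μ = ∫ x, ψ x • fderiv ℝ u x w ∂μ := by
    refine integral_congr_ae ?_
    filter_upwards [hu.ae_differentiableAt (μ := μ)] with x hx
    rw [hx.lineDeriv_eq_fderiv, smul_eq_mul, mul_comm]
  have e2 : ∫ x, lineDeriv ℝ ψ x (-w) * u x ∂μ = - ∫ x, (fderiv ℝ ψ x w) • u x ∂μ := by
    rw [← integral_neg]
    congr 1; ext x
    rw [((hψ.differentiable (by simp)) x).lineDeriv_eq_fderiv]
    simp
  rw [← e1, h1, e2, neg_neg]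

lemma lip_fderiv_locInt {u : E → ℝ} {L : ℝ≥0} (hu : LipschitzWith L u) :
    LocallyIntegrable (fderiv ℝ u) μ := by
  refine (locallyIntegrable_const (L:ℝ)).mono (measurable_fderiv ℝ u).aestronglyMeasurable ?_
  refine Eventually.of_forall fun x => (norm_fderiv_le_of_lipschitz ℝ hu).trans (le_abs_self _)

lemma chain_smooth {f : E → E} {D : E → E →L[ℝ] E} (hf : Continuous f) (hfc : HasCompactSupport f)
    (hD : Integrable D μ) (h : WD μ f D univ) {u : E → ℝ} (hu : ContDiff ℝ ∞ u) {L : ℝ}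
    (hL : ∀ x, ‖fderiv ℝ u x‖ ≤ L) :
    WD μ (u ∘ f) (fun x => (fderiv ℝ u (f x)).comp (D x)) univ := by
  intro ψ hψ hc _ w
  have hL0 : 0 ≤ L := (norm_nonneg _).trans (hL 0)
  have hfl : LocallyIntegrable f μ := hf.locallyIntegrable
  have hdψ : Continuous (fun x => fderiv ℝ ψ x w) :=
    (hψ.continuous_fderiv (by simp)).clm_apply continuous_const
  have hdψs : HasCompactSupport (fun x => fderiv ℝ ψ x w) := by
    refine HasCompactSupport.intro hc fun x hx => ?_
    have : fderiv ℝ ψ x = 0 := by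
      by_contra h
      exact hx (tsupport_fderiv_subset ℝ (subset_tsupport _ h))
    simp [this]
  obtain ⟨M, hM⟩ := hfc.exists_bound_of_continuous hf
  have hM' : ∀ j x, ‖moll μ j f x‖ ≤ M := fun j x => moll_bound μ j hM x
  have hs : ∀ j, ContDiff ℝ ∞ (moll μ j f) := fun j => moll_contDiff μ j hfl
  have hder : ∀ j x, HasFDerivAt (u ∘ moll μ j f) ((fderiv ℝ u (moll μ j f x)).comp (moll μ j D x)) x :=
    fun j x => ((hu.differentiable (by simp)) _).hasFDerivAt.comp x
      (moll_hasFDerivAt μ j hfl hD.locallyIntegrable h x)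
  have hstep : ∀ j, ∫ x, (fderiv ℝ ψ x w) • u (moll μ j f x) ∂μ =
      - ∫ x, ψ x • (fderiv ℝ u (moll μ j f x)) (moll μ j D x w) ∂μ := by
    intro j
    have hg : ContDiff ℝ ∞ (u ∘ moll μ j f) := hu.comp (hs j)
    have hgc : Continuous (fun x => fderiv ℝ (u ∘ moll μ j f) x w) :=
      (hg.continuous_fderiv (by simp)).clm_apply continuous_const
    have := integral_smul_fderiv_eq_neg_fderiv_smul_of_integrable (𝕜 := ℝ) (μ := μ) (f := ψ)
      (g := u ∘ moll μ j f) (v := w)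
      ((hdψ.smul hg.continuous).integrable_of_hasCompactSupport (hdψs.smul_right))
      ((hψ.continuous.smul hgc).integrable_of_hasCompactSupport (hc.smul_right))
      ((hψ.continuous.smul hg.continuous).integrable_of_hasCompactSupport (hc.smul_right))
      (fun x _ => (hψ.differentiable (by simp)) x)
      (fun x _ => (hg.differentiable (by simp)) x)
    rw [eq_neg_iff_add_eq_zero, add_comm, ← eq_neg_iff_add_eq_zero] at this
    rw [eq_neg_iff_add_eq_zero, add_comm, ← eq_neg_iff_add_eq_zero]
    simp only [(hder j _).fderiv, ContinuousLinearMap.comp_apply, Function.comp_apply] at this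
    linarith [this]
  -- limits
  obtain ⟨C, hC⟩ := (isCompact_closedBall (0:E) M).exists_bound_of_continuousOn hu.continuous.continuousOn
  have l1 : Tendsto (fun j => ∫ x, (fderiv ℝ ψ x w) • u (moll μ j f x) ∂μ) atTop
      (𝓝 (∫ x, (fderiv ℝ ψ x w) • u (f x) ∂μ)) := by
    refine tendsto_integral_of_dominated_convergence (fun x => ‖fderiv ℝ ψ x w‖ * C) ?_ ?_ ?_ ?_
    · intro j
      exact (hdψ.smul (hu.continuous.comp (hs j).continuous)).aestronglyMeasurable
    · exact (hdψ.integrable_of_hasCompactSupport hdψs).norm.mul_const C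
    · intro j
      refine Eventually.of_forall fun x => ?_
      rw [norm_smul]
      gcongr
      exact hC _ (by simpa using hM' j x)
    · refine Eventually.of_forall fun x => ?_
      exact ((hu.continuous.tendsto _).comp (moll_tendsto μ hf x)).const_smul _
  obtain ⟨P, hP⟩ := hc.exists_bound_of_continuous hψ.continuous
  have hP0 : 0 ≤ P := (norm_nonneg _).trans (hP 0)
  have hcu : Continuous (fderiv ℝ u) := hu.continuous_fderiv (by simp)
  have hmeas : ∀ (g : E → E) (B : E → E →L[ℝ] E), Continuous g → Integrable B μ →
      Integrable (fun x => ψ x • (fderiv ℝ u (g x)) (B x w)) μ := by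
    intro g B hg hB
    have hBw : Integrable (fun x => B x w) μ := hB.apply_continuousLinearMap w
    refine Integrable.mono' (hBw.norm.const_mul (P * L)) ?_ (Eventually.of_forall fun x => ?_)
    · refine hψ.continuous.aestronglyMeasurable.smul ?_
      exact (ContinuousLinearMap.id ℝ (E →L[ℝ] ℝ)).aestronglyMeasurable_comp₂
        (hcu.comp hg).aestronglyMeasurable hBw.aestronglyMeasurable
    · rw [norm_smul, mul_assoc]
      gcongr
      · exact hP x
      · exact (ContinuousLinearMap.le_opNorm _ _).trans (by gcongr; exact hL _)
  have l2 : Tendsto (fun j => ∫ x, ψ x • (fderiv ℝ u (moll μ j f x)) (D x w) ∂μ) atTop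
      (𝓝 (∫ x, ψ x • (fderiv ℝ u (f x)) (D x w) ∂μ)) := by
    have hDw : Integrable (fun x => D x w) μ := hD.apply_continuousLinearMap w
    refine tendsto_integral_of_dominated_convergence (fun x => (P * L) * ‖D x w‖) ?_ ?_ ?_ ?_
    · intro j
      exact (hmeas _ D (hs j).continuous hD).aestronglyMeasurable
    · exact hDw.norm.const_mul (P * L)
    · intro j
      refine Eventually.of_forall fun x => ?_
      rw [norm_smul, mul_assoc]
      gcongr
      · exact hP x
      · exact (ContinuousLinearMap.le_opNorm _ _).trans (by gcongr; exact hL _)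
    · refine Eventually.of_forall fun x => ?_
      refine Tendsto.const_smul ?_ _
      exact ((ContinuousLinearMap.apply ℝ ℝ (D x w)).continuous.tendsto _).comp
        ((hcu.tendsto _).comp (moll_tendsto μ hf x))
  have l3 : Tendsto (fun j => ∫ x, ψ x • (fderiv ℝ u (moll μ j f x)) (moll μ j D x w) ∂μ -
      ∫ x, ψ x • (fderiv ℝ u (moll μ j f x)) (D x w) ∂μ) atTop (𝓝 0) := by
    have hz := (moll_L1 μ hD).const_mul (P * L * ‖w‖)
    rw [mul_zero] at hz
    refine squeeze_zero_norm (fun j => ?_) hz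
    rw [← integral_sub (hmeas _ _ (hs j).continuous (moll_integrable μ j hD))
      (hmeas _ _ (hs j).continuous hD), ← integral_const_mul]
    refine norm_integral_le_of_norm_le ?_ (Eventually.of_forall fun x => ?_)
    · exact ((moll_integrable μ j hD).sub hD).norm.const_mul _
    · rw [← smul_sub, ← map_sub, norm_smul]
      have e : moll μ j D x w - D x w = (moll μ j D x - D x) w := by simp
      rw [e]
      calc ‖ψ x‖ * ‖(fderiv ℝ u (moll μ j f x)) ((moll μ j D x - D x) w)‖
          ≤ P * (L * (‖moll μ j D x - D x‖ * ‖w‖)) := by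
            gcongr
            · exact hP x
            · refine (ContinuousLinearMap.le_opNorm _ _).trans ?_
              gcongr
              · exact hL _
              · exact ContinuousLinearMap.le_opNorm _ _
        _ = _ := by ring
  have l4 := l3.add l2
  simp only [sub_add_cancel, zero_add] at l4
  have l5 := l4.neg
  simp only [← hstep] at l5
  exact tendsto_nhds_unique l1 l5

theorem chain_lip {f : E → E} {D : E → E →L[ℝ] E} {U : Set E} (hU : IsOpen U)
    (hf : ContinuousOn f U) (hinj : InjOn f U) (hD : LocallyIntegrableOn D U μ) (h : WD μ f D U)
    (hdist : ∀ᵐ x ∂(μ.restrict U), (D x).det = 0 → D x = 0)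
    {u : E → ℝ} {L : ℝ≥0} (hu : LipschitzWith L u) :
    WD μ (u ∘ f) (fun x => (fderiv ℝ u (f x)).comp (D x)) U := by
  intro ψ hψ hc hs w
  have hfl : LocallyIntegrableOn f U μ := hf.locallyIntegrableOn hU.measurableSet
  obtain ⟨χ, hχ, hχc, hχs, hχ1⟩ := exists_cutoff hc hU hs
  set f' : E → E := fun x => χ x • f x
  set D' : E → E →L[ℝ] E := fun x => χ x • D x + (fderiv ℝ χ x).smulRight (f x)
  have hf'c : Continuous f' := cutoff_continuous hU hf hχ.continuous hχs
  have hf's : HasCompactSupport f' := hχc.smul_right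
  have hD'i : Integrable D' μ := cutoff_integrable hfl hD hχ hχc hχs
  have hw : WD μ f' D' univ := h.cutoff hfl hD hχ hχc hχs
  have ef : ∀ x ∈ tsupport ψ, f' x = f x := by
    intro x hx
    simp [f', (hχ1 x hx).eq_of_nhds]
  have eD : ∀ x ∈ tsupport ψ, D' x = D x := by
    intro x hx
    have : fderiv ℝ χ x = 0 := by rw [(hχ1 x hx).fderiv_eq]; simp
    ext w
    simp [D', (hχ1 x hx).eq_of_nhds, this]
  have hul : LocallyIntegrable u μ := hu.continuous.locallyIntegrable
  set uk : ℕ → E → ℝ := fun k => moll μ k u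
  have huk : ∀ k x, HasFDerivAt (uk k) (moll μ k (fderiv ℝ u) x) x := fun k x =>
    moll_hasFDerivAt μ k hul (lip_fderiv_locInt hu) (lip_wd hu) x
  have hukd : ∀ k x, ‖fderiv ℝ (uk k) x‖ ≤ L := by
    intro k x
    rw [(huk k x).fderiv]
    exact moll_bound μ k (fun y => norm_fderiv_le_of_lipschitz ℝ hu) x
  have huks : ∀ k, ContDiff ℝ ∞ (uk k) := fun k => moll_contDiff μ k hul
  have hukl : ∀ k, LipschitzWith L (uk k) := by
    intro k
    refine lipschitzWith_of_nnnorm_fderiv_le ((huks k).differentiable (by simp)) fun x => ?_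
    exact hukd k x
  have hstep := fun k => chain_smooth hf'c hf's hD'i hw (huks k) (hukd k) ψ hψ hc (subset_univ _) w
  have hdψ : Continuous (fun x => fderiv ℝ ψ x w) :=
    (hψ.continuous_fderiv (by simp)).clm_apply continuous_const
  have hdψ0 : ∀ x, x ∉ tsupport ψ → fderiv ℝ ψ x w = 0 := by
    intro x hx
    have : fderiv ℝ ψ x = 0 := by
      by_contra h
      exact hx (tsupport_fderiv_subset ℝ (subset_tsupport _ h))
    simp [this]
  have hdψs : HasCompactSupport (fun x => fderiv ℝ ψ x w) := HasCompactSupport.intro hc hdψ0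
  obtain ⟨M, hM⟩ := hf's.exists_bound_of_continuous hf'c
  obtain ⟨C0, hC0⟩ := (moll_tendsto μ hu.continuous 0).norm.bddAbove_range
  have hbd : ∀ k x, ‖uk k (f' x)‖ ≤ C0 + L * M := by
    intro k x
    have h1 : ‖uk k 0‖ ≤ C0 := hC0 ⟨k, rfl⟩
    have h2 := (hukl k).dist_le_mul (f' x) 0
    rw [dist_eq_norm, dist_zero_right] at h2
    have h3 : ‖uk k (f' x)‖ ≤ ‖uk k (f' x) - uk k 0‖ + ‖uk k 0‖ := by
      have := norm_add_le (uk k (f' x) - uk k 0) (uk k 0)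
      simpa using this
    have h4 : (L:ℝ) * ‖f' x‖ ≤ L * M := by gcongr; exact hM x
    linarith
  have l1 : Tendsto (fun k => ∫ x, (fderiv ℝ ψ x w) • (uk k ∘ f') x ∂μ) atTop
      (𝓝 (∫ x, (fderiv ℝ ψ x w) • (u ∘ f) x ∂μ)) := by
    refine tendsto_integral_of_dominated_convergence (fun x => ‖fderiv ℝ ψ x w‖ * (C0 + L * M)) ?_ ?_ ?_ ?_
    · intro j
      exact (hdψ.smul ((huks j).continuous.comp hf'c)).aestronglyMeasurable
    · exact (hdψ.integrable_of_hasCompactSupport hdψs).norm.mul_const _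
    · intro j
      refine Eventually.of_forall fun x => ?_
      rw [norm_smul]
      gcongr
      exact hbd j x
    · refine Eventually.of_forall fun x => ?_
      by_cases hx : x ∈ tsupport ψ
      · have := (moll_tendsto μ hu.continuous (f' x)).const_smul (fderiv ℝ ψ x w)
        simpa [ef x hx] using this
      · simp [hdψ0 x hx]
  have hN := moll_ae_tendsto μ (lip_fderiv_locInt (μ := μ) hu)
  have hnull := area_null hU hf hinj hD h hN
  have l2 : Tendsto (fun k => ∫ x, ψ x • ((fderiv ℝ (uk k) (f' x)).comp (D' x)) w ∂μ) atTop
      (𝓝 (∫ x, ψ x • ((fderiv ℝ u (f x)).comp (D x)) w ∂μ)) := by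
    have iD := int_smul_clm hD hψ.continuous hc hs w
    have iD' : Integrable (fun x => D' x w) μ := hD'i.apply_continuousLinearMap w
    refine tendsto_integral_of_dominated_convergence (fun x => L * ‖ψ x • D x w‖) ?_ ?_ ?_ ?_
    · intro k
      refine hψ.continuous.aestronglyMeasurable.smul ?_
      simp only [ContinuousLinearMap.comp_apply]
      exact (ContinuousLinearMap.id ℝ (E →L[ℝ] ℝ)).aestronglyMeasurable_comp₂
        (((huks k).continuous_fderiv (by simp)).comp hf'c).aestronglyMeasurable
        iD'.aestronglyMeasurable
    · exact iD.norm.const_mul _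
    · intro k
      refine Eventually.of_forall fun x => ?_
      by_cases hx : x ∈ tsupport ψ
      · rw [eD x hx, ContinuousLinearMap.comp_apply, ← map_smul]
        exact (ContinuousLinearMap.le_opNorm _ _).trans (by gcongr; exact hukd k _)
      · simp [image_eq_zero_of_notMem_tsupport hx]
    · have hnull' := (ae_restrict_iff' hU.measurableSet).1 hnull
      have hdist' := (ae_restrict_iff' hU.measurableSet).1 hdist
      filter_upwards [hnull', hdist'] with x hx1 hx2
      by_cases hx : x ∈ tsupport ψ
      · simp only [eD x hx, ef x hx, ContinuousLinearMap.comp_apply]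
        refine Tendsto.const_smul ?_ _
        by_cases hb : Tendsto (fun k => moll μ k (fderiv ℝ u) (f x)) atTop (𝓝 (fderiv ℝ u (f x)))
        · simp only [(huk _ _).fderiv]
          exact ((ContinuousLinearMap.apply ℝ ℝ (D x w)).continuous.tendsto _).comp hb
        · have : D x = 0 := hx2 (hs hx) (hx1 (hs hx) hb)
          simp [this]
      · simp [image_eq_zero_of_notMem_tsupport hx]
  have l3 := l2.neg
  simp only [← hstep] at l3
  exact tendsto_nhds_unique l1 l3

end Chain

end File5

section File6

open MeasureTheory Set Metric Filter
open scoped ENNReal Topology NNReal Convolution ContDiff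


set_option linter.unusedSectionVars false
section PartII

variable {n : ℕ}


lemma locLip_ext {u : (EuclideanSpace ℝ (Fin n)) → ℝ} {Ω' : Set (EuclideanSpace ℝ (Fin n))} (hΩ' : IsOpen Ω') (hu : LocLipschitzOn u Ω')
    {C : Set (EuclideanSpace ℝ (Fin n))} (hC : IsCompact C) (hCΩ : C ⊆ Ω') :
    ∃ (L : ℝ≥0) (g : (EuclideanSpace ℝ (Fin n)) → ℝ), LipschitzWith L g ∧ ∀ y ∈ C, g =ᶠ[𝓝 y] u := by
  obtain ⟨M, hM, hCM, hMΩ⟩ := exists_compact_between hC hΩ' hCΩ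
  obtain ⟨L, hL⟩ := hu M hMΩ hM
  obtain ⟨g, hg, hgu⟩ := hL.extend_real
  refine ⟨L, g, hg, fun y hy => ?_⟩
  filter_upwards [isOpen_interior.mem_nhds (hCM hy)] with z hz
  exact (hgu (interior_subset hz)).symm

lemma kp_measurable (p : ℝ) : Measurable (fun A : (EuclideanSpace ℝ (Fin n)) →L[ℝ] (EuclideanSpace ℝ (Fin n)) =>
    if LinearMap.det (A : (EuclideanSpace ℝ (Fin n)) →ₗ[ℝ] (EuclideanSpace ℝ (Fin n))) ≠ 0 then
      ‖A‖ / |LinearMap.det (A : (EuclideanSpace ℝ (Fin n)) →ₗ[ℝ] (EuclideanSpace ℝ (Fin n)))| ^ (1/p) else 0) := by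
  have hd : Measurable (fun A : (EuclideanSpace ℝ (Fin n)) →L[ℝ] (EuclideanSpace ℝ (Fin n)) => LinearMap.det (A : (EuclideanSpace ℝ (Fin n)) →ₗ[ℝ] (EuclideanSpace ℝ (Fin n)))) :=
    ContinuousLinearMap.continuous_det.measurable
  refine Measurable.ite ?_ ?_ measurable_const
  · exact (measurableSet_eq_fun hd measurable_const).compl
  · exact measurable_norm.div ((continuous_abs.measurable.comp hd).pow_const _)

lemma distortionFn_nonneg (p : ℝ) (D : (EuclideanSpace ℝ (Fin n)) → (EuclideanSpace ℝ (Fin n)) →L[ℝ] (EuclideanSpace ℝ (Fin n))) (x : EuclideanSpace ℝ (Fin n)) :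
    0 ≤ distortionFn p D x := by
  unfold distortionFn
  split_ifs <;> positivity

lemma distortionFn_aemeas {p : ℝ} {D : (EuclideanSpace ℝ (Fin n)) → (EuclideanSpace ℝ (Fin n)) →L[ℝ] (EuclideanSpace ℝ (Fin n))} {μ : Measure (EuclideanSpace ℝ (Fin n))}
    (hD : AEMeasurable D μ) : AEMeasurable (distortionFn p D) μ :=
  (kp_measurable p).comp_aemeasurable hD

lemma sigma_holder {p q : ℝ} (hq : 1 ≤ q) (hqp : q ≤ p) :
    ENNReal.HolderTriple (sigmaExp p q) (ENNReal.ofReal p) (ENNReal.ofReal q) := by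
  have hp0 : 0 < p := by linarith
  have hq0 : 0 < q := by linarith
  constructor
  unfold sigmaExp
  split_ifs with h
  · simp [h]
  · have hlt : q < p := lt_of_le_of_ne hqp h
    have h1 : 0 < 1/q - 1/p := by
      rw [sub_pos]
      exact one_div_lt_one_div_of_lt hq0 hlt
    rw [← ENNReal.ofReal_inv_of_pos (by positivity), ← ENNReal.ofReal_inv_of_pos hp0,
      ← ENNReal.ofReal_inv_of_pos hq0, ← ENNReal.ofReal_add (by positivity) (by positivity)]
    congr 1
    simp

theorem compBound_of_distortion
    (Ω Ω' : Set (EuclideanSpace ℝ (Fin n))) (hΩo : IsOpen Ω) (hΩ'o : IsOpen Ω')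
    (p q : ℝ) (hq : 1 ≤ q) (hqp : q ≤ p) (φ : (EuclideanSpace ℝ (Fin n)) → (EuclideanSpace ℝ (Fin n)))
    (hbij : Set.BijOn φ Ω Ω') (hcont : ContinuousOn φ Ω)
    (D : (EuclideanSpace ℝ (Fin n)) → (EuclideanSpace ℝ (Fin n)) →L[ℝ] (EuclideanSpace ℝ (Fin n))) (hJ : IsWeakJacobian φ D Ω)
    (hdist : ∀ᵐ x ∂(volume.restrict Ω),
          LinearMap.det ((D x) : (EuclideanSpace ℝ (Fin n)) →ₗ[ℝ] (EuclideanSpace ℝ (Fin n))) = 0 → D x = 0)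
    (hK : eLpNorm (distortionFn p D) (sigmaExp p q) (volume.restrict Ω) < ⊤) :
    CompBound p q (eLpNorm (distortionFn p D) (sigmaExp p q) (volume.restrict Ω)).toReal φ Ω Ω' := by
  intro u hu hui
  have hp0 : 0 < p := by linarith
  have hq0 : 0 < q := by linarith
  have hφl : LocallyIntegrableOn φ Ω volume := hcont.locallyIntegrableOn hΩo.measurableSet
  have hDl := hJ.locInt
  have hW := hJ.wd hφl
  have hDm : AEStronglyMeasurable D (volume.restrict Ω) := hDl.aestronglyMeasurable
  have hφm : AEMeasurable φ (volume.restrict Ω) := hcont.aemeasurable hΩo.measurableSet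
  have hucont : ContinuousOn u Ω' := by
    intro y hy
    obtain ⟨L, g, hg, hgu⟩ := locLip_ext hΩ'o hu (isCompact_singleton (x := y)) (by simpa using hy)
    exact ((hg.continuous.continuousAt).congr (hgu y rfl)).continuousWithinAt
  have hfu : AEStronglyMeasurable (fun x => fderiv ℝ u (φ x)) (volume.restrict Ω) :=
    ((measurable_fderiv ℝ u).comp_aemeasurable hφm).aestronglyMeasurable
  set A : (EuclideanSpace ℝ (Fin n)) → (EuclideanSpace ℝ (Fin n)) →L[ℝ] ℝ := fun x => (fderiv ℝ u (φ x)).comp (D x)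
  have hAm : AEStronglyMeasurable A (volume.restrict Ω) :=
    ((ContinuousLinearMap.compL ℝ (EuclideanSpace ℝ (Fin n)) (EuclideanSpace ℝ (Fin n)) ℝ).continuous₂).comp_aestronglyMeasurable₂ hfu hDm
  set v : (EuclideanSpace ℝ (Fin n)) → (EuclideanSpace ℝ (Fin n)) := fun x => (InnerProductSpace.toDual ℝ (EuclideanSpace ℝ (Fin n))).symm (A x)
  have hvm : AEStronglyMeasurable v (volume.restrict Ω) :=
    (LinearIsometryEquiv.continuous _).comp_aestronglyMeasurable hAm
  have hvA : ∀ x, innerSL ℝ (v x) = A x := by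
    intro x; ext w; simp [v]
  have hvn : ∀ x, ‖v x‖ = ‖A x‖ := by intro x; simp [v]
  have hWu : WD volume (u ∘ φ) A Ω := by
    intro ψ hψ hc hs w
    have hC : IsCompact (φ '' tsupport ψ) := IsCompact.image_of_continuousOn hc (hcont.mono hs)
    have hCs : φ '' tsupport ψ ⊆ Ω' := by
      rw [← hbij.image_eq]; exact image_mono hs
    obtain ⟨L, g, hg, hgu⟩ := locLip_ext hΩ'o hu hC hCs
    have h1 := chain_lip hΩo hcont hbij.injOn hDl hW hdist hg ψ hψ hc hs w
    convert h1 using 2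
    · congr 1; ext x
      by_cases hx : x ∈ tsupport ψ
      · simp [(hgu _ (mem_image_of_mem φ hx)).eq_of_nhds]
      · have : fderiv ℝ ψ x = 0 := by
          by_contra h
          exact hx (tsupport_fderiv_subset ℝ (subset_tsupport _ h))
        simp [this]
    · congr 1; ext x
      by_cases hx : x ∈ tsupport ψ
      · simp [A, (hgu _ (mem_image_of_mem φ hx)).fderiv_eq]
      · simp [image_eq_zero_of_notMem_tsupport hx]
  have hvl : LocallyIntegrableOn v Ω volume := by
    rw [locallyIntegrableOn_iff hΩo.isLocallyClosed]
    intro k hk hkc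
    have hC : IsCompact (φ '' k) := IsCompact.image_of_continuousOn hkc (hcont.mono hk)
    have hCs : φ '' k ⊆ Ω' := by
      rw [← hbij.image_eq]; exact image_mono hk
    obtain ⟨L, g, hg, hgu⟩ := locLip_ext hΩ'o hu hC hCs
    have hDk : IntegrableOn D k volume := hDl.integrableOn_compact_subset hk hkc
    refine Integrable.mono' (hDk.norm.const_mul L) (hvm.mono_measure (Measure.restrict_mono hk le_rfl)) ?_
    refine (ae_restrict_iff' hkc.measurableSet).2 (Eventually.of_forall fun x hx => ?_)
    rw [hvn]
    refine (ContinuousLinearMap.opNorm_comp_le _ _).trans ?_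
    gcongr
    rw [← (hgu _ (mem_image_of_mem φ hx)).fderiv_eq]
    exact norm_fderiv_le_of_lipschitz ℝ hg
  have hul : LocallyIntegrableOn (u ∘ φ) Ω volume :=
    (hucont.comp hcont hbij.mapsTo).locallyIntegrableOn hΩo.measurableSet
  have hgrad : HasWeakGradOn (u ∘ φ) v Ω := by
    refine HasWeakGradOn.of_wd hul hvl ?_
    simpa only [hvA] using hWu
  -- norm estimate
  set J : (EuclideanSpace ℝ (Fin n)) → ℝ := fun x => |(D x).det|
  set h : (EuclideanSpace ℝ (Fin n)) → ℝ := fun x => J x ^ (1/p) * ‖fderiv ℝ u (φ x)‖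
  have hJm : AEMeasurable J (volume.restrict Ω) :=
    (continuous_abs.measurable.comp ContinuousLinearMap.continuous_det.measurable).comp_aemeasurable
      hDm.aemeasurable
  have hhm : AEStronglyMeasurable h (volume.restrict Ω) :=
    ((hJm.pow_const _).mul hfu.norm.aemeasurable).aestronglyMeasurable
  have hKm : AEStronglyMeasurable (distortionFn p D) (volume.restrict Ω) :=
    (distortionFn_aemeas hDm.aemeasurable).aestronglyMeasurable
  have hpt : ∀ᵐ x ∂(volume.restrict Ω), ‖v x‖ ≤ ‖(distortionFn p D • h) x‖ := by
    filter_upwards [hdist] with x hx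
    rw [hvn]
    by_cases hdet : LinearMap.det ((D x) : (EuclideanSpace ℝ (Fin n)) →ₗ[ℝ] (EuclideanSpace ℝ (Fin n))) = 0
    · have : A x = 0 := by simp [A, hx hdet]
      rw [this, norm_zero]; exact norm_nonneg _
    · have hJ0 : 0 < J x := abs_pos.2 hdet
      have e : distortionFn p D x = ‖D x‖ / J x ^ (1/p) := by
        unfold distortionFn
        rw [if_pos hdet]
      have hJp : 0 < J x ^ (1/p) := Real.rpow_pos_of_pos hJ0 _
      have e2 : (distortionFn p D • h) x = ‖fderiv ℝ u (φ x)‖ * ‖D x‖ := by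
        simp only [Pi.smul_apply', smul_eq_mul, e, h]
        field_simp
      rw [e2, Real.norm_of_nonneg (by positivity)]
      exact ContinuousLinearMap.opNorm_comp_le _ _
  have := sigma_holder hq hqp
  have hpe0 : ENNReal.ofReal p ≠ 0 := by simpa using hp0
  have hqe0 : ENNReal.ofReal q ≠ 0 := by simpa using hq0
  have hh : eLpNorm h (ENNReal.ofReal p) (volume.restrict Ω) ≤
      eLpNorm (gradient u) (ENNReal.ofReal p) (volume.restrict Ω') := by
    rw [eLpNorm_eq_lintegral_rpow_enorm_toReal hpe0 (by simp),
      eLpNorm_eq_lintegral_rpow_enorm_toReal hpe0 (by simp), ENNReal.toReal_ofReal hp0.le]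
    refine ENNReal.rpow_le_rpow ?_ (by positivity)
    have h1 := area_le hΩo hcont hbij.injOn hDl hW (fun y => ‖gradient u y‖ₑ ^ p)
    rw [hbij.image_eq] at h1
    refine le_trans (le_of_eq ?_) h1
    congr 1; ext x
    have hn : ‖gradient u (φ x)‖ₑ = ‖‖fderiv ℝ u (φ x)‖‖ₑ := by
      rw [enorm_norm, ← ofReal_norm, ← ofReal_norm, norm_gradient_eq]
    rw [hn]
    simp only [h, enorm_mul]
    rw [ENNReal.mul_rpow_of_nonneg _ _ hp0.le]
    congr 1
    rw [Real.enorm_of_nonneg (by positivity), ENNReal.ofReal_rpow_of_nonneg (by positivity) hp0.le,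
      ← Real.rpow_mul (by positivity), one_div_mul_cancel hp0.ne', Real.rpow_one]
  have hgm : AEStronglyMeasurable (gradient u) (volume.restrict Ω') :=
    ((LinearIsometryEquiv.continuous _).measurable.comp (measurable_fderiv ℝ u)).aestronglyMeasurable
  have hgL : MemLp (gradient u) (ENNReal.ofReal p) (volume.restrict Ω') := by
    rw [← integrable_norm_rpow_iff hgm hpe0 (by simp), ENNReal.toReal_ofReal hp0.le]
    exact hui
  have hmain : eLpNorm v (ENNReal.ofReal q) (volume.restrict Ω) ≤
      eLpNorm (distortionFn p D) (sigmaExp p q) (volume.restrict Ω) *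
        eLpNorm (gradient u) (ENNReal.ofReal p) (volume.restrict Ω') :=
    (eLpNorm_mono_ae hpt).trans ((eLpNorm_smul_le_mul_eLpNorm hhm hKm).trans (by gcongr))
  have hvL : MemLp v (ENNReal.ofReal q) (volume.restrict Ω) :=
    ⟨hvm, hmain.trans_lt (ENNReal.mul_lt_top hK hgL.2)⟩
  refine ⟨v, hgrad, ?_, ?_⟩
  · have := hvL.integrable_norm_rpow hqe0 (by simp)
    rwa [ENNReal.toReal_ofReal hq0.le] at this
  · have h1 := ENNReal.toReal_mono (ENNReal.mul_lt_top hK hgL.2).ne hmain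
    rw [ENNReal.toReal_mul, hvL.eLpNorm_eq_integral_rpow_norm hqe0 (by simp),
      hgL.eLpNorm_eq_integral_rpow_norm hpe0 (by simp), ENNReal.toReal_ofReal hq0.le,
      ENNReal.toReal_ofReal hp0.le, ENNReal.toReal_ofReal (by positivity),
      ENNReal.toReal_ofReal (by positivity)] at h1
    simpa only [one_div] using h1

end PartII

end File6

section File7

open MeasureTheory Set Metric Filter
open scoped ENNReal Topology NNReal Convolution ContDiff


set_option linter.unusedSectionVars false
section PartIII

variable {n : ℕ}


lemma gradient_zero_off {ψ : (EuclideanSpace ℝ (Fin n)) → ℝ} {x : EuclideanSpace ℝ (Fin n)} (hx : x ∉ tsupport ψ) : gradient ψ x = 0 := by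
  have : fderiv ℝ ψ x = 0 := by
    by_contra h
    exact hx (tsupport_fderiv_subset ℝ (subset_tsupport _ h))
  simp [gradient, this]

lemma weak_unique {f g : (EuclideanSpace ℝ (Fin n)) → ℝ} {v v' : (EuclideanSpace ℝ (Fin n)) → (EuclideanSpace ℝ (Fin n))} {Ω W : Set (EuclideanSpace ℝ (Fin n))}
    (hf : HasWeakGradOn f v Ω) (hg : HasWeakGradOn g v' Ω) (hW : IsOpen W) (hWΩ : W ⊆ Ω)
    (hfg : EqOn f g W) : ∀ᵐ x ∂volume, x ∈ W → v x = v' x := by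
  have h1 : ∀ᵐ x ∂volume, x ∈ W → v x - v' x = 0 := by
    refine hW.ae_eq_zero_of_integral_contDiff_smul_eq_zero
      ((hf.2.1.mono_set hWΩ).sub (hg.2.1.mono_set hWΩ)) ?_
    intro ψ hψ hc hs
    have i1 := int_smul hf.2.1 hψ.continuous hc (hs.trans hWΩ)
    have i2 := int_smul hg.2.1 hψ.continuous hc (hs.trans hWΩ)
    have e1 := hf.2.2 ψ hψ hc (hs.trans hWΩ)
    have e2 := hg.2.2 ψ hψ hc (hs.trans hWΩ)
    have e3 : ∫ x in Ω, f x • gradient ψ x = ∫ x in Ω, g x • gradient ψ x := by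
      congr 1; ext1 x
      by_cases hx : x ∈ tsupport ψ
      · rw [hfg (hs hx)]
      · rw [gradient_zero_off hx, smul_zero, smul_zero]
    have key : ∀ w : (EuclideanSpace ℝ (Fin n)) → (EuclideanSpace ℝ (Fin n)), ∫ x in Ω, ψ x • w x = ∫ x, ψ x • w x := by
      intro w
      refine setIntegral_eq_integral_of_forall_compl_eq_zero fun x hx => ?_
      rw [image_eq_zero_of_notMem_tsupport (fun h => hx (hWΩ (hs h))), zero_smul]
    rw [e1, e2, neg_inj, key, key] at e3
    simp only [smul_sub]
    rw [integral_sub i1 i2, e3, sub_self]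
  filter_upwards [h1] with x hx hxW
  exact sub_eq_zero.1 (hx hxW)

lemma smooth_cpt_test {u : (EuclideanSpace ℝ (Fin n)) → ℝ} (hu : ContDiff ℝ ∞ u) (hc : HasCompactSupport u)
    (Ω' : Set (EuclideanSpace ℝ (Fin n))) {p : ℝ} (hp : 0 < p) :
    LocLipschitzOn u Ω' ∧ IntegrableOn (fun x => ‖gradient u x‖ ^ p) Ω' volume := by
  constructor
  · intro K _ _
    obtain ⟨C, hC⟩ := hu.lipschitzWith_of_hasCompactSupport hc (by simp)
    exact ⟨C, hC.lipschitzOnWith⟩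
  · refine Integrable.integrableOn ?_
    have hgc : Continuous (gradient u) :=
      (LinearIsometryEquiv.continuous _).comp (hu.continuous_fderiv (by simp))
    refine Continuous.integrable_of_hasCompactSupport ?_ ?_
    · exact hgc.norm.rpow_const fun x => Or.inr hp.le
    · refine HasCompactSupport.intro hc fun x hx => ?_
      rw [gradient_zero_off hx, norm_zero, Real.zero_rpow hp.ne']

lemma exists_test (R : ℕ) (j : Fin n) : ∃ u : (EuclideanSpace ℝ (Fin n)) → ℝ, ContDiff ℝ ∞ u ∧ HasCompactSupport u ∧
    ∀ y, ‖y‖ < R → u y = y j := by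
  let χ : ContDiffBump (0 : EuclideanSpace ℝ (Fin n)) := ⟨R + 1, R + 2, by positivity, by linarith⟩
  refine ⟨fun y => χ y * y j, ?_, χ.hasCompactSupport.mul_right, ?_⟩
  · exact χ.contDiff.mul (EuclideanSpace.proj j : (EuclideanSpace ℝ (Fin n)) →L[ℝ] ℝ).contDiff
  · intro y hy
    change χ y * y j = y j
    rw [χ.one_of_mem_closedBall, one_mul]
    rw [mem_closedBall_zero_iff]
    change ‖y‖ ≤ R + 1
    linarith

lemma memLp_sum_aux {α ι F : Type*} [MeasurableSpace α] [NormedAddCommGroup F] {μ : Measure α}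
    {q : ℝ≥0∞} (s : Finset ι) (f : ι → α → F) (h : ∀ i, MemLp (f i) q μ) :
    MemLp (fun x => ∑ i ∈ s, f i x) q μ := memLp_finsetSum s fun i _ => h i

theorem exists_weakJacobian
    (Ω Ω' : Set (EuclideanSpace ℝ (Fin n))) (hΩo : IsOpen Ω)
    (p q : ℝ) (hq : 1 ≤ q) (hqp : q ≤ p) (φ : (EuclideanSpace ℝ (Fin n)) → (EuclideanSpace ℝ (Fin n)))
    (hcont : ContinuousOn φ Ω) {K : ℝ} (hK : CompBound p q K φ Ω Ω') :
    ∃ D : (EuclideanSpace ℝ (Fin n)) → ((EuclideanSpace ℝ (Fin n)) →L[ℝ] (EuclideanSpace ℝ (Fin n))), IsWeakJacobian φ D Ω ∧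
        (∀ Kc : Set (EuclideanSpace ℝ (Fin n)), Kc ⊆ Ω → IsCompact Kc →
          IntegrableOn (fun x => ‖D x‖ ^ q) Kc volume) := by
  have hp0 : 0 < p := by linarith
  have hq0 : 0 < q := by linarith
  have hqe0 : ENNReal.ofReal q ≠ 0 := by simpa using hq0
  have ht : ∀ (R : ℕ) (j : Fin n), ∃ (u : (EuclideanSpace ℝ (Fin n)) → ℝ) (v : (EuclideanSpace ℝ (Fin n)) → (EuclideanSpace ℝ (Fin n))),
      (∀ y, ‖y‖ < R → u y = y j) ∧ HasWeakGradOn (u ∘ φ) v Ω ∧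
      IntegrableOn (fun x => ‖v x‖ ^ q) Ω volume := by
    intro R j
    obtain ⟨u, hu, hc, huj⟩ := exists_test R j
    obtain ⟨h1, h2⟩ := smooth_cpt_test hu hc Ω' hp0
    obtain ⟨v, hv, hvi, -⟩ := hK u h1 h2
    exact ⟨u, v, huj, hv, hvi⟩
  choose u v huj hv hvi using ht
  set ΩR : ℕ → Set (EuclideanSpace ℝ (Fin n)) := fun R => Ω ∩ φ ⁻¹' (ball 0 R)
  have hΩR : ∀ R, IsOpen (ΩR R) := fun R => hcont.isOpen_inter_preimage hΩo isOpen_ball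
  have hin : ∀ R x, x ∈ ΩR R → ‖φ x‖ < R := fun R x hx => by simpa using hx.2
  set r : (EuclideanSpace ℝ (Fin n)) → ℕ := fun x => ⌈‖φ x‖⌉₊ + 1
  have hr : ∀ x ∈ Ω, x ∈ ΩR (r x) := by
    intro x hx
    refine ⟨hx, ?_⟩
    rw [mem_preimage, mem_ball_zero_iff]
    have := Nat.le_ceil ‖φ x‖
    simp only [r]; push_cast; linarith
  set V : Fin n → (EuclideanSpace ℝ (Fin n)) → (EuclideanSpace ℝ (Fin n)) := fun j x => v (r x) j x
  have hae : ∀ j, ∀ᵐ x ∂volume, ∀ R S, x ∈ ΩR R ∩ ΩR S → v R j x = v S j x := by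
    intro j
    rw [ae_all_iff]; intro R
    rw [ae_all_iff]; intro S
    refine weak_unique (hv R j) (hv S j) ((hΩR R).inter (hΩR S))
      (inter_subset_left.trans inter_subset_left) ?_
    intro x hx
    simp only [Function.comp]
    rw [huj R j _ (hin R x hx.1), huj S j _ (hin S x hx.2)]
  have hV : ∀ j, ∀ᵐ x ∂volume, ∀ R, x ∈ ΩR R → V j x = v R j x := by
    intro j
    filter_upwards [hae j] with x hx R hxR
    exact hx (r x) R ⟨hr x hxR.1, hxR⟩
  have hcov : ∀ k ⊆ Ω, IsCompact k → ∃ R, k ⊆ ΩR R := by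
    intro k hk hkc
    obtain ⟨C, hC⟩ := (hkc.image_of_continuousOn (hcont.mono hk)).isBounded.exists_norm_le
    refine ⟨⌈C⌉₊ + 1, fun x hx => ⟨hk hx, ?_⟩⟩
    rw [mem_preimage, mem_ball_zero_iff]
    have h1 := Nat.le_ceil C
    have h2 := hC _ (mem_image_of_mem φ hx)
    push_cast; linarith
  have hVk : ∀ j k R, IsCompact k → k ⊆ ΩR R → v R j =ᵐ[volume.restrict k] V j := by
    intro j k R hkc hkR
    refine (ae_restrict_iff' hkc.measurableSet).2 ?_
    filter_upwards [hV j] with x hx hxk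
    exact (hx R (hkR hxk)).symm
  have hφj : ∀ j : Fin n, ContinuousOn (fun x => φ x j) Ω := fun j =>
    (EuclideanSpace.proj j : (EuclideanSpace ℝ (Fin n)) →L[ℝ] ℝ).continuous.comp_continuousOn hcont
  have hVl : ∀ j, LocallyIntegrableOn (V j) Ω volume := by
    intro j
    rw [locallyIntegrableOn_iff hΩo.isLocallyClosed]
    intro k hk hkc
    obtain ⟨R, hR⟩ := hcov k hk hkc
    exact ((hv R j).2.1.integrableOn_compact_subset hk hkc).congr (hVk j k R hkc hR)
  have hwg : ∀ j, HasWeakGradOn (fun x => φ x j) (V j) Ω := by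
    intro j
    refine ⟨(hφj j).locallyIntegrableOn hΩo.measurableSet, hVl j, ?_⟩
    intro ψ hψ hc hs
    obtain ⟨R, hR⟩ := hcov _ hs hc
    have e1 := (hv R j).2.2 ψ hψ hc hs
    convert e1 using 1
    · congr 1; ext1 x
      by_cases hx : x ∈ tsupport ψ
      · simp only [Function.comp]
        rw [huj R j _ (hin R x (hR hx))]
      · rw [gradient_zero_off hx, smul_zero, smul_zero]
    · congr 1
      refine integral_congr_ae (ae_restrict_of_ae ?_)
      filter_upwards [hV j] with x hx
      by_cases hxs : x ∈ tsupport ψ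
      · rw [hx R (hR hxs)]
      · rw [image_eq_zero_of_notMem_tsupport hxs, zero_smul, zero_smul]
  have hrow : ∀ (w : Fin n → EuclideanSpace ℝ (Fin n)) j, rowOf (∑ i, rowL i (w i)) j = w j := by
    intro w j
    refine ext_inner_right ℝ fun z => ?_
    rw [inner_rowOf]
    simp [rowL, Finset.sum_apply, Pi.single_apply]
  refine ⟨fun x => ∑ j, rowL j (V j x), fun j => ?_, ?_⟩
  · have : (fun x => (WithLp.equiv 2 (Fin n → ℝ)).symm
        (fun i => (∑ j, rowL j (V j x)) (EuclideanSpace.single i 1) j)) = V j := by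
      ext1 x
      exact hrow (fun j => V j x) j
    rw [this]
    exact hwg j
  · intro k hk hkc
    obtain ⟨R, hR⟩ := hcov k hk hkc
    have hm : ∀ j, MemLp (V j) (ENNReal.ofReal q) (volume.restrict k) := by
      intro j
      refine MemLp.ae_eq (hVk j k R hkc hR) ?_
      rw [← integrable_norm_rpow_iff
        ((hv R j).2.1.integrableOn_compact_subset hk hkc).aestronglyMeasurable hqe0 (by simp),
        ENNReal.toReal_ofReal hq0.le]
      exact (hvi R j).mono_set hk
    have hD : MemLp (fun x => ∑ j, rowL j (V j x)) (ENNReal.ofReal q) (volume.restrict k) := by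
      have h1 : ∀ j, MemLp (fun x => rowL j (V j x)) (ENNReal.ofReal q) (volume.restrict k) :=
        fun j => (rowL j).comp_memLp' (hm j)
      exact memLp_sum_aux (F := (EuclideanSpace ℝ (Fin n)) →L[ℝ] (EuclideanSpace ℝ (Fin n))) _ _ h1
    have := hD.integrable_norm_rpow hqe0 (by simp)
    rwa [ENNReal.toReal_ofReal hq0.le] at this

end PartIII

end File7

section File8

open MeasureTheory Set Metric Filter
open scoped ENNReal Topology NNReal Convolution ContDiff


set_option linter.unusedSectionVars false
section PartIVa

/-- triangle wave -/
def tri (t : ℝ) : ℝ := |t - round t|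

lemma tri_nonneg (t : ℝ) : 0 ≤ tri t := abs_nonneg _

lemma tri_le (t : ℝ) : tri t ≤ 1 := (abs_sub_round t).trans (by norm_num)

lemma tri_lip (s t : ℝ) : |tri s - tri t| ≤ |s - t| := by
  unfold tri
  rw [← UnitAddCircle.norm_eq, ← UnitAddCircle.norm_eq]
  refine (abs_norm_sub_norm_le _ _).trans ?_
  rw [← AddCircle.coe_sub, UnitAddCircle.norm_eq]
  simpa using round_le (s - t) 0

lemma tri_affine (m : ℤ) : ∃ s d : ℝ, |s| = 1 ∧ ∀ t : ℝ, (m : ℝ) < 2 * t → 2 * t < m + 1 →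
    tri t = s * t + d := by
  rcases Int.even_or_odd m with ⟨k, hk⟩ | ⟨k, hk⟩
  · refine ⟨1, -k, by simp, fun t h1 h2 => ?_⟩
    have hm : (m : ℝ) = k + k := by exact_mod_cast hk
    have : round t = k := by
      rw [round_eq, Int.floor_eq_iff]
      constructor <;> linarith
    unfold tri
    rw [this, abs_of_nonneg (by linarith)]; ring
  · refine ⟨-1, k + 1, by simp, fun t h1 h2 => ?_⟩
    have hm : (m : ℝ) = 2 * k + 1 := by exact_mod_cast hk
    have : round t = k + 1 := by
      rw [round_eq, Int.floor_eq_iff]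
      constructor <;> push_cast <;> linarith
    unfold tri
    rw [this, abs_of_nonpos (by push_cast; linarith)]; push_cast; ring

lemma exists_offset {α : Type*} [MeasurableSpace α] (μ : Measure α) [SFinite μ] {g : α → ℝ}
    (hg : AEMeasurable g μ) : ∃ c : ℝ, ∀ᵐ x ∂μ, ∀ m : ℤ, 2 * (g x + c) ≠ m := by
  have hB := Measure.countable_meas_level_set_pos₀ (μ := μ) hg.nullMeasurable
  set B : Set ℝ := {t | 0 < μ {a | g a = t}}
  have hc : (⋃ m : ℤ, (fun t : ℝ => (m : ℝ) / 2 - t) '' B).Countable :=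
    countable_iUnion fun m => hB.image _
  obtain ⟨c, hcn⟩ : (⋃ m : ℤ, (fun t : ℝ => (m : ℝ) / 2 - t) '' B)ᶜ.Nonempty := by
    rw [nonempty_compl]
    intro h
    rw [h] at hc
    exact not_countable_univ hc
  refine ⟨c, ?_⟩
  rw [ae_all_iff]
  intro m
  have : (m : ℝ) / 2 - c ∉ B := by
    intro h
    apply hcn
    refine mem_iUnion.2 ⟨m, _, h, by ring⟩
  have h0 : μ {a | g a = (m : ℝ) / 2 - c} = 0 := by
    by_contra h
    exact this (pos_iff_ne_zero.2 h)
  rw [ae_iff]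
  convert h0 using 3
  ext x
  simp only [ne_eq, not_not]
  constructor <;> intro h <;> linarith

variable {n : ℕ}


lemma compBound_enn {p q K : ℝ} (hp0 : 0 < p) (hq0 : 0 < q)
    {φ : (EuclideanSpace ℝ (Fin n)) → (EuclideanSpace ℝ (Fin n))} {Ω Ω' : Set (EuclideanSpace ℝ (Fin n))} (hK0 : 0 ≤ K) (hK : CompBound p q K φ Ω Ω')
    {u : (EuclideanSpace ℝ (Fin n)) → ℝ} (hu : LocLipschitzOn u Ω')
    (hI : ∫⁻ y in Ω', ‖fderiv ℝ u y‖ₑ ^ p < ⊤) :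
    ∃ v, HasWeakGradOn (u ∘ φ) v Ω ∧
      (∫⁻ x in Ω, ‖v x‖ₑ ^ q) ^ (1/q) ≤
        ENNReal.ofReal K * (∫⁻ y in Ω', ‖fderiv ℝ u y‖ₑ ^ p) ^ (1/p) := by
  have hpe0 : ENNReal.ofReal p ≠ 0 := by simpa using hp0
  have hqe0 : ENNReal.ofReal q ≠ 0 := by simpa using hq0
  have hgm : AEStronglyMeasurable (gradient u) (volume.restrict Ω') :=
    ((LinearIsometryEquiv.continuous _).measurable.comp (measurable_fderiv ℝ u)).aestronglyMeasurable
  have he : ∀ y, ‖gradient u y‖ₑ = ‖fderiv ℝ u y‖ₑ := fun y => by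
    rw [← ofReal_norm, ← ofReal_norm, norm_gradient_eq]
  have hE : eLpNorm (gradient u) (ENNReal.ofReal p) (volume.restrict Ω') =
      (∫⁻ y in Ω', ‖fderiv ℝ u y‖ₑ ^ p) ^ (1/p) := by
    rw [eLpNorm_eq_lintegral_rpow_enorm_toReal hpe0 (by simp), ENNReal.toReal_ofReal hp0.le]
    simp only [he]
  have hgL : MemLp (gradient u) (ENNReal.ofReal p) (volume.restrict Ω') :=
    ⟨hgm, by rw [hE]; exact ENNReal.rpow_lt_top_of_nonneg (by positivity) hI.ne⟩
  have hInt0 := hgL.integrable_norm_rpow hpe0 (by simp)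
  rw [ENNReal.toReal_ofReal hp0.le] at hInt0
  obtain ⟨v, hv, hvi, hle⟩ := hK u hu hInt0
  refine ⟨v, hv, ?_⟩
  have hvL : MemLp v (ENNReal.ofReal q) (volume.restrict Ω) := by
    rw [← integrable_norm_rpow_iff hv.2.1.aestronglyMeasurable hqe0 (by simp),
      ENNReal.toReal_ofReal hq0.le]
    exact hvi
  have hEv : eLpNorm v (ENNReal.ofReal q) (volume.restrict Ω) =
      (∫⁻ y in Ω, ‖v y‖ₑ ^ q) ^ (1/q) := by
    rw [eLpNorm_eq_lintegral_rpow_enorm_toReal hqe0 (by simp), ENNReal.toReal_ofReal hq0.le]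
  rw [← hE, ← hEv, hvL.eLpNorm_eq_integral_rpow_norm hqe0 (by simp),
      hgL.eLpNorm_eq_integral_rpow_norm hpe0 (by simp), ENNReal.toReal_ofReal hq0.le,
      ENNReal.toReal_ofReal hp0.le, ← ENNReal.ofReal_mul hK0]
  refine ENNReal.ofReal_le_ofReal ?_
  simpa only [one_div] using hle

lemma affine_weakGrad {φ : (EuclideanSpace ℝ (Fin n)) → (EuclideanSpace ℝ (Fin n))} {D : (EuclideanSpace ℝ (Fin n)) → ((EuclideanSpace ℝ (Fin n)) →L[ℝ] (EuclideanSpace ℝ (Fin n)))} {Ω : Set (EuclideanSpace ℝ (Fin n))}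
    (hΩo : IsOpen Ω) (hcont : ContinuousOn φ Ω) (hJ : IsWeakJacobian φ D Ω) (b : EuclideanSpace ℝ (Fin n)) (c : ℝ) :
    HasWeakGradOn (fun x => inner ℝ b (φ x) + c)
      (fun x => ContinuousLinearMap.adjoint (D x) b) Ω := by
  have hφl : LocallyIntegrableOn φ Ω volume := hcont.locallyIntegrableOn hΩo.measurableSet
  refine HasWeakGradOn.of_wd ?_ ?_ ?_
  · exact ((continuousOn_const.inner hcont).add continuousOn_const).locallyIntegrableOn
      hΩo.measurableSet
  · have h1 : LocallyIntegrableOn (fun x => ContinuousLinearMap.adjoint (D x)) Ω volume :=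
      ContinuousLinearMap.locallyIntegrableOn_comp
        ((ContinuousLinearMap.adjoint : ((EuclideanSpace ℝ (Fin n)) →L[ℝ] (EuclideanSpace ℝ (Fin n))) ≃ₗᵢ⋆[ℝ] _).toContinuousLinearEquiv :
          ((EuclideanSpace ℝ (Fin n)) →L[ℝ] (EuclideanSpace ℝ (Fin n))) →L⋆[ℝ] ((EuclideanSpace ℝ (Fin n)) →L[ℝ] (EuclideanSpace ℝ (Fin n)))) hJ.locInt
    exact ContinuousLinearMap.locallyIntegrableOn_comp (ContinuousLinearMap.apply ℝ (EuclideanSpace ℝ (Fin n)) b) h1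
  · intro ψ hψ hc hs w
    have h1 := hJ.wd hφl ψ hψ hc hs w
    have i1 := int_fderiv_smul hφl hψ hc hs w
    have i2 := int_smul_clm hJ.locInt hψ.continuous hc hs w
    have i3 : Integrable (fun x => fderiv ℝ ψ x w * c) volume := by
      have := int_fderiv_smul (locallyIntegrableOn_const (μ := volume) (s := Ω) c) hψ hc hs w
      simpa using this
    have h3 : ∫ x, fderiv ℝ ψ x w * c = 0 := by
      have := lip_wd (μ := (volume : Measure (EuclideanSpace ℝ (Fin n)))) (LipschitzWith.const (α := EuclideanSpace ℝ (Fin n)) c) ψ hψ hc (subset_univ _) w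
      simpa using this
    have h4 := congrArg (fun z => inner ℝ b z) h1
    simp only [inner_neg_right] at h4
    rw [← integral_inner i1, ← integral_inner i2] at h4
    simp only [smul_eq_mul, mul_add]
    rw [integral_add _ i3, h3, add_zero]
    · simp only [innerSL_apply_apply, ContinuousLinearMap.adjoint_inner_left]
      simpa only [inner_smul_right] using h4
    · simpa only [inner_smul_right] using i1.const_inner (𝕜 := ℝ) b

end PartIVa

end File8

section File9

open MeasureTheory Set Metric Filter
open scoped ENNReal Topology NNReal Convolution ContDiff


set_option linter.unusedSectionVars false
section PartIVb

variable {n : ℕ}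


lemma piece_lip {θ : (EuclideanSpace ℝ (Fin n)) → ℝ} {M : ℝ} (hθ0 : ∀ y, 0 ≤ θ y) (hθ1 : ∀ y, θ y ≤ 1)
    (hθ : ∀ x y, |θ x - θ y| ≤ M * dist x y) (a : EuclideanSpace ℝ (Fin n)) (c : ℝ) {ε : ℝ} (hε : 0 < ε) (hM : 0 ≤ M) :
    LipschitzWith (‖a‖ + M * ε).toNNReal
      (fun y => θ y * (ε * tri (inner ℝ a y / ε + c))) := by
  refine LipschitzWith.of_dist_le_mul fun x y => ?_
  rw [Real.dist_eq, Real.coe_toNNReal _ (by positivity)]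
  set wx := ε * tri (inner ℝ a x / ε + c)
  set wy := ε * tri (inner ℝ a y / ε + c)
  have h1 : |wx - wy| ≤ ‖a‖ * dist x y := by
    simp only [wx, wy]
    rw [← mul_sub, abs_mul, abs_of_pos hε]
    calc ε * |tri (inner ℝ a x / ε + c) - tri (inner ℝ a y / ε + c)|
        ≤ ε * |(inner ℝ a x / ε + c) - (inner ℝ a y / ε + c)| := by
          exact mul_le_mul_of_nonneg_left (tri_lip _ _) hε.le
      _ = |inner ℝ a (x - y)| := by
          have : (inner ℝ a x / ε + c) - (inner ℝ a y / ε + c) = inner ℝ a (x - y) / ε := by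
            rw [inner_sub_right]; ring
          rw [this, abs_div, abs_of_pos hε]; field_simp
      _ ≤ ‖a‖ * dist x y := by
          rw [dist_eq_norm]; exact abs_real_inner_le_norm _ _
  have h2 : |wy| ≤ ε := by
    simp only [wy]
    rw [abs_mul, abs_of_pos hε, abs_of_nonneg (tri_nonneg _)]
    nlinarith [tri_le (inner ℝ a y / ε + c)]
  have h3 : θ x * wx - θ y * wy = θ x * (wx - wy) + (θ x - θ y) * wy := by ring
  rw [h3]
  refine (abs_add_le _ _).trans ?_
  rw [abs_mul, abs_mul, abs_of_nonneg (hθ0 x)]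
  have h4 : θ x * |wx - wy| ≤ 1 * (‖a‖ * dist x y) :=
    mul_le_mul (hθ1 x) h1 (abs_nonneg _) zero_le_one
  have h5 : |θ x - θ y| * |wy| ≤ (M * dist x y) * ε :=
    mul_le_mul (hθ x y) h2 (abs_nonneg _) (by positivity)
  linarith

lemma lip_sum {ι : Type*} (s : Finset ι) (f : ι → (EuclideanSpace ℝ (Fin n)) → ℝ) (h : ∀ i, ∃ L : ℝ≥0, LipschitzWith L (f i)) :
    ∃ L : ℝ≥0, LipschitzWith L (fun y => ∑ i ∈ s, f i y) := by
  classical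
  induction s using Finset.induction_on with
  | empty => exact ⟨0, by simp⟩
  | insert a s ha ih =>
    obtain ⟨L1, h1⟩ := h a
    obtain ⟨L2, h2⟩ := ih
    exact ⟨L1 + L2, by simpa only [Finset.sum_insert ha] using h1.add h2⟩

lemma test_fn {ι : Type*} [Fintype ι] (C : ι → Set (EuclideanSpace ℝ (Fin n))) (a : ι → EuclideanSpace ℝ (Fin n)) (c : ι → ℝ) {ε δ : ℝ}
    (hε : 0 < ε) (hδ : 0 < δ)
    (hd : Pairwise fun i j => Disjoint (thickening (δ + δ) (C i)) (thickening (δ + δ) (C j))) :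
    ∃ u : (EuclideanSpace ℝ (Fin n)) → ℝ, (∃ L : ℝ≥0, LipschitzWith L u) ∧
      (∀ i, ∀ y ∈ thickening δ (C i), u y = ε * tri (inner ℝ (a i) y / ε + c i)) ∧
      (∀ i, ∀ y ∈ thickening (δ + δ) (C i), ‖fderiv ℝ u y‖ ≤ ‖a i‖ + ε / δ) ∧
      (∀ y, (∀ i, y ∉ thickening (δ + δ) (C i)) → fderiv ℝ u y = 0) := by
  set θ : ι → (EuclideanSpace ℝ (Fin n)) → ℝ := fun i y => (thickenedIndicator hδ (thickening δ (C i)) y : ℝ)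
  have hθ0 : ∀ i y, 0 ≤ θ i y := fun i y => NNReal.coe_nonneg _
  have hθ1 : ∀ i y, θ i y ≤ 1 := fun i y => by
    exact_mod_cast thickenedIndicator_le_one hδ _ y
  have hθl : ∀ i x y, |θ i x - θ i y| ≤ δ⁻¹ * dist x y := by
    intro i x y
    have := (lipschitzWith_thickenedIndicator hδ (thickening δ (C i))).dist_le_mul x y
    rwa [NNReal.dist_eq, NNReal.coe_inv, Real.coe_toNNReal _ hδ.le] at this
  have hθone : ∀ i, ∀ y ∈ thickening δ (C i), θ i y = 1 := by
    intro i y hy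
    have h := thickenedIndicator_one hδ _ hy
    change ((thickenedIndicator hδ (thickening δ (C i)) y : ℝ≥0) : ℝ) = 1
    rw [h]; rfl
  have hθz : ∀ i y, y ∉ thickening (δ + δ) (C i) → θ i y = 0 := by
    intro i y hy
    have : y ∉ thickening δ (thickening δ (C i)) := fun h =>
      hy (thickening_thickening_subset δ δ (C i) h)
    have h := thickenedIndicator_zero hδ _ this
    change ((thickenedIndicator hδ (thickening δ (C i)) y : ℝ≥0) : ℝ) = 0
    rw [h]; rfl
  set w : ι → (EuclideanSpace ℝ (Fin n)) → ℝ := fun i y => θ i y * (ε * tri (inner ℝ (a i) y / ε + c i))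
  have hw0 : ∀ i y, 0 ≤ w i y := fun i y => mul_nonneg (hθ0 i y) (mul_nonneg hε.le (tri_nonneg _))
  have hwl : ∀ i, LipschitzWith (‖a i‖ + δ⁻¹ * ε).toNNReal (w i) := fun i =>
    piece_lip (hθ0 i) (hθ1 i) (hθl i) (a i) (c i) hε (by positivity)
  have hwz : ∀ i y, y ∉ thickening (δ + δ) (C i) → w i y = 0 := fun i y hy => by
    simp [w, hθz i y hy]
  have hloc : ∀ i, ∀ y ∈ thickening (δ + δ) (C i), ∑ j, w j y = w i y := by
    intro i y hy
    refine Finset.sum_eq_single_of_mem i (Finset.mem_univ _) fun j _ hj => hwz j y ?_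
    exact disjoint_right.1 (hd hj) hy
  refine ⟨fun y => ∑ i, w i y, lip_sum _ _ fun i => ⟨_, hwl i⟩, ?_, ?_, ?_⟩
  · intro i y hy
    have := hloc i y (thickening_mono (by linarith) _ hy)
    simp only [this, w, hθone i y hy, one_mul]
  · intro i y hy
    have : (fun y => ∑ i, w i y) =ᶠ[𝓝 y] w i := by
      filter_upwards [isOpen_thickening.mem_nhds hy] with z hz
      exact hloc i z hz
    rw [this.fderiv_eq]
    refine (norm_fderiv_le_of_lipschitz ℝ (hwl i)).trans (le_of_eq ?_)
    rw [Real.coe_toNNReal _ (by positivity)]; ring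
  · intro y hy
    refine IsLocalMin.fderiv_eq_zero (Eventually.of_forall fun z => ?_)
    have h1 : ∑ i, w i y = 0 := Finset.sum_eq_zero fun i _ => hwz i y (hy i)
    simp only [h1]
    exact Finset.sum_nonneg fun i _ => hw0 i z

lemma test_bound_eps {p q K : ℝ} (hq : 1 ≤ q) (hqp : q ≤ p)
    {φ : (EuclideanSpace ℝ (Fin n)) → (EuclideanSpace ℝ (Fin n))} {Ω Ω' : Set (EuclideanSpace ℝ (Fin n))} (hΩo : IsOpen Ω)
    (hcont : ContinuousOn φ Ω) (hK0 : 0 ≤ K) (hK : CompBound p q K φ Ω Ω')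
    {D : (EuclideanSpace ℝ (Fin n)) → ((EuclideanSpace ℝ (Fin n)) →L[ℝ] (EuclideanSpace ℝ (Fin n)))} (hJ : IsWeakJacobian φ D Ω)
    {ι : Type*} [Fintype ι] (C : ι → Set (EuclideanSpace ℝ (Fin n))) (hC : ∀ i, IsCompact (C i)) (a : ι → EuclideanSpace ℝ (Fin n)) {ε δ : ℝ}
    (hε : 0 < ε) (hδ : 0 < δ)
    (hd : Pairwise fun i j => Disjoint (thickening (δ + δ) (C i)) (thickening (δ + δ) (C j))) :
    (∑ i, ∫⁻ x in Ω ∩ φ ⁻¹' (C i), ‖ContinuousLinearMap.adjoint (D x) (a i)‖ₑ ^ q) ^ (1/q) ≤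
      ENNReal.ofReal K *
        (∑ i, ENNReal.ofReal (‖a i‖ + ε / δ) ^ p * volume (thickening (δ + δ) (C i))) ^ (1/p) := by
  have hp0 : 0 < p := by linarith
  have hq0 : 0 < q := by linarith
  have hoff : ∀ i, ∃ c : ℝ, ∀ᵐ x ∂(volume.restrict Ω), ∀ m : ℤ,
      2 * (inner ℝ (a i) (φ x) / ε + c) ≠ m := fun i =>
    exists_offset _ (((continuousOn_const.inner hcont).div_const ε).aemeasurable hΩo.measurableSet)
  choose c hc using hoff
  obtain ⟨u, ⟨L, hL⟩, hu1, hu2, hu3⟩ := test_fn C a c hε hδ hd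
  have hIle : ∫⁻ y in Ω', ‖fderiv ℝ u y‖ₑ ^ p ≤
      ∑ i, ENNReal.ofReal (‖a i‖ + ε / δ) ^ p * volume (thickening (δ + δ) (C i)) := by
    calc ∫⁻ y in Ω', ‖fderiv ℝ u y‖ₑ ^ p ≤ ∫⁻ y, ‖fderiv ℝ u y‖ₑ ^ p :=
          setLIntegral_le_lintegral _ _
      _ ≤ ∫⁻ y, ∑ i, (thickening (δ + δ) (C i)).indicator
            (fun _ => ENNReal.ofReal (‖a i‖ + ε / δ) ^ p) y := by
          refine lintegral_mono fun y => ?_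
          by_cases hy : ∃ i, y ∈ thickening (δ + δ) (C i)
          · obtain ⟨i, hi⟩ := hy
            refine le_trans ?_ (Finset.single_le_sum (fun _ _ => zero_le) (Finset.mem_univ i))
            rw [indicator_of_mem hi]
            refine ENNReal.rpow_le_rpow ?_ hp0.le
            rw [← ofReal_norm]
            exact ENNReal.ofReal_le_ofReal (hu2 i y hi)
          · push Not at hy
            rw [hu3 y hy]
            have h0 : ‖(0 : (EuclideanSpace ℝ (Fin n)) →L[ℝ] ℝ)‖ₑ ^ p = 0 := by
              rw [← ofReal_norm, norm_zero, ENNReal.ofReal_zero, ENNReal.zero_rpow_of_pos hp0]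
            rw [h0]; exact zero_le
      _ = _ := by
          rw [lintegral_finsetSum]
          · refine Finset.sum_congr rfl fun i _ => ?_
            rw [lintegral_indicator_const isOpen_thickening.measurableSet]
          · exact fun i _ => measurable_const.indicator isOpen_thickening.measurableSet
  have hfin : ∑ i, ENNReal.ofReal (‖a i‖ + ε / δ) ^ p * volume (thickening (δ + δ) (C i)) < ⊤ := by
    refine ENNReal.sum_lt_top.2 fun i _ => ENNReal.mul_lt_top ?_ ?_
    · exact ENNReal.rpow_lt_top_of_nonneg hp0.le ENNReal.ofReal_ne_top
    · exact (hC i).isBounded.thickening.measure_lt_top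
  obtain ⟨v, hv, hvle⟩ := compBound_enn hp0 hq0 hK0 hK (u := u)
    (fun k _ _ => ⟨L, hL.lipschitzOnWith⟩) (hIle.trans_lt hfin)
  refine le_trans ?_ (hvle.trans ?_)
  swap
  · gcongr
  refine ENNReal.rpow_le_rpow ?_ (by positivity)
  -- pointwise identification
  have hpt : ∀ i, ∀ᵐ x ∂(volume.restrict Ω), φ x ∈ C i →
      ‖ContinuousLinearMap.adjoint (D x) (a i)‖ₑ = ‖v x‖ₑ := by
    intro i
    set g : (EuclideanSpace ℝ (Fin n)) → ℝ := fun x => inner ℝ (a i) (φ x) / ε + c i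
    have hg : ContinuousOn g Ω :=
      ((continuousOn_const.inner hcont).div_const ε).add continuousOn_const
    have hW : ∀ᵐ x ∂volume, ∀ m : ℤ, x ∈ (Ω ∩ φ ⁻¹' (thickening δ (C i))) ∩
        (Ω ∩ g ⁻¹' {t | (m : ℝ) < 2 * t ∧ 2 * t < m + 1}) →
        ‖v x‖ₑ = ‖ContinuousLinearMap.adjoint (D x) (a i)‖ₑ := by
      rw [ae_all_iff]
      intro m
      obtain ⟨s, d, hs, htri⟩ := tri_affine m
      have hop : IsOpen {t : ℝ | (m : ℝ) < 2 * t ∧ 2 * t < m + 1} :=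
        (isOpen_lt (f := fun _ : ℝ => (m : ℝ)) (g := fun t : ℝ => 2 * t) (by fun_prop) (by fun_prop)).inter
          (isOpen_lt (f := fun t : ℝ => 2 * t) (g := fun _ : ℝ => (m : ℝ) + 1) (by fun_prop) (by fun_prop))
      have haff := affine_weakGrad hΩo hcont hJ (s • a i) (ε * (s * c i + d))
      have := weak_unique hv haff
        ((hcont.isOpen_inter_preimage hΩo (isOpen_thickening (δ := δ) (E := C i))).inter
          (hg.isOpen_inter_preimage hΩo hop)) (inter_subset_left.trans inter_subset_left) ?_
      · filter_upwards [this] with x hx hxW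
        rw [hx hxW, map_smul, enorm_smul]
        rw [← ofReal_norm, Real.norm_eq_abs, hs]; simp
      · intro x hx
        simp only [Function.comp]
        rw [hu1 i _ hx.1.2, htri _ hx.2.2.1 hx.2.2.2, inner_smul_left]
        simp only [conj_trivial]
        have hgx : ε * g x = inner ℝ (a i) (φ x) + ε * c i := by
          simp only [g]; field_simp
        change ε * (s * g x + d) = s * inner ℝ (a i) (φ x) + ε * (s * c i + d)
        linear_combination s * hgx
    have hm := ae_restrict_mem (μ := (volume : Measure (EuclideanSpace ℝ (Fin n)))) hΩo.measurableSet
    have hW' := ae_restrict_of_ae (s := Ω) hW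
    filter_upwards [hW', hc i, hm] with x hx hcx hxΩ hxC
    have m1 : φ x ∈ thickening δ (C i) := self_subset_thickening hδ (C i) hxC
    have m2 : ((⌊2 * g x⌋ : ℤ) : ℝ) < 2 * g x :=
      lt_of_le_of_ne (Int.floor_le (2 * g x)) (hcx ⌊2 * g x⌋).symm
    have m3 : 2 * g x < ((⌊2 * g x⌋ : ℤ) : ℝ) + 1 := Int.lt_floor_add_one (2 * g x)
    have m4 : x ∈ (Ω ∩ φ ⁻¹' (thickening δ (C i))) ∩
        (Ω ∩ g ⁻¹' {t | ((⌊2 * g x⌋ : ℤ) : ℝ) < 2 * t ∧ 2 * t < ((⌊2 * g x⌋ : ℤ) : ℝ) + 1}) :=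
      And.intro (And.intro hxΩ m1) (And.intro hxΩ (And.intro m2 m3))
    exact (hx _ m4).symm
  have hCm : ∀ i, MeasurableSet (Ω ∩ φ ⁻¹' (C i)) := by
    intro i
    have h1 := hcont.isOpen_inter_preimage hΩo (hC i).isClosed.isOpen_compl
    have h2 : Ω ∩ φ ⁻¹' (C i) = Ω \ (Ω ∩ φ ⁻¹' (C i)ᶜ) := by
      ext x; simp
    rw [h2]
    exact hΩo.measurableSet.diff h1.measurableSet
  have hdis : Pairwise fun i j => Disjoint (Ω ∩ φ ⁻¹' (C i)) (Ω ∩ φ ⁻¹' (C j)) := by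
    intro i j hij
    have : Disjoint (C i) (C j) := (hd hij).mono (self_subset_thickening (by positivity) _)
      (self_subset_thickening (by positivity) _)
    exact (this.preimage φ).mono inter_subset_right inter_subset_right
  calc ∑ i, ∫⁻ x in Ω ∩ φ ⁻¹' (C i), ‖ContinuousLinearMap.adjoint (D x) (a i)‖ₑ ^ q
      = ∑ i, ∫⁻ x in Ω ∩ φ ⁻¹' (C i), ‖v x‖ₑ ^ q := by
        refine Finset.sum_congr rfl fun i _ => ?_
        refine setLIntegral_congr_fun_ae (hCm i) ?_
        filter_upwards [(ae_restrict_iff' hΩo.measurableSet).1 (hpt i)] with x hx hxC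
        rw [hx hxC.1 hxC.2]
    _ = ∫⁻ x in ⋃ i, Ω ∩ φ ⁻¹' (C i), ‖v x‖ₑ ^ q := by
        rw [lintegral_iUnion hCm hdis, tsum_fintype]
    _ ≤ _ := lintegral_mono_set (iUnion_subset fun i => inter_subset_left)

theorem test_bound {p q K : ℝ} (hq : 1 ≤ q) (hqp : q ≤ p)
    {φ : (EuclideanSpace ℝ (Fin n)) → (EuclideanSpace ℝ (Fin n))} {Ω Ω' : Set (EuclideanSpace ℝ (Fin n))} (hΩo : IsOpen Ω)
    (hcont : ContinuousOn φ Ω) (hK0 : 0 ≤ K) (hK : CompBound p q K φ Ω Ω')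
    {D : (EuclideanSpace ℝ (Fin n)) → ((EuclideanSpace ℝ (Fin n)) →L[ℝ] (EuclideanSpace ℝ (Fin n)))} (hJ : IsWeakJacobian φ D Ω)
    {ι : Type*} [Fintype ι] (C : ι → Set (EuclideanSpace ℝ (Fin n))) (hC : ∀ i, IsCompact (C i)) (a : ι → EuclideanSpace ℝ (Fin n))
    (hd : Pairwise fun i j => Disjoint (C i) (C j)) :
    (∑ i, ∫⁻ x in Ω ∩ φ ⁻¹' (C i), ‖ContinuousLinearMap.adjoint (D x) (a i)‖ₑ ^ q) ^ (1/q) ≤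
      ENNReal.ofReal K * (∑ i, ‖a i‖ₑ ^ p * volume (C i)) ^ (1/p) := by
  have hp0 : 0 < p := by linarith
  have hev : ∀ᶠ δ : ℝ in 𝓝[>] 0, Pairwise fun i j =>
      Disjoint (thickening (δ + δ) (C i)) (thickening (δ + δ) (C j)) := by
    have : ∀ i j, ∀ᶠ δ : ℝ in 𝓝[>] 0, i ≠ j →
        Disjoint (thickening (δ + δ) (C i)) (thickening (δ + δ) (C j)) := by
      intro i j
      by_cases hij : i = j
      · exact Eventually.of_forall fun _ h => absurd hij h
      obtain ⟨η, hη, hdis⟩ := (hd hij).exists_thickenings (hC i) (hC j).isClosed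
      have : ∀ᶠ δ : ℝ in 𝓝[>] 0, δ < η / 2 :=
        mem_nhdsWithin_of_mem_nhds (Iio_mem_nhds (by positivity))
      filter_upwards [this] with δ hδ _
      exact hdis.mono (thickening_mono (by linarith) _) (thickening_mono (by linarith) _)
    have h2 : ∀ᶠ δ : ℝ in 𝓝[>] 0, ∀ i j, i ≠ j →
        Disjoint (thickening (δ + δ) (C i)) (thickening (δ + δ) (C j)) :=
      eventually_all.2 fun i => eventually_all.2 fun j => this i j
    filter_upwards [h2] with δ h i j hij
    exact h i j hij
  have hlim : Tendsto (fun δ : ℝ => ENNReal.ofReal K *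
      (∑ i, ENNReal.ofReal (‖a i‖ + δ * δ / δ) ^ p * volume (thickening (δ + δ) (C i))) ^ (1/p))
      (𝓝[>] 0) (𝓝 (ENNReal.ofReal K * (∑ i, ‖a i‖ₑ ^ p * volume (C i)) ^ (1/p))) := by
    refine ENNReal.Tendsto.const_mul ?_ (Or.inr ENNReal.ofReal_ne_top)
    refine Tendsto.ennrpow_const _ ?_
    refine tendsto_finsetSum _ fun i _ => ?_
    have hfin : ∃ R > 0, volume (thickening R (C i)) ≠ ⊤ :=
      ⟨1, one_pos, (hC i).isBounded.thickening.measure_lt_top.ne⟩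
    refine ENNReal.Tendsto.mul ?_ (Or.inr (hC i).measure_lt_top.ne) ?_
      (Or.inr (ENNReal.rpow_lt_top_of_nonneg hp0.le enorm_ne_top).ne)
    · refine Tendsto.ennrpow_const _ ?_
      rw [← ofReal_norm]
      refine ENNReal.tendsto_ofReal ?_
      have h1 : Tendsto (fun δ : ℝ => ‖a i‖ + δ) (𝓝[>] 0) (𝓝 ‖a i‖) := by
        have : Tendsto (fun δ : ℝ => ‖a i‖ + δ) (𝓝 0) (𝓝 (‖a i‖ + 0)) :=
          (continuous_const.add continuous_id).tendsto 0
        rw [add_zero] at this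
        exact this.mono_left nhdsWithin_le_nhds
      refine h1.congr' ?_
      filter_upwards [self_mem_nhdsWithin] with δ hδ
      rw [mul_div_assoc, div_self (ne_of_gt hδ), mul_one]
    · refine (tendsto_measure_thickening_of_isClosed hfin (hC i).isClosed).comp ?_
      refine tendsto_nhdsWithin_iff.2 ⟨?_, ?_⟩
      · have : Tendsto (fun δ : ℝ => δ + δ) (𝓝 0) (𝓝 (0 + 0)) :=
          (continuous_id.add continuous_id).tendsto 0
        rw [add_zero] at this
        exact this.mono_left nhdsWithin_le_nhds
      · filter_upwards [self_mem_nhdsWithin] with δ hδ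
        have : 0 < δ := hδ
        exact add_pos this this
  refine ge_of_tendsto hlim ?_
  filter_upwards [hev, self_mem_nhdsWithin] with δ hδ hδ0
  have h0 : 0 < δ := hδ0
  exact test_bound_eps hq hqp hΩo hcont hK0 hK hJ C hC a (mul_pos h0 h0) h0 hδ

end PartIVb

end File9

section File10

open MeasureTheory Set Metric Filter
open scoped ENNReal Topology NNReal Convolution ContDiff


set_option linter.unusedSectionVars false
section PartIVc

variable {n : ℕ}


lemma exists_compacts {A : Set (EuclideanSpace ℝ (Fin n))} (hA : MeasurableSet A) :
    ∃ C : ℕ → Set (EuclideanSpace ℝ (Fin n)), Monotone C ∧ (∀ k, IsCompact (C k)) ∧ (∀ k, C k ⊆ A) ∧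
      volume (A \ ⋃ k, C k) = 0 := by
  set ν : Measure (EuclideanSpace ℝ (Fin n)) := (volume : Measure (EuclideanSpace ℝ (Fin n))).toFinite
  have h : ∀ k : ℕ, ∃ K ⊆ A, IsCompact K ∧ ν (A \ K) < ((k : ℝ≥0∞) + 1)⁻¹ := by
    intro k
    refine hA.exists_isCompact_sdiff_lt (measure_ne_top ν A) ?_
    simp
  choose K hKA hKc hKl using h
  refine ⟨accumulate K, monotone_accumulate, fun k => ?_, fun k => ?_, ?_⟩
  · rw [accumulate_def]
    exact (finite_Iic k).isCompact_biUnion fun i _ => hKc i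
  · rw [accumulate_def]
    exact iUnion₂_subset fun i _ => hKA i
  · refine absolutelyContinuous_toFinite (volume : Measure (EuclideanSpace ℝ (Fin n))) ?_
    rw [iUnion_accumulate]
    have hle : ∀ k : ℕ, ν (A \ ⋃ k, K k) ≤ ((k : ℝ≥0∞) + 1)⁻¹ := fun k =>
      (measure_mono (sdiff_subset_sdiff_right (subset_iUnion K k))).trans (hKl k).le
    have hlim : Tendsto (fun k : ℕ => ((k : ℝ≥0∞) + 1)⁻¹) atTop (𝓝 0) := by
      have := (tendsto_add_atTop_iff_nat 1).2 ENNReal.tendsto_inv_nat_nhds_zero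
      refine this.congr fun k => ?_
      push_cast; rfl
    exact le_antisymm (ge_of_tendsto' hlim hle) bot_le

lemma tendsto_setLIntegral_compacts {A : Set (EuclideanSpace ℝ (Fin n))} (hA : MeasurableSet A) {C : ℕ → Set (EuclideanSpace ℝ (Fin n))}
    (hm : Monotone C) (hc : ∀ k, IsCompact (C k)) (hs : ∀ k, C k ⊆ A)
    (h0 : volume (A \ ⋃ k, C k) = 0) (F : (EuclideanSpace ℝ (Fin n)) → ℝ≥0∞) :
    Tendsto (fun k => ∫⁻ x in C k, F x) atTop (𝓝 (∫⁻ x in A, F x)) := by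
  set ν := (volume : Measure (EuclideanSpace ℝ (Fin n))).withDensity F
  have h1 := tendsto_measure_iUnion_atTop (μ := ν) hm
  have hU : MeasurableSet (⋃ k, C k) := MeasurableSet.iUnion fun k => (hc k).measurableSet
  have h2 : ν (⋃ k, C k) = ν A := by
    refine le_antisymm (measure_mono (iUnion_subset hs)) ?_
    have : ν (A \ ⋃ k, C k) = 0 := withDensity_absolutelyContinuous _ _ h0
    calc ν A ≤ ν ((⋃ k, C k) ∪ (A \ ⋃ k, C k)) := measure_mono (by rw [union_sdiff_self]; exact subset_union_right)
      _ ≤ _ := measure_union_le _ _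
      _ = _ := by rw [this, add_zero]
  rw [h2, withDensity_apply _ hA] at h1
  refine h1.congr fun k => ?_
  exact withDensity_apply _ (hc k).measurableSet

theorem simple_bound {p q K : ℝ} (hq : 1 ≤ q) (hqp : q ≤ p)
    {φ : (EuclideanSpace ℝ (Fin n)) → (EuclideanSpace ℝ (Fin n))} {Ω Ω' : Set (EuclideanSpace ℝ (Fin n))} (hΩo : IsOpen Ω)
    (hcont : ContinuousOn φ Ω) (hinj : InjOn φ Ω) (hK0 : 0 ≤ K) (hK : CompBound p q K φ Ω Ω')
    {D : (EuclideanSpace ℝ (Fin n)) → ((EuclideanSpace ℝ (Fin n)) →L[ℝ] (EuclideanSpace ℝ (Fin n)))} (hJ : IsWeakJacobian φ D Ω)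
    (b : SimpleFunc (EuclideanSpace ℝ (Fin n)) (EuclideanSpace ℝ (Fin n))) :
    (∫⁻ x in Ω, ‖ContinuousLinearMap.adjoint (D x) (b x)‖ₑ ^ q) ^ (1/q) ≤
      ENNReal.ofReal K * (∫⁻ x in Ω, ‖b x‖ₑ ^ p * ENNReal.ofReal |(D x).det|) ^ (1/p) := by
  have hp0 : 0 < p := by linarith
  have hq0 : 0 < q := by linarith
  have hφLI : LocallyIntegrableOn φ Ω volume := hcont.locallyIntegrableOn hΩo.measurableSet
  obtain ⟨G, hGm, hGΩ, hG0, harea⟩ := area_package hΩo hcont hinj hJ.locInt (hJ.wd hφLI)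
  have hGae : volume.restrict Ω = volume.restrict G := by
    refine Measure.restrict_congr_set ?_
    refine (ae_le_set.2 hG0).antisymm (LE.le.eventuallyLE hGΩ)
  rw [hGae]
  set A : b.range → Set (EuclideanSpace ℝ (Fin n)) := fun y => G ∩ b ⁻¹' {(y : EuclideanSpace ℝ (Fin n))}
  have hAm : ∀ y, MeasurableSet (A y) := fun y => hGm.inter (b.measurableSet_fiber _)
  have hGU : G = ⋃ y, A y := by
    ext x
    simp only [A, mem_iUnion, mem_inter_iff, mem_preimage, mem_singleton_iff]
    exact ⟨fun h => ⟨⟨b x, b.mem_range_self x⟩, h, rfl⟩, fun ⟨_, h, _⟩ => h⟩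
  have hAd : Pairwise (Function.onFun Disjoint A) := by
    intro y z hyz
    refine disjoint_left.2 fun x hx hx' => hyz (Subtype.ext ?_)
    exact hx.2.symm.trans hx'.2
  have hsplit : ∀ F : (EuclideanSpace ℝ (Fin n)) → ℝ≥0∞, ∫⁻ x in G, F x = ∑ y, ∫⁻ x in A y, F x := by
    intro F
    conv_lhs => rw [hGU]
    rw [lintegral_iUnion hAm hAd, tsum_fintype]
  choose C hCm hCc hCA hC0 using fun y => exists_compacts (hAm y)
  have hCΩ : ∀ y k, C y k ⊆ Ω := fun y k => (hCA y k).trans (inter_subset_left.trans hGΩ)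
  have hpre : ∀ y k, Ω ∩ φ ⁻¹' (φ '' C y k) = C y k := by
    intro y k
    ext x
    constructor
    · rintro ⟨hx, z, hz, hzx⟩
      rwa [← hinj (hCΩ y k hz) hx hzx]
    · exact fun hx => ⟨hCΩ y k hx, mem_image_of_mem _ hx⟩
  have hvol : ∀ y k, volume (φ '' C y k) ≤ ∫⁻ x in A y, ENNReal.ofReal |(D x).det| := by
    intro y k
    have := harea (C y k) ((hCA y k).trans inter_subset_left) (hCc y k).measurableSet 1
    simp only [Pi.one_apply, mul_one, lintegral_one, Measure.restrict_apply_univ] at this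
    rw [this]
    exact lintegral_mono_set (hCA y k)
  have hstep : ∀ k : ℕ,
      (∑ y : b.range, ∫⁻ x in C y k, ‖ContinuousLinearMap.adjoint (D x) (y : EuclideanSpace ℝ (Fin n))‖ₑ ^ q) ^ (1/q) ≤
      ENNReal.ofReal K * (∑ y : b.range, ‖(y : EuclideanSpace ℝ (Fin n))‖ₑ ^ p *
        ∫⁻ x in A y, ENNReal.ofReal |(D x).det|) ^ (1/p) := by
    intro k
    have hd : Pairwise fun y z => Disjoint (φ '' C y k) (φ '' C z k) := by
      intro y z hyz
      refine disjoint_left.2 ?_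
      rintro _ ⟨x, hx, rfl⟩ ⟨x', hx', he⟩
      have := hinj (hCΩ z k hx') (hCΩ y k hx) he
      subst this
      exact disjoint_left.1 (hAd hyz) (hCA y k hx) (hCA z k hx')
    have := test_bound hq hqp hΩo hcont hK0 hK hJ (fun y : b.range => φ '' C y k)
      (fun y => (hCc y k).image_of_continuousOn (hcont.mono (hCΩ y k))) (fun y => (y : EuclideanSpace ℝ (Fin n))) hd
    simp only [hpre] at this
    refine this.trans ?_
    gcongr with y
    exact hvol y k
  have hlim : Tendsto (fun k : ℕ =>
      (∑ y : b.range, ∫⁻ x in C y k, ‖ContinuousLinearMap.adjoint (D x) (y : EuclideanSpace ℝ (Fin n))‖ₑ ^ q) ^ (1/q))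
      atTop (𝓝 ((∑ y : b.range, ∫⁻ x in A y,
        ‖ContinuousLinearMap.adjoint (D x) (y : EuclideanSpace ℝ (Fin n))‖ₑ ^ q) ^ (1/q))) := by
    refine Tendsto.ennrpow_const _ (tendsto_finsetSum _ fun y _ => ?_)
    exact tendsto_setLIntegral_compacts (hAm y) (hCm y) (hCc y) (hCA y) (hC0 y) _
  have hfin := le_of_tendsto' hlim hstep
  rw [hsplit, hsplit]
  have e1 : ∀ y : b.range, ∫⁻ x in A y, ‖ContinuousLinearMap.adjoint (D x) (b x)‖ₑ ^ q =
      ∫⁻ x in A y, ‖ContinuousLinearMap.adjoint (D x) (y : EuclideanSpace ℝ (Fin n))‖ₑ ^ q := by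
    intro y
    refine setLIntegral_congr_fun (hAm y) fun x hx => ?_
    have : b x = y := hx.2
    simp only [this]
  have e2 : ∀ y : b.range, ∫⁻ x in A y, ‖b x‖ₑ ^ p * ENNReal.ofReal |(D x).det| =
      ‖(y : EuclideanSpace ℝ (Fin n))‖ₑ ^ p * ∫⁻ x in A y, ENNReal.ofReal |(D x).det| := by
    intro y
    rw [← lintegral_const_mul' _ _ (ENNReal.rpow_lt_top_of_nonneg hp0.le enorm_ne_top).ne]
    refine setLIntegral_congr_fun (hAm y) fun x hx => ?_
    have : b x = y := hx.2
    simp only [this]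
  simp only [e1, e2]
  exact hfin

theorem meas_bound {p q K : ℝ} (hq : 1 ≤ q) (hqp : q ≤ p)
    {φ : (EuclideanSpace ℝ (Fin n)) → (EuclideanSpace ℝ (Fin n))} {Ω Ω' : Set (EuclideanSpace ℝ (Fin n))} (hΩo : IsOpen Ω)
    (hcont : ContinuousOn φ Ω) (hinj : InjOn φ Ω) (hK0 : 0 ≤ K) (hK : CompBound p q K φ Ω Ω')
    {D : (EuclideanSpace ℝ (Fin n)) → ((EuclideanSpace ℝ (Fin n)) →L[ℝ] (EuclideanSpace ℝ (Fin n)))} (hJ : IsWeakJacobian φ D Ω)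
    {b : (EuclideanSpace ℝ (Fin n)) → EuclideanSpace ℝ (Fin n)} (hb : Measurable b)
    (hfin : ∫⁻ x in Ω, ‖b x‖ₑ ^ p * ENNReal.ofReal |(D x).det| ≠ ⊤) :
    (∫⁻ x in Ω, ‖ContinuousLinearMap.adjoint (D x) (b x)‖ₑ ^ q) ^ (1/q) ≤
      ENNReal.ofReal K * (∫⁻ x in Ω, ‖b x‖ₑ ^ p * ENNReal.ofReal |(D x).det|) ^ (1/p) := by
  have hp0 : 0 < p := by linarith
  have hq0 : 0 < q := by linarith
  have hDm : AEMeasurable D (volume.restrict Ω) := by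
    have := hJ.locInt.aestronglyMeasurable
    exact this.aemeasurable
  have hdm : AEMeasurable (fun x => ENNReal.ofReal |(D x).det|) (volume.restrict Ω) :=
    ENNReal.measurable_ofReal.comp_aemeasurable
      ((continuous_abs.comp ContinuousLinearMap.continuous_det).measurable.comp_aemeasurable hDm)
  set s : ℕ → SimpleFunc (EuclideanSpace ℝ (Fin n)) (EuclideanSpace ℝ (Fin n)) := SimpleFunc.approxOn b hb univ 0 (mem_univ _)
  have hst : ∀ x, Tendsto (fun k => s k x) atTop (𝓝 (b x)) := fun x =>
    SimpleFunc.tendsto_approxOn hb (mem_univ _) (by simp)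
  have hsn : ∀ x k, ‖s k x‖ₑ ≤ 2 * ‖b x‖ₑ := by
    intro x k
    have := SimpleFunc.norm_approxOn_zero_le hb (mem_univ (0 : EuclideanSpace ℝ (Fin n))) x k
    rw [two_mul, ← ofReal_norm, ← ofReal_norm, ← ENNReal.ofReal_add (norm_nonneg _) (norm_nonneg _)]
    exact ENNReal.ofReal_le_ofReal this
  have hRHS : Tendsto (fun k => ENNReal.ofReal K *
      (∫⁻ x in Ω, ‖s k x‖ₑ ^ p * ENNReal.ofReal |(D x).det|) ^ (1/p)) atTop
      (𝓝 (ENNReal.ofReal K * (∫⁻ x in Ω, ‖b x‖ₑ ^ p * ENNReal.ofReal |(D x).det|) ^ (1/p))) := by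
    refine ENNReal.Tendsto.const_mul ?_ (Or.inr ENNReal.ofReal_ne_top)
    refine Tendsto.ennrpow_const _ ?_
    refine tendsto_lintegral_of_dominated_convergence'
      (fun x => 2 ^ p * (‖b x‖ₑ ^ p * ENNReal.ofReal |(D x).det|)) (fun k => ?_) (fun k => ?_) ?_ ?_
    · exact ((s k).measurable.enorm.pow_const p).aemeasurable.mul hdm
    · refine Eventually.of_forall fun x => ?_
      beta_reduce
      rw [← mul_assoc, ← ENNReal.mul_rpow_of_nonneg _ _ hp0.le]
      gcongr
      exact hsn x k
    · rw [lintegral_const_mul' _ _ (ENNReal.rpow_lt_top_of_nonneg hp0.le (by norm_num)).ne]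
      exact ENNReal.mul_ne_top (ENNReal.rpow_lt_top_of_nonneg hp0.le (by norm_num)).ne hfin
    · refine Eventually.of_forall fun x => ?_
      refine ENNReal.Tendsto.mul_const ?_ (Or.inr ENNReal.ofReal_ne_top)
      exact Tendsto.ennrpow_const _ (hst x).enorm
  set R : ℕ → ℝ≥0∞ := fun k => ENNReal.ofReal K *
      (∫⁻ x in Ω, ‖s k x‖ₑ ^ p * ENNReal.ofReal |(D x).det|) ^ (1/p) with hR
  have hkey : ∀ k, ∫⁻ x in Ω, ‖ContinuousLinearMap.adjoint (D x) (s k x)‖ₑ ^ q ≤ R k ^ q := by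
    intro k
    have := simple_bound hq hqp hΩo hcont hinj hK0 hK hJ (s k)
    rw [one_div] at this
    exact (ENNReal.rpow_inv_le_iff hq0).1 this
  rw [one_div, ENNReal.rpow_inv_le_iff hq0]
  have hm : ∀ k, AEMeasurable (fun x => ‖ContinuousLinearMap.adjoint (D x) (s k x)‖ₑ ^ q)
      (volume.restrict Ω) := by
    intro k
    have h1 : AEMeasurable (fun x => ContinuousLinearMap.adjoint (D x)) (volume.restrict Ω) :=
      (LinearIsometryEquiv.continuous ContinuousLinearMap.adjoint).measurable.comp_aemeasurable hDm
    have h2 : AEMeasurable (fun x => ContinuousLinearMap.adjoint (D x) (s k x)) (volume.restrict Ω) :=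
      (isBoundedBilinearMap_apply (𝕜 := ℝ) (E := EuclideanSpace ℝ (Fin n)) (F := EuclideanSpace ℝ (Fin n))).continuous.measurable.comp_aemeasurable
        (h1.prodMk (s k).measurable.aemeasurable)
    exact h2.enorm.pow_const q
  calc ∫⁻ x in Ω, ‖ContinuousLinearMap.adjoint (D x) (b x)‖ₑ ^ q
      = ∫⁻ x in Ω, liminf (fun k => ‖ContinuousLinearMap.adjoint (D x) (s k x)‖ₑ ^ q) atTop := by
        refine lintegral_congr fun x => ?_
        refine (Tendsto.liminf_eq ?_).symm
        refine Tendsto.ennrpow_const _ (Tendsto.enorm ?_)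
        exact ((ContinuousLinearMap.adjoint (D x)).continuous.tendsto _).comp (hst x)
    _ ≤ liminf (fun k => ∫⁻ x in Ω, ‖ContinuousLinearMap.adjoint (D x) (s k x)‖ₑ ^ q) atTop :=
        lintegral_liminf_le' hm
    _ ≤ liminf (fun k => R k ^ q) atTop := liminf_le_liminf (Eventually.of_forall hkey)
    _ = _ := (Tendsto.ennrpow_const _ hRHS).liminf_eq

end PartIVc

end File10

section File11

open MeasureTheory Set Metric Filter
open scoped ENNReal Topology NNReal Convolution ContDiff


set_option linter.unusedSectionVars false
section PartV

variable {n : ℕ}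


lemma exists_direction {τ : ℝ} (hτ1 : τ < 1) :
    ∃ e : ((EuclideanSpace ℝ (Fin n)) →L[ℝ] (EuclideanSpace ℝ (Fin n))) → EuclideanSpace ℝ (Fin n), Measurable e ∧
      ∀ A, ‖e A‖ ≤ 1 ∧ τ * ‖A‖ ≤ ‖ContinuousLinearMap.adjoint A (e A)‖ := by
  classical
  set d : ℕ → EuclideanSpace ℝ (Fin n) := TopologicalSpace.denseSeq (EuclideanSpace ℝ (Fin n))
  set w : ℕ → EuclideanSpace ℝ (Fin n) := fun k => if ‖d k‖ ≤ 1 then d k else 0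
  have hw : ∀ k, ‖w k‖ ≤ 1 := by
    intro k
    simp only [w]
    split_ifs with h
    · exact h
    · simp
  have hex : ∀ A : (EuclideanSpace ℝ (Fin n)) →L[ℝ] (EuclideanSpace ℝ (Fin n)), ∃ k, τ * ‖A‖ ≤ ‖ContinuousLinearMap.adjoint A (w k)‖ := by
    intro A
    by_cases hA : A = 0
    · exact ⟨0, by simp [hA]⟩
    have hpos : 0 < ‖A‖ := norm_pos_iff.2 hA
    have hlt : τ * ‖A‖ < ‖ContinuousLinearMap.adjoint A‖ := by
      rw [LinearIsometryEquiv.norm_map]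
      nlinarith
    obtain ⟨x, hx1, hx2⟩ := ContinuousLinearMap.exists_lt_apply_of_lt_opNorm _ hlt
    have ho : IsOpen {x : EuclideanSpace ℝ (Fin n) | ‖x‖ < 1 ∧ τ * ‖A‖ < ‖ContinuousLinearMap.adjoint A x‖} :=
      (isOpen_lt continuous_norm continuous_const).inter
        (isOpen_lt continuous_const (ContinuousLinearMap.adjoint A).continuous.norm)
    obtain ⟨k, hk⟩ := (TopologicalSpace.denseRange_denseSeq (EuclideanSpace ℝ (Fin n))).exists_mem_open ho ⟨x, hx1, hx2⟩
    refine ⟨k, ?_⟩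
    have : w k = d k := if_pos hk.1.le
    rw [this]
    exact hk.2.le
  refine ⟨fun A => w (Nat.find (hex A)), ?_, fun A => ⟨hw _, Nat.find_spec (hex A)⟩⟩
  refine (measurable_from_nat (f := w)).comp (measurable_find hex fun k => ?_)
  refine (isClosed_le (continuous_const.mul continuous_norm) ?_).measurableSet
  refine Continuous.norm ?_
  exact (ContinuousLinearMap.apply ℝ (EuclideanSpace ℝ (Fin n)) (w k)).continuous.comp
    (LinearIsometryEquiv.continuous ContinuousLinearMap.adjoint)

/-- The key inequality satisfied by all admissible vector fields. -/
def KeyIneq (p q : ℝ) (k : ℝ≥0∞) (μ : Measure (EuclideanSpace ℝ (Fin n))) (D : (EuclideanSpace ℝ (Fin n)) → (EuclideanSpace ℝ (Fin n)) →L[ℝ] (EuclideanSpace ℝ (Fin n))) : Prop :=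
  ∀ b : (EuclideanSpace ℝ (Fin n)) → EuclideanSpace ℝ (Fin n), Measurable b →
    ∫⁻ x, ‖b x‖ₑ ^ p * ENNReal.ofReal |(D x).det| ∂μ ≠ ⊤ →
    (∫⁻ x, ‖ContinuousLinearMap.adjoint (D x) (b x)‖ₑ ^ q ∂μ) ^ (1/q) ≤
      k * (∫⁻ x, ‖b x‖ₑ ^ p * ENNReal.ofReal |(D x).det| ∂μ) ^ (1/p)

lemma adj_meas {D : (EuclideanSpace ℝ (Fin n)) → (EuclideanSpace ℝ (Fin n)) →L[ℝ] (EuclideanSpace ℝ (Fin n))} (hD : Measurable D) {b : (EuclideanSpace ℝ (Fin n)) → EuclideanSpace ℝ (Fin n)}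
    (hb : Measurable b) : Measurable fun x => ContinuousLinearMap.adjoint (D x) (b x) :=
  (isBoundedBilinearMap_apply (𝕜 := ℝ) (E := EuclideanSpace ℝ (Fin n)) (F := EuclideanSpace ℝ (Fin n))).continuous.measurable.comp
    (((LinearIsometryEquiv.continuous ContinuousLinearMap.adjoint).measurable.comp hD).prodMk hb)

lemma key_finite_distortion {p q : ℝ} (hp0 : 0 < p) (hq0 : 0 < q) {k : ℝ≥0∞} {μ : Measure (EuclideanSpace ℝ (Fin n))}
    {D : (EuclideanSpace ℝ (Fin n)) → (EuclideanSpace ℝ (Fin n)) →L[ℝ] (EuclideanSpace ℝ (Fin n))} (hD : Measurable D) (H : KeyIneq p q k μ D) :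
    ∀ᵐ x ∂μ, (D x).det = 0 → D x = 0 := by
  obtain ⟨e, hem, he⟩ := exists_direction (n := n) (τ := 1/2) (by norm_num)
  have hdm : Measurable fun x => (D x).det := ContinuousLinearMap.continuous_det.measurable.comp hD
  set Z : Set (EuclideanSpace ℝ (Fin n)) := {x | (D x).det = 0}
  have hZ : MeasurableSet Z := measurableSet_eq_fun hdm measurable_const
  have hbm : Measurable (Z.indicator fun x => e (D x)) := (hem.comp hD).indicator hZ
  have h0 : ∫⁻ x, ‖Z.indicator (fun x => e (D x)) x‖ₑ ^ p * ENNReal.ofReal |(D x).det| ∂μ = 0 := by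
    rw [← lintegral_zero (μ := μ)]
    refine lintegral_congr fun x => ?_
    by_cases hx : x ∈ Z
    · have : (D x).det = 0 := hx
      simp [this]
    · simp [indicator_of_notMem hx, hp0]
  have h1 := H _ hbm (by rw [h0]; simp)
  rw [h0, ENNReal.zero_rpow_of_pos (by positivity), mul_zero, nonpos_iff_eq_zero,
    ENNReal.rpow_eq_zero_iff_of_pos (by positivity),
    lintegral_eq_zero_iff ((adj_meas hD hbm).enorm.pow_const q)] at h1
  filter_upwards [h1] with x hx hdet
  have hxZ : x ∈ Z := hdet
  simp only [Pi.zero_apply, ENNReal.rpow_eq_zero_iff_of_pos hq0, indicator_of_mem hxZ,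
    enorm_eq_zero] at hx
  have := (he (D x)).2
  rw [hx, norm_zero] at this
  exact norm_le_zero_iff.1 (by linarith)

lemma dist_pos_eq {p : ℝ} (D : (EuclideanSpace ℝ (Fin n)) → (EuclideanSpace ℝ (Fin n)) →L[ℝ] (EuclideanSpace ℝ (Fin n))) (x : EuclideanSpace ℝ (Fin n)) (h : (D x).det ≠ 0) :
    distortionFn p D x = ‖D x‖ / |(D x).det| ^ (1/p) := if_pos h

lemma dist_zero_eq {p : ℝ} (D : (EuclideanSpace ℝ (Fin n)) → (EuclideanSpace ℝ (Fin n)) →L[ℝ] (EuclideanSpace ℝ (Fin n))) (x : EuclideanSpace ℝ (Fin n)) (h : (D x).det = 0) :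
    distortionFn p D x = 0 := if_neg (not_not.2 h)

lemma key_norm_eq {p q : ℝ} (hp0 : 0 < p) (hqp : q = p) {k : ℝ≥0∞} (hk0 : k ≠ 0) (hkt : k ≠ ⊤)
    {μ : Measure (EuclideanSpace ℝ (Fin n))} [SigmaFinite μ]
    {D : (EuclideanSpace ℝ (Fin n)) → (EuclideanSpace ℝ (Fin n)) →L[ℝ] (EuclideanSpace ℝ (Fin n))} (hD : Measurable D) (H : KeyIneq p q k μ D)
    {τ : ℝ} (hτ0 : 0 < τ) (hτ1 : τ < 1) :
    ENNReal.ofReal τ * eLpNorm (distortionFn p D) ⊤ μ ≤ k := by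
  subst hqp
  obtain ⟨e, hem, he⟩ := exists_direction (n := n) hτ1
  have hdm : Measurable fun x => (D x).det := ContinuousLinearMap.continuous_det.measurable.comp hD
  have hJm : Measurable fun x => ENNReal.ofReal |(D x).det| := by fun_prop
  have key : ∀ᵐ x ∂μ, (ENNReal.ofReal τ * ‖D x‖ₑ) ^ q ≤ k ^ q * ENNReal.ofReal |(D x).det| := by
    refine ae_le_of_forall_setLIntegral_le_of_sigmaFinite ?_ ?_
    · exact (hD.enorm.const_mul _).pow_const q
    intro s hs _
    rw [lintegral_const_mul _ hJm]
    by_cases hfin : ∫⁻ x in s, ENNReal.ofReal |(D x).det| ∂μ = ⊤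
    · rw [hfin, ENNReal.mul_top]
      · exact le_top
      · exact (ENNReal.rpow_pos (pos_iff_ne_zero.2 hk0) hkt).ne'
    have hbm : Measurable (s.indicator fun x => e (D x)) := (hem.comp hD).indicator hs
    have hle : ∫⁻ x, ‖s.indicator (fun x => e (D x)) x‖ₑ ^ q * ENNReal.ofReal |(D x).det| ∂μ ≤
        ∫⁻ x in s, ENNReal.ofReal |(D x).det| ∂μ := by
      rw [← lintegral_indicator hs]
      refine lintegral_mono fun x => ?_
      by_cases hx : x ∈ s
      · simp only [indicator_of_mem hx]
        refine mul_le_of_le_one_left bot_le (ENNReal.rpow_le_one ?_ hp0.le)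
        rw [← ofReal_norm]
        exact ENNReal.ofReal_le_one.2 (he (D x)).1
      · simp [indicator_of_notMem hx, hp0]
    have h1 := H _ hbm (ne_top_of_le_ne_top hfin hle)
    have h2 : ∫⁻ x in s, (ENNReal.ofReal τ * ‖D x‖ₑ) ^ q ∂μ ≤
        ∫⁻ x, ‖ContinuousLinearMap.adjoint (D x) (s.indicator (fun x => e (D x)) x)‖ₑ ^ q ∂μ := by
      rw [← lintegral_indicator hs]
      refine lintegral_mono fun x => ?_
      by_cases hx : x ∈ s
      · simp only [indicator_of_mem hx]
        refine ENNReal.rpow_le_rpow ?_ hp0.le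
        rw [← ofReal_norm, ← ofReal_norm, ← ENNReal.ofReal_mul hτ0.le]
        exact ENNReal.ofReal_le_ofReal (he (D x)).2
      · simp [indicator_of_notMem hx]
    rw [one_div, ENNReal.rpow_inv_le_iff hp0, ENNReal.mul_rpow_of_nonneg _ _ hp0.le,
      ENNReal.rpow_inv_rpow hp0.ne'] at h1
    exact h2.trans (h1.trans (by gcongr))
  have hbd : ∀ᵐ x ∂μ, ‖distortionFn q D x‖ₑ ≤ k / ENNReal.ofReal τ := by
    filter_upwards [key] with x hx
    by_cases hdet : (D x).det = 0
    · rw [dist_zero_eq D x hdet]; simp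
    have hpos : 0 < |(D x).det| := abs_pos.2 hdet
    rw [ENNReal.le_div_iff_mul_le (Or.inl (by simpa using hτ0)) (Or.inl ENNReal.ofReal_ne_top),
      dist_pos_eq D x hdet, Real.enorm_of_nonneg (by positivity),
      ENNReal.ofReal_div_of_pos (by positivity), ofReal_norm, mul_comm, ← mul_div_assoc]
    refine ENNReal.div_le_of_le_mul ?_
    rw [← ENNReal.ofReal_rpow_of_pos hpos]
    have := ENNReal.rpow_le_rpow (z := q⁻¹) hx (by positivity)
    rw [ENNReal.rpow_rpow_inv hp0.ne', ENNReal.mul_rpow_of_nonneg _ _ (by positivity),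
      ENNReal.rpow_rpow_inv hp0.ne'] at this
    rwa [one_div]
  rw [eLpNorm_exponent_top]
  have h3 : eLpNormEssSup (distortionFn q D) μ ≤ k / ENNReal.ofReal τ := essSup_le_of_ae_le _ hbd
  rw [ENNReal.le_div_iff_mul_le (Or.inl (by simpa using hτ0)) (Or.inl ENNReal.ofReal_ne_top)] at h3
  rwa [mul_comm]

lemma real_aux {p q r N d κ : ℝ} (hp0 : 0 < p) (hq0 : 0 < q) (hr0 : 0 < r)
    (hr : 1/q = 1/p + 1/r) (hN : 0 ≤ N) (hd : 0 < d) (hκ : κ = N / d ^ (1/p)) :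
    ((κ ^ r / d) ^ (1/p)) ^ p * d = κ ^ r ∧ (κ ^ r / d) ^ (1/p) * N = κ ^ (r/q) := by
  have hκ0 : 0 ≤ κ := by rw [hκ]; positivity
  constructor
  · rw [← Real.rpow_mul (by positivity), one_div_mul_cancel hp0.ne', Real.rpow_one]
    field_simp
  · have hd0 : 0 < d ^ (1/p) := by positivity
    have hN' : N = κ * d ^ (1/p) := by rw [hκ]; field_simp
    have e : r / q = r * (1/p) + 1 := by
      have : r / q = r * (1/q) := by ring
      rw [this, hr]; field_simp
    rw [e, Real.rpow_add_of_nonneg hκ0 (by positivity) zero_le_one, Real.rpow_one,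
      Real.div_rpow (by positivity) hd.le, ← Real.rpow_mul hκ0, hN']
    field_simp

lemma key_norm_lt {p q r : ℝ} (hp0 : 0 < p) (hq0 : 0 < q) (hr0 : 0 < r)
    (hr : 1/q = 1/p + 1/r) {k : ℝ≥0∞}
    {μ : Measure (EuclideanSpace ℝ (Fin n))} [SigmaFinite μ]
    {D : (EuclideanSpace ℝ (Fin n)) → (EuclideanSpace ℝ (Fin n)) →L[ℝ] (EuclideanSpace ℝ (Fin n))} (hD : Measurable D) (H : KeyIneq p q k μ D)
    {τ : ℝ} (hτ0 : 0 < τ) (hτ1 : τ < 1) :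
    ENNReal.ofReal τ * eLpNorm (distortionFn p D) (ENNReal.ofReal r) μ ≤ k := by
  obtain ⟨e, hem, he⟩ := exists_direction (n := n) hτ1
  have hdm : Measurable fun x => (D x).det := ContinuousLinearMap.continuous_det.measurable.comp hD
  set κ := distortionFn p D with hκ
  have hκm : Measurable κ := (kp_measurable p).comp hD
  have hκ0 : ∀ x, 0 ≤ κ x := distortionFn_nonneg p D
  set T : ℕ → Set (EuclideanSpace ℝ (Fin n)) := fun m => {x | κ x ≤ m} ∩ spanningSets μ m with hT
  have hTm : ∀ m, MeasurableSet (T m) := fun m =>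
    (measurableSet_le hκm measurable_const).inter (measurableSet_spanningSets μ m)
  set g : (EuclideanSpace ℝ (Fin n)) → ℝ := fun x => (κ x ^ r / |(D x).det|) ^ (1/p) with hg
  have hgm : Measurable g := by fun_prop
  have hg0 : ∀ x, 0 ≤ g x := fun x => by have := hκ0 x; positivity
  have hstep : ∀ m, ENNReal.ofReal τ * (∫⁻ x in T m, ‖κ x‖ₑ ^ r ∂μ) ^ (1/r) ≤ k := by
    intro m
    set I := ∫⁻ x in T m, ‖κ x‖ₑ ^ r ∂μ with hI
    have hIt : I ≠ ⊤ := by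
      have h1 : I ≤ ∫⁻ x in T m, (ENNReal.ofReal m) ^ r ∂μ := by
        refine setLIntegral_mono' (hTm m) fun x hx => ?_
        refine ENNReal.rpow_le_rpow ?_ hr0.le
        rw [Real.enorm_of_nonneg (hκ0 x)]
        exact ENNReal.ofReal_le_ofReal hx.1
      refine ne_top_of_le_ne_top ?_ h1
      rw [setLIntegral_const]
      refine ENNReal.mul_ne_top (ENNReal.rpow_lt_top_of_nonneg hr0.le ENNReal.ofReal_ne_top).ne ?_
      exact ((measure_mono inter_subset_right).trans_lt (measure_spanningSets_lt_top μ m)).ne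
    set b : (EuclideanSpace ℝ (Fin n)) → EuclideanSpace ℝ (Fin n) := (T m).indicator fun x => g x • e (D x)
    have hbm : Measurable b := (hgm.smul (hem.comp hD)).indicator (hTm m)
    have hle : ∫⁻ x, ‖b x‖ₑ ^ p * ENNReal.ofReal |(D x).det| ∂μ ≤ I := by
      rw [hI, ← lintegral_indicator (hTm m)]
      refine lintegral_mono fun x => ?_
      by_cases hx : x ∈ T m
      · simp only [b, indicator_of_mem hx]
        by_cases hdet : (D x).det = 0
        · simp [hdet]
        have hpos : 0 < |(D x).det| := abs_pos.2 hdet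
        have h1 := (real_aux hp0 hq0 hr0 hr (norm_nonneg (D x)) hpos (dist_pos_eq D x hdet)).1
        have h2 : ‖g x • e (D x)‖ₑ ≤ ENNReal.ofReal (g x) := by
          rw [← ofReal_norm, norm_smul, Real.norm_of_nonneg (hg0 x)]
          exact ENNReal.ofReal_le_ofReal (mul_le_of_le_one_right (hg0 x) (he (D x)).1)
        calc ‖g x • e (D x)‖ₑ ^ p * ENNReal.ofReal |(D x).det|
            ≤ ENNReal.ofReal (g x) ^ p * ENNReal.ofReal |(D x).det| := by gcongr
          _ = ENNReal.ofReal (g x ^ p * |(D x).det|) := by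
            rw [ENNReal.ofReal_rpow_of_nonneg (hg0 x) hp0.le, ENNReal.ofReal_mul (Real.rpow_nonneg (hg0 x) _)]
          _ = ENNReal.ofReal (κ x ^ r) := by rw [← h1]
          _ = ‖κ x‖ₑ ^ r := by
            rw [Real.enorm_of_nonneg (hκ0 x), ENNReal.ofReal_rpow_of_nonneg (hκ0 x) hr0.le]
      · simp [b, indicator_of_notMem hx, hp0]
    have hge : ENNReal.ofReal τ ^ q * I ≤
        ∫⁻ x, ‖ContinuousLinearMap.adjoint (D x) (b x)‖ₑ ^ q ∂μ := by
      rw [hI, ← lintegral_const_mul' _ _ (ENNReal.rpow_lt_top_of_nonneg hq0.le ENNReal.ofReal_ne_top).ne,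
        ← lintegral_indicator (hTm m)]
      refine lintegral_mono fun x => ?_
      by_cases hx : x ∈ T m
      · simp only [b, indicator_of_mem hx]
        by_cases hdet : (D x).det = 0
        · simp [hκ, dist_zero_eq D x hdet, hr0]
        have hpos : 0 < |(D x).det| := abs_pos.2 hdet
        have h1 := (real_aux hp0 hq0 hr0 hr (norm_nonneg (D x)) hpos (dist_pos_eq D x hdet)).2
        have h2 : τ * κ x ^ (r/q) ≤ ‖ContinuousLinearMap.adjoint (D x) (g x • e (D x))‖ := by
          rw [map_smul, norm_smul, Real.norm_of_nonneg (hg0 x)]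
          calc τ * κ x ^ (r/q) = g x * (τ * ‖D x‖) := by rw [hκ, ← h1]; ring
            _ ≤ _ := mul_le_mul_of_nonneg_left (he (D x)).2 (hg0 x)
        have h3 : ‖κ x‖ₑ ^ r = ENNReal.ofReal (κ x ^ (r/q)) ^ q := by
          rw [Real.enorm_of_nonneg (hκ0 x), ENNReal.ofReal_rpow_of_nonneg (hκ0 x) hr0.le,
            ENNReal.ofReal_rpow_of_nonneg (Real.rpow_nonneg (hκ0 x) _) hq0.le,
            ← Real.rpow_mul (hκ0 x), div_mul_cancel₀ _ hq0.ne']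
        rw [h3, ← ENNReal.mul_rpow_of_nonneg _ _ hq0.le, ← ENNReal.ofReal_mul hτ0.le, ← ofReal_norm]
        exact ENNReal.rpow_le_rpow (ENNReal.ofReal_le_ofReal h2) hq0.le
      · simp [indicator_of_notMem hx]
    have h1 := H b hbm (ne_top_of_le_ne_top hIt hle)
    have h2 : ENNReal.ofReal τ * I ^ (1/q) ≤ k * I ^ (1/p) := by
      have e1 : ENNReal.ofReal τ * I ^ (1/q) = (ENNReal.ofReal τ ^ q * I) ^ (1/q) := by
        rw [ENNReal.mul_rpow_of_nonneg _ _ (by positivity), one_div, ENNReal.rpow_rpow_inv hq0.ne']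
      rw [e1]
      calc _ ≤ _ := ENNReal.rpow_le_rpow hge (by positivity)
        _ ≤ _ := h1
        _ ≤ _ := by gcongr
    by_cases hI0 : I = 0
    · rw [hI0, ENNReal.zero_rpow_of_pos (by positivity), mul_zero]; exact bot_le
    rw [hr, ENNReal.rpow_add _ _ hI0 hIt, mul_comm (I ^ (1/p)), ← mul_assoc] at h2
    have hIp0 : I ^ (1/p) ≠ 0 := (ENNReal.rpow_pos (pos_iff_ne_zero.2 hI0) hIt).ne'
    have hIpt : I ^ (1/p) ≠ ⊤ := (ENNReal.rpow_lt_top_of_nonneg (by positivity) hIt).ne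
    exact (ENNReal.mul_le_mul_iff_left hIp0 hIpt).1 h2
  have hmono : Monotone T := by
    intro i j hij x hx
    have h1 : κ x ≤ i := hx.1
    have h2 : (i : ℝ) ≤ j := Nat.cast_le.2 hij
    refine ⟨h1.trans h2, monotone_spanningSets μ hij hx.2⟩
  have hU : ⋃ m, T m = univ := by
    refine eq_univ_of_forall fun x => ?_
    obtain ⟨m1, h1⟩ := exists_nat_ge (κ x)
    have h2 : x ∈ ⋃ m, spanningSets μ m := by rw [iUnion_spanningSets]; trivial
    obtain ⟨m2, h2⟩ := mem_iUnion.1 h2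
    refine mem_iUnion.2 ⟨max m1 m2, ?_, monotone_spanningSets μ (le_max_right _ _) h2⟩
    exact h1.trans (by exact_mod_cast le_max_left _ _)
  have hlim : Tendsto (fun m => ∫⁻ x in T m, ‖κ x‖ₑ ^ r ∂μ) atTop (𝓝 (∫⁻ x, ‖κ x‖ₑ ^ r ∂μ)) := by
    have h1 := tendsto_measure_iUnion_atTop (μ := μ.withDensity fun x => ‖κ x‖ₑ ^ r) hmono
    rw [hU, withDensity_apply _ MeasurableSet.univ, Measure.restrict_univ] at h1
    exact h1.congr fun m => withDensity_apply _ (hTm m)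
  rw [eLpNorm_eq_lintegral_rpow_enorm_toReal (by simpa using hr0) (by simp), ENNReal.toReal_ofReal hr0.le]
  refine le_of_tendsto' (ENNReal.Tendsto.const_mul (Tendsto.ennrpow_const (1/r) hlim)
    (Or.inr ENNReal.ofReal_ne_top)) hstep

lemma key_norm {p q : ℝ} (hq : 1 ≤ q) (hqp : q ≤ p) {k : ℝ≥0∞} (hk0 : k ≠ 0) (hkt : k ≠ ⊤)
    {μ : Measure (EuclideanSpace ℝ (Fin n))} [SigmaFinite μ]
    {D : (EuclideanSpace ℝ (Fin n)) → (EuclideanSpace ℝ (Fin n)) →L[ℝ] (EuclideanSpace ℝ (Fin n))} (hD : Measurable D) (H : KeyIneq p q k μ D) :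
    eLpNorm (distortionFn p D) (sigmaExp p q) μ ≤ k := by
  have hp0 : 0 < p := by linarith
  have hq0 : 0 < q := by linarith
  have hτ : ∀ τ : ℝ, 0 < τ → τ < 1 →
      ENNReal.ofReal τ * eLpNorm (distortionFn p D) (sigmaExp p q) μ ≤ k := by
    intro τ h0 h1
    unfold sigmaExp
    split_ifs with h
    · exact key_norm_eq hp0 h hk0 hkt hD H h0 h1
    · have hlt : q < p := lt_of_le_of_ne hqp h
      have h2 : 0 < 1/q - 1/p := sub_pos.2 (one_div_lt_one_div_of_lt hq0 hlt)
      refine key_norm_lt hp0 hq0 (by positivity) ?_ hD H h0 h1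
      rw [one_div_one_div]; ring
  have hlim : Tendsto (fun τ : ℝ => ENNReal.ofReal τ * eLpNorm (distortionFn p D) (sigmaExp p q) μ)
      (𝓝[<] 1) (𝓝 (ENNReal.ofReal 1 * eLpNorm (distortionFn p D) (sigmaExp p q) μ)) := by
    refine ENNReal.Tendsto.mul_const ?_ (Or.inl (by simp))
    exact (ENNReal.continuous_ofReal.tendsto 1).mono_left nhdsWithin_le_nhds
  rw [ENNReal.ofReal_one, one_mul] at hlim
  refine le_of_tendsto hlim ?_
  have h0 : ∀ᶠ τ : ℝ in 𝓝[<] 1, 0 < τ :=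
    mem_nhdsWithin_of_mem_nhds (Ioi_mem_nhds one_pos)
  filter_upwards [h0, self_mem_nhdsWithin] with τ h1 h2
  exact hτ τ h1 h2

theorem necessity {p q K : ℝ} (hq : 1 ≤ q) (hqp : q ≤ p)
    {φ : (EuclideanSpace ℝ (Fin n)) → (EuclideanSpace ℝ (Fin n))} {Ω Ω' : Set (EuclideanSpace ℝ (Fin n))} (hΩo : IsOpen Ω)
    (hcont : ContinuousOn φ Ω) (hinj : InjOn φ Ω) (hK0 : 0 ≤ K) (hK : CompBound p q K φ Ω Ω')
    {D : (EuclideanSpace ℝ (Fin n)) → ((EuclideanSpace ℝ (Fin n)) →L[ℝ] (EuclideanSpace ℝ (Fin n)))} (hJ : IsWeakJacobian φ D Ω) :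
    (∀ᵐ x ∂(volume.restrict Ω), (D x).det = 0 → D x = 0) ∧
      eLpNorm (distortionFn p D) (sigmaExp p q) (volume.restrict Ω) ≤ ENNReal.ofReal K := by
  have hp0 : 0 < p := by linarith
  have hq0 : 0 < q := by linarith
  have hDm : AEMeasurable D (volume.restrict Ω) := by
    have := hJ.locInt.aestronglyMeasurable
    exact this.aemeasurable
  have hae := hDm.ae_eq_mk
  have hkey : KeyIneq p q (ENNReal.ofReal K) (volume.restrict Ω) (hDm.mk D) := by
    intro b hb hfin
    have e1 : ∫⁻ x in Ω, ‖b x‖ₑ ^ p * ENNReal.ofReal |(hDm.mk D x).det| =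
        ∫⁻ x in Ω, ‖b x‖ₑ ^ p * ENNReal.ofReal |(D x).det| := by
      refine lintegral_congr_ae ?_
      filter_upwards [hae] with x hx
      rw [hx]
    have e2 : ∫⁻ x in Ω, ‖ContinuousLinearMap.adjoint (hDm.mk D x) (b x)‖ₑ ^ q =
        ∫⁻ x in Ω, ‖ContinuousLinearMap.adjoint (D x) (b x)‖ₑ ^ q := by
      refine lintegral_congr_ae ?_
      filter_upwards [hae] with x hx
      rw [hx]
    rw [e1] at hfin
    rw [e1, e2]
    exact meas_bound hq hqp hΩo hcont hinj hK0 hK hJ hb hfin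
  constructor
  · filter_upwards [hae, key_finite_distortion hp0 hq0 hDm.measurable_mk hkey] with x hx h
    rw [hx]; exact h
  · have e : eLpNorm (distortionFn p D) (sigmaExp p q) (volume.restrict Ω) =
        eLpNorm (distortionFn p (hDm.mk D)) (sigmaExp p q) (volume.restrict Ω) := by
      refine eLpNorm_congr_ae ?_
      filter_upwards [hae] with x hx
      unfold distortionFn
      rw [hx]
    rw [e]
    have hlim : Tendsto (fun t : ℝ => ENNReal.ofReal t) (𝓝[>] K) (𝓝 (ENNReal.ofReal K)) :=
      (ENNReal.continuous_ofReal.tendsto K).mono_left nhdsWithin_le_nhds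
    refine ge_of_tendsto hlim ?_
    filter_upwards [self_mem_nhdsWithin] with t ht
    have ht' : K < t := ht
    refine key_norm hq hqp (by simpa using hK0.trans_lt ht') ENNReal.ofReal_ne_top hDm.measurable_mk ?_
    intro b hb hfin
    refine (hkey b hb hfin).trans ?_
    gcongr

end PartV

end File11

/-- A homeomorphism `φ : Ω → Ω'` of domains in `ℝⁿ` induces a bounded
composition operator `L¹_p(Ω') ∩ Lip_loc(Ω') → L¹_q(Ω)` iff `φ ∈ W¹_{q,loc}`, has finite
distortion, and `K_p(·,φ) ∈ L_σ(Ω)`; moreover the operator norm equals `‖K_p(·,φ)‖_{L_σ}`. -/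
theorem composition_operator_characterization
    {n : ℕ} (hn : 0 < n)
    (Ω Ω' : Set (EuclideanSpace ℝ (Fin n)))
    (hΩo : IsOpen Ω) (hΩc : IsConnected Ω) (hΩ'o : IsOpen Ω') (hΩ'c : IsConnected Ω')
    (p q : ℝ) (hq : 1 ≤ q) (hqp : q ≤ p)
    (φ : EuclideanSpace ℝ (Fin n) → EuclideanSpace ℝ (Fin n))
    (hbij : Set.BijOn φ Ω Ω') (hcont : ContinuousOn φ Ω)
    (hopen : ∀ U : Set (EuclideanSpace ℝ (Fin n)), IsOpen U → U ⊆ Ω → IsOpen (φ '' U)) :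
    ((∃ K : ℝ, 0 ≤ K ∧ CompBound p q K φ Ω Ω') ↔
      (∃ D : EuclideanSpace ℝ (Fin n) →
          (EuclideanSpace ℝ (Fin n) →L[ℝ] EuclideanSpace ℝ (Fin n)),
        IsWeakJacobian φ D Ω ∧
        (∀ Kc : Set (EuclideanSpace ℝ (Fin n)), Kc ⊆ Ω → IsCompact Kc →
          IntegrableOn (fun x => ‖D x‖ ^ q) Kc volume) ∧
        (∀ᵐ x ∂(volume.restrict Ω),
          LinearMap.det ((D x) : EuclideanSpace ℝ (Fin n) →ₗ[ℝ] EuclideanSpace ℝ (Fin n)) = 0 →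
            D x = 0) ∧
        eLpNorm (distortionFn p D) (sigmaExp p q) (volume.restrict Ω) < ⊤)) ∧
    (∀ D : EuclideanSpace ℝ (Fin n) →
        (EuclideanSpace ℝ (Fin n) →L[ℝ] EuclideanSpace ℝ (Fin n)),
      IsWeakJacobian φ D Ω →
      (∀ Kc : Set (EuclideanSpace ℝ (Fin n)), Kc ⊆ Ω → IsCompact Kc →
        IntegrableOn (fun x => ‖D x‖ ^ q) Kc volume) →
      (∀ᵐ x ∂(volume.restrict Ω),
        LinearMap.det ((D x) : EuclideanSpace ℝ (Fin n) →ₗ[ℝ] EuclideanSpace ℝ (Fin n)) = 0 →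
          D x = 0) →
      eLpNorm (distortionFn p D) (sigmaExp p q) (volume.restrict Ω) < ⊤ →
      sInf {K : ℝ | 0 ≤ K ∧ CompBound p q K φ Ω Ω'} =
        (eLpNorm (distortionFn p D) (sigmaExp p q) (volume.restrict Ω)).toReal) := by
  refine ⟨⟨?_, ?_⟩, ?_⟩
  · rintro ⟨K, hK0, hK⟩
    obtain ⟨D, hJ, hDq⟩ := exists_weakJacobian Ω Ω' hΩo p q hq hqp φ hcont hK
    have h := necessity hq hqp hΩo hcont hbij.injOn hK0 hK hJ
    exact ⟨D, hJ, hDq, h.1, h.2.trans_lt ENNReal.ofReal_lt_top⟩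
  · rintro ⟨D, hJ, -, hdist, hfin⟩
    exact ⟨_, ENNReal.toReal_nonneg,
      compBound_of_distortion Ω Ω' hΩo hΩ'o p q hq hqp φ hbij hcont D hJ hdist hfin⟩
  · intro D hJ _ hdist hfin
    refine IsLeast.csInf_eq ⟨⟨ENNReal.toReal_nonneg,
      compBound_of_distortion Ω Ω' hΩo hΩ'o p q hq hqp φ hbij hcont D hJ hdist hfin⟩, ?_⟩
    rintro K ⟨hK0, hK⟩
    have h := (necessity hq hqp hΩo hcont hbij.injOn hK0 hK hJ).2
    exact ENNReal.toReal_le_of_le_ofReal hK0 h
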